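/- Let ρ_max = 1, v(ρ) = 1 − ρ and c(ρ) = 1/(1 − ρ). If the initial datum ρ̄ belongs to BV((−1,1);[0,1]), satisfies ‖ρ̄‖_{L^∞} < 1 and satisfies the smallness condition 3‖ρ̄‖_{L^∞} + TV(c∘ρ̄) + [c(ρ̄(−1⁺)) − c(1/2)]₊ + [c(ρ̄(1⁻)) − c(1/2)]₊ < 2, where ρ̄(−1⁺) and ρ̄(1⁻) denote the one-sided limits of ρ̄ at the endpoints (which exist since ρ̄ ∈ BV) and [x]₊ = max{x,0}, then there exists a BV-regular entropy solution of Hughes' model with initial datum ρ̄ defined globally in time. -/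

import Mathlib

open MeasureTheory Set Filter

noncomputable section

/-- The flux `f(ρ) = ρ·v(ρ)`. -/
def hughesFlux (v : ℝ → ℝ) (r : ℝ) : ℝ := r * v r

/-- The discontinuous flux `F(t,x,ρ,ξ) = sign(x − ξ(t))·f(ρ)`. -/
def hughesF (v : ℝ → ℝ) (ξ : ℝ → ℝ) (t x r : ℝ) : ℝ :=
  Real.sign (x - ξ t) * hughesFlux v r

/-- The Kruzhkov-type entropy flux `𝓕(t,x,ρ,k,ξ)`. -/
def hughesKruzhkov (v : ℝ → ℝ) (ξ : ℝ → ℝ) (t x r k : ℝ) : ℝ :=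
  Real.sign (r - k) * (hughesF v ξ t x r - hughesF v ξ t x k)

/-- Entropy solution of Hughes' model on `C = (−1,1)` with speed `v`, cost `c`,
maximal density `ρmax` and initial datum `ρ₀` (extended by `0` outside `C`). -/
structure IsEntropySol (ρmax : ℝ) (v c : ℝ → ℝ) (ρ₀ : ℝ → ℝ)
    (ρ : ℝ → ℝ → ℝ) (ξ : ℝ → ℝ) : Prop where
  meas : Measurable (Function.uncurry ρ)
  range : ∀ t x : ℝ, 0 ≤ t → ρ t x ∈ Icc 0 ρmax
  integrable : ∀ t : ℝ, 0 ≤ t → Integrable (ρ t)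
  timeCont : ∀ s : ℝ, 0 ≤ s →
    Tendsto (fun t => ∫ x : ℝ, |ρ t x - ρ s x|) (nhdsWithin s (Ici 0)) (nhds 0)
  init : ∀ᵐ x : ℝ, ρ 0 x = if x ∈ Ioo (-1 : ℝ) 1 then ρ₀ x else 0
  xi_mem : ∀ t : ℝ, ξ t ∈ Ioo (-1 : ℝ) 1
  xi_lip : ∃ L : NNReal, LipschitzOnWith L ξ (Ici 0)
  balance : ∀ᵐ t ∂(volume.restrict (Ioi (0 : ℝ))),
    ∫ y in Ioo (-1 : ℝ) (ξ t), c (ρ t y) = ∫ y in Ioo (ξ t) 1, c (ρ t y)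
  entropy : ∀ k ∈ Icc (0 : ℝ) ρmax, ∀ φ : ℝ × ℝ → ℝ,
    ContDiff ℝ (⊤ : ℕ∞) φ → HasCompactSupport φ →
    (∀ p : ℝ × ℝ, p.1 ≤ 0 → φ p = 0) → (∀ p : ℝ × ℝ, 0 ≤ φ p) →
    0 ≤ (∫ t in Ioi (0 : ℝ), ∫ x : ℝ,
          (|ρ t x - k| * (fderiv ℝ φ (t, x)) (1, 0)
            + hughesKruzhkov v ξ t x (ρ t x) k * (fderiv ℝ φ (t, x)) (0, 1)))
        + 2 * ∫ t in Ioi (0 : ℝ), hughesFlux v k * φ (t, ξ t)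

/-- BV-regular entropy solution: in addition `ρ ∈ L^∞([0,T]; BV((−1,1)))` for all `T > 0`. -/
def IsBVEntropySol (ρmax : ℝ) (v c : ℝ → ℝ) (ρ₀ : ℝ → ℝ)
    (ρ : ℝ → ℝ → ℝ) (ξ : ℝ → ℝ) : Prop :=
  IsEntropySol ρmax v c ρ₀ ρ ξ ∧
    ∀ T > (0 : ℝ), ∃ V : ENNReal, V < ⊤ ∧
      ∀ t ∈ Icc (0 : ℝ) T, eVariationOn (ρ t) (Ioo (-1 : ℝ) 1) ≤ V

/-- An explicit Euler discretization (time step `τ`) of the follow-the-leader system with `N` cells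
of mass `ℓ`: `x n i` is the position of the `i`-th vehicle after `n` steps and `ρ n i` the density
between the vehicles `i` and `i + 1`. Densities are bounded by `M`, with total decrease at most
`W`. -/
structure FollowLeader (M W ℓ τ : ℝ) (N : ℕ) (ρ x : ℕ → ℕ → ℝ) : Prop where
  mass_pos : 0 < ℓ
  step_pos : 0 < τ
  step_le : τ ≤ ℓ / 2
  bound_lt : M < 1
  nonneg : ∀ n i, 0 ≤ ρ n i
  le_bound : ∀ n i, ρ n i ≤ M
  vacuum : ∀ n i, N ≤ i → ρ n i = 0
  pos : ∀ n i, i < N → 0 < ρ n i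
  gap : ∀ n i, i < N → ρ n i * (x n (i + 1) - x n i) = ℓ
  move : ∀ n i, x (n + 1) i = x n i + τ * (1 - ρ n i)
  decrease : ∀ n, ∑ i ∈ Finset.range N, max (ρ n i - ρ n (i + 1)) 0 ≤ W

/-- One step of the density update. -/
def densityStep (σ : ℝ) (u : ℕ → ℝ) (i : ℕ) : ℝ := u i / (1 + σ * u i * (u i - u (i + 1)))

/-- The densities generated by the initial densities `u`. -/
def densityIter (σ : ℝ) (u : ℕ → ℝ) : ℕ → ℕ → ℝ
  | 0 => u
  | n + 1 => densityStep σ (densityIter σ u n)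

/-- The positions generated by the initial positions `y`, the densities being `ρ`. -/
def positionIter (τ : ℝ) (ρ : ℕ → ℕ → ℝ) (y : ℕ → ℝ) : ℕ → ℕ → ℝ
  | 0 => y
  | n + 1 => fun i => positionIter τ ρ y n i + τ * (1 - ρ n i)

theorem densityStep_denom_pos {σ a b : ℝ} (hσ : 0 ≤ σ) (hσ1 : σ ≤ 1 / 2) (ha : 0 ≤ a) (ha1 : a ≤ 1)
    (hb : 0 ≤ b) (hb1 : b ≤ 1) : 1 / 2 ≤ 1 + σ * a * (a - b) := by
  have h1 : σ * a ≤ 1 / 2 := by nlinarith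
  have h2 : 0 ≤ σ * a := mul_nonneg hσ ha
  nlinarith

theorem exists_convex_densityStep {σ : ℝ} (hσ : 0 ≤ σ) (hσ1 : σ ≤ 1 / 2) {u : ℕ → ℝ}
    (h0 : ∀ i, 0 ≤ u i) (h1 : ∀ i, u i ≤ 1) (i : ℕ) :
    ∃ θ ∈ Icc (0 : ℝ) 1, densityStep σ u i = u i - θ * (u i - u (i + 1)) := by
  have hd := densityStep_denom_pos hσ hσ1 (h0 i) (h1 i) (h0 (i + 1)) (h1 (i + 1))
  set d := 1 + σ * u i * (u i - u (i + 1)) with hd'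
  have hdpos : 0 < d := by linarith
  have hs2 : u i * u i ≤ 1 := by nlinarith [h0 i, h1 i]
  refine ⟨σ * u i * u i / d, ⟨by have := h0 i; positivity, ?_⟩, ?_⟩
  · rw [div_le_one hdpos]
    nlinarith [mul_nonneg hσ (mul_self_nonneg (u i)), h0 i]
  · rw [densityStep, ← hd']
    field_simp
    rw [hd']; ring

theorem sum_decrease_densityStep_le {σ : ℝ} (hσ : 0 ≤ σ) (hσ1 : σ ≤ 1 / 2) {u : ℕ → ℝ}
    (h0 : ∀ i, 0 ≤ u i) (h1 : ∀ i, u i ≤ 1) {N : ℕ} (hN : ∀ i, N ≤ i → u i = 0) :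
    ∑ i ∈ Finset.range N, max (densityStep σ u i - densityStep σ u (i + 1)) 0 ≤
      ∑ i ∈ Finset.range N, max (u i - u (i + 1)) 0 := by
  choose θ hθ hs using fun i => exists_convex_densityStep hσ hσ1 h0 h1 i
  set m : ℕ → ℝ := fun i => max (u i - u (i + 1)) 0 with hm
  have key : ∀ i, max (densityStep σ u i - densityStep σ u (i + 1)) 0 ≤
      m i - (θ i * m i - θ (i + 1) * m (i + 1)) := by
    intro i
    have hm0 : ∀ j, 0 ≤ m j := fun j => le_max_right _ _
    have hm1 : ∀ j, u j - u (j + 1) ≤ m j := fun j => le_max_left _ _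
    have a1 := mul_le_mul_of_nonneg_left (hm1 i) (sub_nonneg.2 (hθ i).2)
    have a2 := mul_le_mul_of_nonneg_left (hm1 (i + 1)) (hθ (i + 1)).1
    have a3 := mul_nonneg (sub_nonneg.2 (hθ i).2) (hm0 i)
    have a4 := mul_nonneg (hθ (i + 1)).1 (hm0 (i + 1))
    apply max_le
    · rw [hs i, hs (i + 1)]; nlinarith
    · nlinarith
  calc _ ≤ ∑ i ∈ Finset.range N, (m i - (θ i * m i - θ (i + 1) * m (i + 1))) :=
        Finset.sum_le_sum fun i _ => key i
    _ = ∑ i ∈ Finset.range N, m i - (θ 0 * m 0 - θ N * m N) := by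
        rw [Finset.sum_sub_distrib, Finset.sum_range_sub' (fun i => θ i * m i)]
    _ ≤ _ := by
        have : m N = 0 := by simp [hm, hN N le_rfl, hN (N + 1) (Nat.le_succ N)]
        have h3 : 0 ≤ θ 0 * m 0 := mul_nonneg (hθ 0).1 (le_max_right _ _)
        rw [this]; linarith

theorem exists_followLeader {M W ℓ τ : ℝ} {N : ℕ} {u y : ℕ → ℝ} (hℓ : 0 < ℓ) (hτ : 0 < τ)
    (hτℓ : τ ≤ ℓ / 2) (hM : M < 1) (h0 : ∀ i, 0 ≤ u i) (h1 : ∀ i, u i ≤ M)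
    (hvac : ∀ i, N ≤ i → u i = 0) (hpos : ∀ i, i < N → 0 < u i)
    (hgap : ∀ i, i < N → u i * (y (i + 1) - y i) = ℓ)
    (hdec : ∑ i ∈ Finset.range N, max (u i - u (i + 1)) 0 ≤ W) :
    ∃ ρ x : ℕ → ℕ → ℝ, FollowLeader M W ℓ τ N ρ x ∧ ρ 0 = u ∧ x 0 = y := by
  set σ := τ / ℓ with hσ
  have hσ0 : 0 ≤ σ := by positivity
  have hσ1 : σ ≤ 1 / 2 := by rw [hσ, div_le_iff₀ hℓ]; linarith
  set ρ := densityIter σ u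
  have hbd : ∀ n, (∀ i, 0 ≤ ρ n i) ∧ (∀ i, ρ n i ≤ M) := by
    intro n
    induction n with
    | zero => exact ⟨h0, h1⟩
    | succ n ih =>
      have ih1 : ∀ i, ρ n i ≤ 1 := fun i => (ih.2 i).trans hM.le
      choose θ hθ hs using fun i => exists_convex_densityStep hσ0 hσ1 ih.1 ih1 i
      constructor <;> intro i
      · change 0 ≤ densityStep σ (ρ n) i
        rw [hs i]
        nlinarith [mul_nonneg (sub_nonneg.2 (hθ i).2) (ih.1 i), mul_nonneg (hθ i).1 (ih.1 (i + 1))]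
      · change densityStep σ (ρ n) i ≤ M
        rw [hs i]
        nlinarith [mul_le_mul_of_nonneg_left (ih.2 i) (sub_nonneg.2 (hθ i).2),
          mul_le_mul_of_nonneg_left (ih.2 (i + 1)) (hθ i).1]
  have hle1 : ∀ n i, ρ n i ≤ 1 := fun n i => ((hbd n).2 i).trans hM.le
  have hden : ∀ n i, 1 / 2 ≤ 1 + σ * ρ n i * (ρ n i - ρ n (i + 1)) := fun n i =>
    densityStep_denom_pos hσ0 hσ1 ((hbd n).1 i) (hle1 n i) ((hbd n).1 _) (hle1 n _)
  have hv : ∀ n i, N ≤ i → ρ n i = 0 := by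
    intro n
    induction n with
    | zero => exact hvac
    | succ n ih =>
      intro i hi
      change densityStep σ (ρ n) i = 0
      simp [densityStep, ih i hi]
  have hp : ∀ n i, i < N → 0 < ρ n i := by
    intro n
    induction n with
    | zero => exact hpos
    | succ n ih =>
      intro i hi
      have := hden n i
      exact div_pos (ih i hi) (by linarith)
  refine ⟨ρ, positionIter τ ρ y, ⟨hℓ, hτ, hτℓ, hM, fun n => (hbd n).1, fun n => (hbd n).2, hv, hp,
    ?_, fun n i => rfl, ?_⟩, rfl, rfl⟩
  · intro n
    induction n with
    | zero => exact hgap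
    | succ n ih =>
      intro i hi
      have h2 := ih i hi
      have h3 := hden n i
      change densityStep σ (ρ n) i * ((positionIter τ ρ y n (i + 1) + τ * (1 - ρ n (i + 1))) -
        (positionIter τ ρ y n i + τ * (1 - ρ n i))) = ℓ
      rw [densityStep, div_mul_eq_mul_div, div_eq_iff (by linarith)]
      have : σ * ℓ = τ := by rw [hσ]; field_simp
      linear_combination h2 - ρ n i * (ρ n i - ρ n (i + 1)) * this
  · intro n
    induction n with
    | zero => exact hdec
    | succ n ih => exact (sum_decrease_densityStep_le hσ0 hσ1 (hbd n).1 (hle1 n) (hv n)).trans ih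

theorem abs_intervalIntegral_sub_mul_le {φ : ℝ → ℝ} {L : ℝ} (hφ : ∀ x y, |φ x - φ y| ≤ L * |x - y|)
    (hc : Continuous φ) {a b z : ℝ} (hab : a ≤ b) (hz : z ∈ Icc a b) :
    |(∫ x in a..b, φ x) - (b - a) * φ z| ≤ L * (b - a) * (b - a) := by
  have hL : 0 ≤ L := by have := (abs_nonneg _).trans (hφ 1 0); simpa using this
  have h1 : (∫ x in a..b, φ x) - (b - a) * φ z = ∫ x in a..b, (φ x - φ z) := by
    rw [intervalIntegral.integral_sub (hc.intervalIntegrable _ _) (by simp)]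
    simp
  rw [h1, ← Real.norm_eq_abs]
  refine (intervalIntegral.norm_integral_le_of_norm_le_const
    (C := L * (b - a)) fun x hx => ?_).trans
    (by rw [abs_of_nonneg (sub_nonneg.2 hab)])
  rw [uIoc_of_le hab] at hx
  rw [Real.norm_eq_abs]
  refine (hφ x z).trans (mul_le_mul_of_nonneg_left ?_ hL)
  rw [abs_le]; constructor <;> linarith [hx.1, hx.2, hz.1, hz.2]

namespace FollowLeader

variable {M W ℓ τ : ℝ} {N : ℕ} {ρ x : ℕ → ℕ → ℝ}

theorem le_one (h : FollowLeader M W ℓ τ N ρ x) (n i : ℕ) : ρ n i ≤ 1 :=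
  (h.le_bound n i).trans h.bound_lt.le

theorem gap_pos (h : FollowLeader M W ℓ τ N ρ x) (n : ℕ) {i : ℕ} (hi : i < N) :
    0 < x n (i + 1) - x n i := by
  have h1 := h.gap n i hi
  have h2 := h.pos n i hi
  by_contra hc
  nlinarith [h.mass_pos]

theorem gap_succ (h : FollowLeader M W ℓ τ N ρ x) (n i : ℕ) :
    x (n + 1) (i + 1) - x (n + 1) i = (x n (i + 1) - x n i) + τ * (ρ n i - ρ n (i + 1)) := by
  rw [h.move, h.move]; ring

theorem density_sub_mul_gap (h : FollowLeader M W ℓ τ N ρ x) (n : ℕ) {i : ℕ} (hi : i < N) :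
    (ρ (n + 1) i - ρ n i) * (x n (i + 1) - x n i) =
      τ * ρ (n + 1) i * (ρ n (i + 1) - ρ n i) := by
  have h1 := h.gap n i hi
  have h2 := h.gap (n + 1) i hi
  rw [h.gap_succ] at h2
  linear_combination h2 - h1

theorem abs_density_sub_le (h : FollowLeader M W ℓ τ N ρ x) (n : ℕ) {i : ℕ} (hi : i < N) :
    |ρ (n + 1) i - ρ n i| ≤ τ / ℓ := by
  have h1 := h.gap n i hi
  have h2 := h.density_sub_mul_gap n hi
  have hℓ := h.mass_pos
  have h3 : (ρ (n + 1) i - ρ n i) * ℓ = τ * (ρ n i * ρ (n + 1) i * (ρ n (i + 1) - ρ n i)) := by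
    rw [← h1]; linear_combination ρ n i * h2
  have ha := h.nonneg n i
  have hb := h.nonneg n (i + 1)
  have ha' := h.nonneg (n + 1) i
  have ha1 := h.le_one n i
  have hb1 := h.le_one n (i + 1)
  have ha1' := h.le_one (n + 1) i
  rw [le_div_iff₀ hℓ, ← abs_of_pos hℓ, ← abs_mul, h3, abs_mul, abs_of_pos h.step_pos]
  refine mul_le_of_le_one_right h.step_pos.le ?_
  rw [abs_mul, abs_of_nonneg (mul_nonneg ha ha')]
  exact mul_le_one₀ (mul_le_one₀ ha1 ha' ha1') (abs_nonneg _)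
    (by rw [abs_le]; constructor <;> linarith)

theorem density_succ_mul_gap_le (h : FollowLeader M W ℓ τ N ρ x) (n : ℕ) {i : ℕ} (hi : i < N) :
    ρ (n + 1) i * (x n (i + 1) - x n i) ≤ 2 * ℓ := by
  have h2 := h.gap (n + 1) i hi
  rw [h.gap_succ] at h2
  have hb := h.nonneg n i
  have hb1 := h.le_one n (i + 1)
  have ha' := h.nonneg (n + 1) i
  have ha1' := h.le_one (n + 1) i
  have hτ := h.step_pos
  have hτℓ := h.step_le
  have hℓ := h.mass_pos
  have : -1 ≤ ρ n i - ρ n (i + 1) := by linarith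
  have h3 : -τ ≤ τ * (ρ n i - ρ n (i + 1)) := by nlinarith
  have h4 : ρ (n + 1) i * (-τ) ≤ ρ (n + 1) i * (τ * (ρ n i - ρ n (i + 1))) :=
    mul_le_mul_of_nonneg_left h3 ha'
  nlinarith

/-- Change, in one time step, of the contribution of one cell to an integral `∫ E(ρ) φ`. -/
theorem abs_cell_sub_le (h : FollowLeader M W ℓ τ N ρ x) (n : ℕ) {i : ℕ} (hi : i < N)
    {φ : ℝ → ℝ} {L : ℝ} (hφ : ∀ x y, |φ x - φ y| ≤ L * |x - y|) (hc : Continuous φ)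
    (hφL : ∀ x, |φ x| ≤ L) {Λ e e' : ℝ} (he : |e| ≤ Λ)
    (he' : |e' - e| ≤ Λ * |ρ (n + 1) i - ρ n i|) :
    |e' * (∫ y in x (n + 1) i..x (n + 1) (i + 1), φ y) - e * (∫ y in x n i..x n (i + 1), φ y)
      - τ * (e * ((1 - ρ n (i + 1)) * φ (x n (i + 1)) - (1 - ρ n i) * φ (x n i)))
      - (e' - e) * (x n (i + 1) - x n i) * φ (x n (i + 1))| ≤
    Λ * L * τ * (2 * τ + 2 * (τ / ℓ) + 2 * ℓ * |ρ n i - ρ n (i + 1)|) := by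
  have hΛ : 0 ≤ Λ := (abs_nonneg _).trans he
  have hL : 0 ≤ L := (abs_nonneg _).trans (hφL 0)
  have hτ := h.step_pos
  have hℓ := h.mass_pos
  have hi' : ∀ a b, IntervalIntegrable φ volume a b := fun a b => hc.intervalIntegrable a b
  have moved : ∀ j, |(∫ y in x n j..x (n + 1) j, φ y) - τ * ((1 - ρ n j) * φ (x n j))| ≤
      L * τ * τ ∧ |∫ y in x n j..x (n + 1) j, φ y| ≤ L * τ := by
    intro j
    have h0 := h.nonneg n j
    have h1 := h.le_one n j
    have hm : x (n + 1) j - x n j = τ * (1 - ρ n j) := by rw [h.move]; ring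
    have hm0 : 0 ≤ τ * (1 - ρ n j) := mul_nonneg hτ.le (by linarith)
    have hm1 : τ * (1 - ρ n j) ≤ τ := by nlinarith
    have hle : x n j ≤ x (n + 1) j := by linarith
    constructor
    · have := abs_intervalIntegral_sub_mul_le hφ hc hle (left_mem_Icc.2 hle)
      rw [hm] at this
      rw [← mul_assoc]
      refine this.trans ?_
      gcongr
    · rw [← Real.norm_eq_abs]
      refine (intervalIntegral.norm_integral_le_of_norm_le_const (C := L) fun y _ => hφL y).trans ?_
      rw [hm, abs_of_nonneg hm0]
      gcongr
  set Δ := x n (i + 1) - x n i with hΔ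
  have hΔ0 : 0 < Δ := h.gap_pos n hi
  set I' := ∫ y in x (n + 1) i..x (n + 1) (i + 1), φ y
  set I := ∫ y in x n i..x n (i + 1), φ y with hI
  set p := ∫ y in x n (i + 1)..x (n + 1) (i + 1), φ y
  set q := ∫ y in x n i..x (n + 1) i, φ y
  have hsplit : I' - I = p - q := by
    have h1 : q + I' = I + p := by
      rw [intervalIntegral.integral_add_adjacent_intervals (hi' _ _) (hi' _ _),
        intervalIntegral.integral_add_adjacent_intervals (hi' _ _) (hi' _ _)]
    linarith
  obtain ⟨p1, p2⟩ := moved (i + 1)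
  obtain ⟨q1, q2⟩ := moved i
  have hIc : |I - Δ * φ (x n (i + 1))| ≤ L * Δ * Δ := by
    have hle : x n i ≤ x n (i + 1) := by linarith
    exact abs_intervalIntegral_sub_mul_le hφ hc hle (right_mem_Icc.2 hle)
  set vp := τ * ((1 - ρ n (i + 1)) * φ (x n (i + 1)))
  set vq := τ * ((1 - ρ n i) * φ (x n i))
  have e1 : e' * I' - e * I -
      τ * (e * ((1 - ρ n (i + 1)) * φ (x n (i + 1)) - (1 - ρ n i) * φ (x n i)))
      - (e' - e) * Δ * φ (x n (i + 1)) =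
      e * ((p - vp) - (q - vq)) + ((e' - e) * (p - q) + (e' - e) * (I - Δ * φ (x n (i + 1)))) := by
    have : I' = I + p - q := by linarith
    rw [this]; simp only [vp, vq]; ring
  have hδ := h.abs_density_sub_le n hi
  set δ := |ρ (n + 1) i - ρ n i|
  have hδ0 : 0 ≤ δ := abs_nonneg _
  have b1 : |e * ((p - vp) - (q - vq))| ≤ Λ * (2 * (L * τ * τ)) := by
    rw [abs_mul]
    refine mul_le_mul he ((abs_sub _ _).trans ?_) (abs_nonneg _) hΛ
    linarith
  have b2 : |(e' - e) * (p - q)| ≤ (Λ * (τ / ℓ)) * (2 * (L * τ)) := by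
    rw [abs_mul]
    refine mul_le_mul (he'.trans (mul_le_mul_of_nonneg_left hδ hΛ)) ((abs_sub _ _).trans ?_)
      (abs_nonneg _) (by positivity)
    linarith
  have b3 : |(e' - e) * (I - Δ * φ (x n (i + 1)))| ≤
      Λ * L * (τ * (2 * ℓ) * |ρ n i - ρ n (i + 1)|) := by
    rw [abs_mul]
    refine (mul_le_mul he' hIc (abs_nonneg _) (by positivity)).trans ?_
    have hd : δ * Δ = τ * ρ (n + 1) i * |ρ n i - ρ n (i + 1)| := by
      have := congrArg abs (h.density_sub_mul_gap n hi)
      rw [abs_mul, abs_of_pos hΔ0, abs_mul, abs_mul, abs_of_pos hτ, abs_of_nonneg (h.nonneg _ _),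
        abs_sub_comm (ρ n (i + 1))] at this
      exact this
    have hd2 : δ * Δ * Δ ≤ τ * (2 * ℓ) * |ρ n i - ρ n (i + 1)| := by
      rw [hd]
      have := mul_le_mul_of_nonneg_left (h.density_succ_mul_gap_le n hi)
        (mul_nonneg hτ.le (abs_nonneg (ρ n i - ρ n (i + 1))))
      nlinarith
    calc Λ * δ * (L * Δ * Δ) = Λ * L * (δ * Δ * Δ) := by ring
      _ ≤ _ := mul_le_mul_of_nonneg_left hd2 (by positivity)
  rw [e1]
  refine (abs_add_le _ _).trans
    ((add_le_add b1 ((abs_add_le _ _).trans (add_le_add b2 b3))).trans ?_)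
  apply le_of_eq; ring

theorem sum_abs_sub_le (h : FollowLeader M W ℓ τ N ρ x) (n : ℕ) :
    ∑ i ∈ Finset.range N, |ρ n i - ρ n (i + 1)| ≤ 2 * W := by
  have h1 : ∑ i ∈ Finset.range N, |ρ n i - ρ n (i + 1)| =
      2 * ∑ i ∈ Finset.range N, max (ρ n i - ρ n (i + 1)) 0 - (ρ n 0 - ρ n N) := by
    rw [← Finset.sum_range_sub', Finset.mul_sum, ← Finset.sum_sub_distrib]
    refine Finset.sum_congr rfl fun i _ => ?_
    rcases le_total 0 (ρ n i - ρ n (i + 1)) with hd | hd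
    · rw [abs_of_nonneg hd, max_eq_left hd]; ring
    · rw [abs_of_nonpos hd, max_eq_right hd]; ring
  rw [h1, h.vacuum n N le_rfl]
  linarith [h.decrease n, h.nonneg n 0]

end FollowLeader

/-- The entropy `|r - k|`, normalized to vanish at `r = 0`. -/
def entE (k r : ℝ) : ℝ := |r - k| - k

/-- The flux, normalized to vanish at `r = 0`, of the entropy `|r - k|` for the equation
`∂ₜ r + ∂ₓ (r (1 - r)) = 0`. -/
def entQ (k r : ℝ) : ℝ := |r - k| * (1 - r - k) - k * (1 - k)

theorem kruzhkov_cell_le {a a' b k τ Δ p q L δ : ℝ} (ha : a ∈ Icc (0 : ℝ) 1)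
    (hb : b ∈ Icc (0 : ℝ) 1) (hk : k ∈ Icc (0 : ℝ) 1) (hτ : 0 < τ) (hΔ : 0 < Δ)
    (hp : p ∈ Icc 0 L) (hq : q ∈ Icc 0 L) (hδ : |a' - a| ≤ δ)
    (hm : (a' - a) * Δ = τ * a' * (b - a)) :
    τ * (entE k a * ((1 - b) * q - (1 - a) * p)) + (entE k a' - entE k a) * Δ * q ≤
      τ * (entQ k a * (q - p) + (k * q * (|b - k| + b - k) - k * p * (|a - k| + a - k))
        + 7 * δ * L) := by
  obtain ⟨s, hs1, hs⟩ : ∃ s : ℝ, |s| ≤ 1 ∧ s * (a' - k) = |a' - k| := by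
    rcases le_total 0 (a' - k) with hd | hd
    · exact ⟨1, by simp, by rw [abs_of_nonneg hd]; ring⟩
    · exact ⟨-1, by simp, by rw [abs_of_nonpos hd]; ring⟩
  obtain ⟨hs1, hs2⟩ := abs_le.1 hs1
  obtain ⟨hp0, hpL⟩ := hp
  obtain ⟨hq0, hqL⟩ := hq
  have hL : 0 ≤ L := hp0.trans hpL
  have hδ0 : 0 ≤ δ := (abs_nonneg _).trans hδ
  obtain ⟨hδ1, hδ2⟩ := abs_le.1 hδ
  have slope : ∀ z : ℝ, s * z ≤ |z| := fun z => by
    have : |s * z| ≤ |z| := by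
      rw [abs_mul]; exact mul_le_of_le_one_left (abs_nonneg _) (abs_le.2 ⟨hs1, hs2⟩)
    exact (le_abs_self _).trans this
  set A := |a - k| with hA
  have hA1 : s * (a - k) ≤ A := slope _
  have hA2 : A ≤ s * (a - k) + 2 * δ := by
    have h1 : A ≤ |a' - k| + |a' - a| := by
      have := abs_sub_abs_le_abs_sub (a - k) (a' - k)
      rw [show a - k - (a' - k) = -(a' - a) by ring, abs_neg] at this
      linarith
    have h2 := slope (a' - a)
    have : s * (a' - k) - s * (a - k) = s * (a' - a) := by ring
    linarith
  have hB := slope (b - k)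
  set B := |b - k|
  -- the contribution of the change of density
  have c1 : (entE k a' - entE k a) * Δ * q ≤ τ * (s * a * (b - a) * q + δ * L) := by
    have h1 : entE k a' - entE k a ≤ s * (a' - a) := by
      simp only [entE]; rw [← hs]; linarith
    have h2 : (entE k a' - entE k a) * Δ * q ≤ s * (a' - a) * Δ * q := by gcongr
    have h3 : s * (a' - a) * Δ * q = τ * (s * a' * (b - a) * q) := by
      linear_combination s * q * hm
    have h4 : s * a' * (b - a) * q ≤ s * a * (b - a) * q + δ * L := by
      have : s * ((b - a) * ((a' - a) * q)) ≤ |(b - a) * ((a' - a) * q)| := slope _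
      have h5 : |(b - a) * ((a' - a) * q)| ≤ 1 * (δ * L) := by
        rw [abs_mul, abs_mul, abs_of_nonneg hq0]
        refine mul_le_mul ?_ (mul_le_mul hδ hqL hq0 hδ0) (by positivity) one_pos.le
        rw [abs_le]; constructor <;> linarith [ha.1, ha.2, hb.1, hb.2]
      nlinarith
    rw [h3] at h2
    exact h2.trans (mul_le_mul_of_nonneg_left h4 hτ.le)
  -- errors when `|a - k|` is replaced by `s * (a - k)`
  set e := A - s * (a - k) with he
  have he0 : 0 ≤ e := by linarith
  have he2 : e ≤ 2 * δ := by linarith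
  have prodL : ∀ z : ℝ, |z| ≤ L → e * z ≤ 2 * δ * L := fun z hz =>
    (mul_le_mul_of_nonneg_left ((le_abs_self z).trans hz) he0).trans
      (mul_le_mul_of_nonneg_right he2 hL)
  have d1 : e * ((1 - b) * q - (1 - a) * p) ≤ 2 * δ * L := by
    apply prodL
    have h1 : 0 ≤ (1 - b) * q := mul_nonneg (by linarith [hb.2]) hq0
    have h2 : 0 ≤ (1 - a) * p := mul_nonneg (by linarith [ha.2]) hp0
    have h3 : (1 - b) * q ≤ L := (mul_le_of_le_one_left hq0 (by linarith [hb.1])).trans hqL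
    have h4 : (1 - a) * p ≤ L := (mul_le_of_le_one_left hp0 (by linarith [ha.1])).trans hpL
    rw [abs_le]; constructor <;> linarith
  have d2 : e * (-((1 - a - k) * (q - p))) ≤ 2 * δ * L := by
    apply prodL
    rw [abs_neg, abs_mul]
    refine (mul_le_of_le_one_left (abs_nonneg _) ?_).trans ?_
    · rw [abs_le]; constructor <;> linarith [ha.1, ha.2, hk.1, hk.2]
    · rw [abs_le]; constructor <;> linarith
  have d3 : e * (k * p) ≤ 2 * δ * L := by
    apply prodL
    rw [abs_of_nonneg (mul_nonneg hk.1 hp0)]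
    exact (mul_le_of_le_one_left hp0 hk.2).trans hpL
  have d4 : k * q * (s * (b - k)) ≤ k * q * B :=
    mul_le_mul_of_nonneg_left hB (mul_nonneg hk.1 hq0)
  have main : entE k a * ((1 - b) * q - (1 - a) * p) + s * a * (b - a) * q ≤
      entQ k a * (q - p) + (k * q * (B + b - k) - k * p * (A + a - k)) + 6 * δ * L := by
    simp only [entE, entQ, ← hA]
    have hAe : A = e + s * (a - k) := by rw [he]; ring
    rw [hAe]
    nlinarith
  have := mul_le_mul_of_nonneg_left main hτ.le
  nlinarith

namespace FollowLeader

variable {M W ℓ τ : ℝ} {N : ℕ} {ρ x : ℕ → ℕ → ℝ}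

theorem mem_Icc (h : FollowLeader M W ℓ τ N ρ x) (n i : ℕ) : ρ n i ∈ Icc (0 : ℝ) 1 :=
  ⟨h.nonneg n i, h.le_one n i⟩

/-- Discrete Kruzhkov inequality. -/
theorem entropy_step (h : FollowLeader M W ℓ τ N ρ x) (n : ℕ) {k : ℝ} (hk : k ∈ Icc (0 : ℝ) 1)
    {φ : ℝ → ℝ} {L : ℝ} (hφ : ∀ x y, |φ x - φ y| ≤ L * |x - y|) (hc : Continuous φ)
    (hφ0 : ∀ x, φ x ∈ Icc 0 L) :
    ∑ i ∈ Finset.range N, entE k (ρ (n + 1) i) * (∫ y in x (n + 1) i..x (n + 1) (i + 1), φ y) ≤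
      ∑ i ∈ Finset.range N, entE k (ρ n i) * (∫ y in x n i..x n (i + 1), φ y) +
      τ * ∑ i ∈ Finset.range N, entQ k (ρ n i) * (φ (x n (i + 1)) - φ (x n i)) +
      L * τ * (N * (2 * τ + 9 * (τ / ℓ)) + 4 * ℓ * W) := by
  have hL : 0 ≤ L := (hφ0 0).1.trans (hφ0 0).2
  have hτ := h.step_pos
  have hℓ := h.mass_pos
  set G : ℕ → ℝ := fun i => k * φ (x n i) * (|ρ n i - k| + ρ n i - k) with hG
  have cell : ∀ i ∈ Finset.range N,
      entE k (ρ (n + 1) i) * (∫ y in x (n + 1) i..x (n + 1) (i + 1), φ y) ≤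
      entE k (ρ n i) * (∫ y in x n i..x n (i + 1), φ y) +
      τ * (entQ k (ρ n i) * (φ (x n (i + 1)) - φ (x n i))) + τ * (G (i + 1) - G i) +
      (L * τ * (2 * τ + 9 * (τ / ℓ)) + L * τ * (2 * ℓ) * |ρ n i - ρ n (i + 1)|) := by
    intro i hi
    have hi := Finset.mem_range.1 hi
    have h1 := h.abs_cell_sub_le n hi hφ hc (L := L) (Λ := 1) (e := entE k (ρ n i))
      (e' := entE k (ρ (n + 1) i))
      (fun y => by rw [abs_of_nonneg (hφ0 y).1]; exact (hφ0 y).2)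
      (by
        have ha := h.mem_Icc n i
        simp only [entE]
        have := abs_sub_le_of_nonneg_of_le ha.1 ha.2 hk.1 hk.2
        have := abs_nonneg (ρ n i - k)
        rw [abs_le]; constructor <;> linarith [hk.1, hk.2])
      (by
        simp only [entE, one_mul]
        have := abs_abs_sub_abs_le (ρ (n + 1) i - k) (ρ n i - k)
        rw [show ρ (n + 1) i - k - (ρ n i - k) = ρ (n + 1) i - ρ n i by ring] at this
        rwa [sub_sub_sub_cancel_right])
    have h2 := kruzhkov_cell_le (h.mem_Icc n i) (h.mem_Icc n (i + 1)) hk hτ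
      (h.gap_pos n hi) (hφ0 (x n i)) (hφ0 (x n (i + 1))) (h.abs_density_sub_le n hi)
      (h.density_sub_mul_gap n hi)
    have h3 := (abs_le.1 h1).2
    simp only [hG]
    nlinarith
  refine (Finset.sum_le_sum cell).trans ?_
  simp only [Finset.sum_add_distrib, ← Finset.mul_sum, Finset.sum_range_sub, Finset.sum_const,
    Finset.card_range, nsmul_eq_mul]
  have hGN : G N = 0 := by
    simp only [hG]
    rw [h.vacuum n N le_rfl, zero_sub, abs_neg, abs_of_nonneg hk.1]; ring
  have hG0 : 0 ≤ G 0 := by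
    have := neg_abs_le (ρ n 0 - k)
    exact mul_nonneg (mul_nonneg hk.1 (hφ0 _).1) (by linarith)
  have h4 : L * τ * (2 * ℓ) * ∑ i ∈ Finset.range N, |ρ n i - ρ n (i + 1)| ≤
      L * τ * (2 * ℓ) * (2 * W) := mul_le_mul_of_nonneg_left (h.sum_abs_sub_le n) (by positivity)
  have h5 : τ * (G N - G 0) ≤ 0 := by rw [hGN]; nlinarith
  nlinarith

end FollowLeader

/-- The excess `1 / (1 - r) - 1` of the cost over the cost of the vacuum. -/
def excessCost (r : ℝ) : ℝ := r / (1 - r)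

/-- The primitive of `excessCost ^ 2` which vanishes at `0`. -/
def costPrimitive (r : ℝ) : ℝ := r + 2 * Real.log (1 - r) + 1 / (1 - r) - 1

theorem excessCost_nonneg {r : ℝ} (h0 : 0 ≤ r) (h1 : r < 1) : 0 ≤ excessCost r :=
  div_nonneg h0 (by linarith)

theorem excessCost_mono {r s : ℝ} (hs : s < 1) (h : r ≤ s) : excessCost r ≤ excessCost s := by
  rw [excessCost, excessCost, div_le_div_iff₀ (by linarith) (by linarith)]
  nlinarith

theorem excessCost_sub {r s : ℝ} (hr : r < 1) (hs : s < 1) :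
    excessCost s - excessCost r = (s - r) / ((1 - r) * (1 - s)) := by
  have h1 : 1 - r ≠ 0 := by linarith
  have h2 : 1 - s ≠ 0 := by linarith
  rw [excessCost, excessCost]
  field_simp
  ring

theorem abs_excessCost_sub_le {M r s : ℝ} (hM : M < 1) (hr : r ≤ M) (hs : s ≤ M) :
    |excessCost s - excessCost r| ≤ 1 / (1 - M) ^ 2 * |s - r| := by
  rw [excessCost_sub (by linarith) (by linarith), abs_div, div_eq_mul_inv, mul_comm, one_div]
  have h3 : 0 < 1 - M := by linarith
  have : (1 - M) ^ 2 ≤ (1 - r) * (1 - s) := by nlinarith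
  gcongr
  exact this.trans (le_abs_self _)

theorem excessCost_le {M r : ℝ} (hM0 : 0 ≤ M) (hM : M < 1) (hr : r ≤ M) :
    excessCost r ≤ 1 / (1 - M) ^ 2 := by
  refine (excessCost_mono hM hr).trans ?_
  have h3 : 0 < 1 - M := by linarith
  rw [excessCost, div_le_div_iff₀ h3 (by positivity)]
  nlinarith

theorem hasDerivAt_costPrimitive {r : ℝ} (hr : r < 1) :
    HasDerivAt costPrimitive (excessCost r ^ 2) r := by
  have h1 : 1 - r ≠ 0 := by linarith
  have h2 : HasDerivAt (fun z : ℝ => 1 - z) (-1) r := by simpa using (hasDerivAt_id r).const_sub 1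
  have := (((hasDerivAt_id r).add ((h2.log h1).const_mul 2)).add (h2.inv h1)).sub_const 1
  refine (this.congr_of_eventuallyEq (f₁ := costPrimitive)
    (Eventually.of_forall fun z => ?_)).congr_deriv ?_
  · simp [costPrimitive]
  · rw [excessCost]
    field_simp
    ring

theorem excessCost_sq_mul_sub_le {r s : ℝ} (hr0 : 0 ≤ r) (hr : r < 1) (hs0 : 0 ≤ s) (hs : s < 1) :
    excessCost r ^ 2 * (s - r) ≤ costPrimitive s - costPrimitive r := by
  have hcont : ∀ a b, a < 1 → b < 1 → ContinuousOn costPrimitive (Icc a b) := fun a b _ hb z hz =>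
    (hasDerivAt_costPrimitive (hz.2.trans_lt hb)).continuousAt.continuousWithinAt
  rcases lt_trichotomy r s with h | rfl | h
  · obtain ⟨z, hz, he⟩ := exists_hasDerivAt_eq_slope costPrimitive (fun z => excessCost z ^ 2) h
      (hcont r s hr hs) (fun z hz => hasDerivAt_costPrimitive (hz.2.trans hs))
    have h1 : excessCost r ^ 2 ≤ excessCost z ^ 2 :=
      pow_le_pow_left₀ (excessCost_nonneg hr0 hr) (excessCost_mono (hz.2.trans hs) hz.1.le) 2
    rw [eq_div_iff (by linarith)] at he
    nlinarith
  · simp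
  · obtain ⟨z, hz, he⟩ := exists_hasDerivAt_eq_slope costPrimitive (fun z => excessCost z ^ 2) h
      (hcont s r hs hr) (fun z hz => hasDerivAt_costPrimitive (hz.2.trans hr))
    have h1 : excessCost z ^ 2 ≤ excessCost r ^ 2 :=
      pow_le_pow_left₀ (excessCost_nonneg (hs0.trans hz.1.le) (hz.2.trans hr))
        (excessCost_mono hr hz.2.le) 2
    rw [eq_div_iff (by linarith)] at he
    nlinarith

theorem costPrimitive_zero : costPrimitive 0 = 0 := by simp [costPrimitive]

theorem costPrimitive_nonneg {r : ℝ} (h0 : 0 ≤ r) (h1 : r < 1) : 0 ≤ costPrimitive r := by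
  have := excessCost_sq_mul_sub_le le_rfl one_pos h0 h1
  simpa [costPrimitive_zero, excessCost] using this

theorem costPrimitive_le_self {r : ℝ} (h0 : 0 ≤ r) (h1 : r ≤ 11 / 20) : costPrimitive r ≤ r := by
  obtain ⟨s, hs, hs2⟩ : ∃ s : ℝ, 0 < s ∧ s ^ 2 = 1 - r :=
    ⟨√(1 - r), Real.sqrt_pos.2 (by linarith), Real.sq_sqrt (by linarith)⟩
  have h2 : 2 / 3 ≤ s := by nlinarith
  have h3 : s ≤ 1 := by nlinarith
  have h4 := Real.log_le_sub_one_of_pos hs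
  have h5 : 1 / s ^ 2 - 1 ≤ 4 * (1 - s) := by
    rw [sub_le_iff_le_add, div_le_iff₀ (by positivity)]
    nlinarith [mul_nonneg (sub_nonneg.2 h3) (show 0 ≤ 4 * s ^ 2 - s - 1 by nlinarith)]
  rw [costPrimitive, ← hs2, Real.log_pow]
  push_cast
  linarith

namespace FollowLeader

variable {M W ℓ τ : ℝ} {N : ℕ} {ρ x : ℕ → ℕ → ℝ}

theorem lt_one (h : FollowLeader M W ℓ τ N ρ x) (n i : ℕ) : ρ n i < 1 :=
  (h.le_bound n i).trans_lt h.bound_lt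

theorem bound_nonneg (h : FollowLeader M W ℓ τ N ρ x) : 0 ≤ M :=
  (h.nonneg 0 0).trans (h.le_bound 0 0)

/-- The discrete time derivative of `∫ excessCost ρ * ψ`, up to errors. -/
def costRate (ρ x : ℕ → ℝ) (ψ : ℝ → ℝ) (i : ℕ) : ℝ :=
  ρ i * (ψ (x (i + 1)) - ψ (x i)) + excessCost (ρ i) ^ 2 * (ρ (i + 1) - ρ i) * ψ (x (i + 1))

theorem abs_cost_cell_sub_le (h : FollowLeader M W ℓ τ N ρ x) (n : ℕ) {i : ℕ} (hi : i < N)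
    {ψ : ℝ → ℝ} {L : ℝ} (hψ : ∀ x y, |ψ x - ψ y| ≤ L * |x - y|) (hc : Continuous ψ)
    (hψ0 : ∀ x, ψ x ∈ Icc (0 : ℝ) 1) (hL : 1 ≤ L) :
    |excessCost (ρ (n + 1) i) * (∫ y in x (n + 1) i..x (n + 1) (i + 1), ψ y) -
      excessCost (ρ n i) * (∫ y in x n i..x n (i + 1), ψ y) - τ * costRate (ρ n) (x n) ψ i| ≤
    1 / (1 - M) ^ 2 * L * τ * (2 * τ + 2 * (τ / ℓ) + 2 * ℓ * |ρ n i - ρ n (i + 1)|) +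
      (1 / (1 - M) ^ 2) ^ 2 * τ * (τ / ℓ) := by
  set Λ := 1 / (1 - M) ^ 2
  have hM := h.bound_lt
  have h1M : 0 < 1 - M := by linarith
  have hΛ : 0 ≤ Λ := by positivity
  have h1 := h.abs_cell_sub_le n hi hψ hc (L := L) (Λ := Λ) (e := excessCost (ρ n i))
    (e' := excessCost (ρ (n + 1) i))
    (fun y => by rw [abs_of_nonneg (hψ0 y).1]; exact (hψ0 y).2.trans hL)
    (by
      rw [abs_of_nonneg (excessCost_nonneg (h.nonneg n i) (h.lt_one n i))]
      exact excessCost_le h.bound_nonneg hM (h.le_bound n i))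
    (abs_excessCost_sub_le hM (h.le_bound n i) (h.le_bound (n + 1) i))
  have h2 := h.density_sub_mul_gap n hi
  have hsub := abs_excessCost_sub_le hM (h.le_bound n i) (h.le_bound (n + 1) i)
  have hδ := h.abs_density_sub_le n hi
  have hr := h.lt_one n i
  have hr' := h.lt_one (n + 1) i
  set a := ρ n i with ha
  set a' := ρ (n + 1) i with ha'
  set b := ρ n (i + 1) with hb
  set q := ψ (x n (i + 1)) with hq
  have hq0 : q ∈ Icc (0 : ℝ) 1 := hψ0 _
  have n1 : 1 - a ≠ 0 := by linarith
  have n2 : 1 - a' ≠ 0 := by linarith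
  have e1 : (excessCost a' - excessCost a) * (x n (i + 1) - x n i) =
      τ * (b - a) * (excessCost a' / (1 - a)) := by
    rw [excessCost_sub hr hr', div_mul_eq_mul_div, h2, excessCost]
    field_simp
  have e2 : excessCost a * (1 - b) = a - excessCost a * (b - a) := by
    rw [excessCost]; field_simp; ring
  have e3 : excessCost a / (1 - a) = excessCost a + excessCost a ^ 2 := by
    rw [excessCost]; field_simp; ring
  have e4 : excessCost a * (1 - a) = a := by rw [excessCost]; field_simp
  have e5 : |τ * (b - a) * ((excessCost a' - excessCost a) / (1 - a)) * q| ≤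
      Λ ^ 2 * τ * (τ / ℓ) := by
    have hba : |b - a| ≤ 1 := by
      have h3 := h.mem_Icc n i
      have h4 := h.mem_Icc n (i + 1)
      rw [abs_le]; constructor <;> linarith [h3.1, h3.2, h4.1, h4.2]
    have g1 : |(excessCost a' - excessCost a) / (1 - a)| ≤ Λ * (τ / ℓ) * Λ := by
      rw [abs_div, div_eq_mul_inv]
      refine mul_le_mul (hsub.trans (mul_le_mul_of_nonneg_left hδ hΛ)) ?_ (by positivity)
        (mul_nonneg hΛ (div_nonneg h.step_pos.le h.mass_pos.le))
      rw [abs_of_pos (by linarith), ← one_div]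
      refine one_div_le_one_div_of_le (by positivity) ?_
      have := h.le_bound n i
      have := h.bound_nonneg
      nlinarith
    have g0 : 0 ≤ Λ * (τ / ℓ) * Λ := (abs_nonneg _).trans g1
    rw [abs_mul, abs_mul, abs_mul, abs_of_pos h.step_pos, abs_of_nonneg hq0.1]
    have hτ := h.step_pos
    calc τ * |b - a| * |(excessCost a' - excessCost a) / (1 - a)| * q
        ≤ τ * 1 * (Λ * (τ / ℓ) * Λ) * 1 := by
          gcongr
          exacts [hq0.1, hq0.2]
      _ = _ := by ring
  refine le_trans ?_ (add_le_add h1 e5)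
  refine le_trans (le_of_eq ?_) (abs_add_le _ _)
  congr 1
  rw [e1, costRate, ← ha, ← hb, ← hq]
  linear_combination (τ * q) * e2 - τ * ψ (x n i) * e4 + τ * (b - a) * q * e3

theorem sum_costRate_nonpos (h : FollowLeader M W ℓ τ N ρ x) (hM : M ≤ 11 / 20) (n : ℕ)
    {ψ : ℝ → ℝ} (hψ : Antitone ψ) (hψ0 : ∀ x, 0 ≤ ψ x) :
    ∑ i ∈ Finset.range N, costRate (ρ n) (x n) ψ i ≤ 0 := by
  set G : ℕ → ℝ := fun i => costPrimitive (ρ n i) * ψ (x n i)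
  have cell : ∀ i ∈ Finset.range N, costRate (ρ n) (x n) ψ i ≤ G (i + 1) - G i := by
    intro i hi
    have hi := Finset.mem_range.1 hi
    have h1 := excessCost_sq_mul_sub_le (h.nonneg n i) (h.lt_one n i) (h.nonneg n (i + 1))
      (h.lt_one n (i + 1))
    have h2 := costPrimitive_le_self (h.nonneg n i) ((h.le_bound n i).trans hM)
    have h3 : ψ (x n (i + 1)) ≤ ψ (x n i) := hψ (by linarith [h.gap_pos n hi])
    have h4 := mul_le_mul_of_nonneg_right h1 (hψ0 (x n (i + 1)))
    have h5 := mul_nonneg (sub_nonneg.2 h2) (sub_nonneg.2 h3)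
    simp only [costRate, G]
    nlinarith
  refine (Finset.sum_le_sum cell).trans ?_
  rw [Finset.sum_range_sub]
  have : G N = 0 := by simp [G, h.vacuum n N le_rfl, costPrimitive_zero]
  have h0 : 0 ≤ G 0 := mul_nonneg (costPrimitive_nonneg (h.nonneg n 0) (h.lt_one n 0)) (hψ0 _)
  linarith

theorem le_sum_costRate (h : FollowLeader M W ℓ τ N ρ x) (n : ℕ)
    {ψ : ℝ → ℝ} (hψ : Antitone ψ) (hψ0 : ∀ x, ψ x ∈ Icc (0 : ℝ) 1) {κ : ℝ} (hκ : 1 ≤ κ)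
    (hκM : excessCost M ^ 2 ≤ κ) :
    -(κ * W) ≤ ∑ i ∈ Finset.range N, costRate (ρ n) (x n) ψ i := by
  set d : ℕ → ℝ := fun i => max (ρ n i - ρ n (i + 1)) 0 with hd
  set D : ℕ → ℝ := fun i => ∑ j ∈ Finset.range N, d j - ∑ j ∈ Finset.range i, d j with hD
  have hmono : Monotone fun i => ρ n i + ∑ j ∈ Finset.range i, d j := by
    refine monotone_nat_of_le_succ fun i => ?_
    rw [Finset.sum_range_succ]
    have := le_max_left (ρ n i - ρ n (i + 1)) 0
    simp only [hd]
    linarith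
  have hρD : ∀ i ≤ N, ρ n i ≤ D i := fun i hi => by
    have := hmono hi
    simp only [h.vacuum n N le_rfl] at this
    simp only [hD]
    linarith
  set G : ℕ → ℝ := fun i => D i * ψ (x n i)
  have cell : ∀ i ∈ Finset.range N, κ * (G (i + 1) - G i) ≤ costRate (ρ n) (x n) ψ i := by
    intro i hi
    have hi := Finset.mem_range.1 hi
    have h3 : ψ (x n (i + 1)) ≤ ψ (x n i) := hψ (by linarith [h.gap_pos n hi])
    have h0 := h.nonneg n i
    have hq := (hψ0 (x n (i + 1))).1
    have h4 : ρ n i ≤ κ * D i := by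
      have := hρD i hi.le
      nlinarith
    have h5 : excessCost (ρ n i) ^ 2 ≤ κ :=
      (pow_le_pow_left₀ (excessCost_nonneg h0 (h.lt_one n i))
        (excessCost_mono h.bound_lt (h.le_bound n i)) 2).trans hκM
    have h6 : D (i + 1) = D i - d i := by simp only [hD, Finset.sum_range_succ]; ring
    have h7 : -(κ * d i) ≤ excessCost (ρ n i) ^ 2 * (ρ n (i + 1) - ρ n i) := by
      have a1 : ρ n i - ρ n (i + 1) ≤ d i := le_max_left _ _
      have a2 : 0 ≤ d i := le_max_right _ _
      have a3 := sq_nonneg (excessCost (ρ n i))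
      nlinarith
    have h8 := mul_le_mul_of_nonneg_right h7 hq
    have h9 := mul_nonneg (sub_nonneg.2 h4) (sub_nonneg.2 h3)
    simp only [costRate, G, h6]
    nlinarith
  refine le_trans ?_ (Finset.sum_le_sum cell)
  rw [← Finset.mul_sum, Finset.sum_range_sub]
  have hN : G N = 0 := by simp [G, hD]
  have h0 : G 0 ≤ W := by
    have h1 : D 0 ≤ W := by simpa [hD] using h.decrease n
    have h2 : 0 ≤ D 0 := (h.nonneg n 0).trans (hρD 0 (Nat.zero_le _))
    have := (hψ0 (x n 0)).2
    simp only [G]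
    nlinarith
  rw [hN]
  nlinarith

/-- Error made in one time step by the discrete cost balance. -/
def costError (M W ℓ τ L : ℝ) (N : ℕ) : ℝ :=
  1 / (1 - M) ^ 2 * L * (N * (2 * τ + 2 * (τ / ℓ)) + 4 * ℓ * W) +
    (1 / (1 - M) ^ 2) ^ 2 * (N * (τ / ℓ))

theorem abs_cost_step_sub_le (h : FollowLeader M W ℓ τ N ρ x) (n : ℕ)
    {ψ : ℝ → ℝ} {L : ℝ} (hψ : ∀ x y, |ψ x - ψ y| ≤ L * |x - y|) (hc : Continuous ψ)
    (hψ0 : ∀ x, ψ x ∈ Icc (0 : ℝ) 1) (hL : 1 ≤ L) :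
    |∑ i ∈ Finset.range N,
        excessCost (ρ (n + 1) i) * (∫ y in x (n + 1) i..x (n + 1) (i + 1), ψ y) -
      ∑ i ∈ Finset.range N, excessCost (ρ n i) * (∫ y in x n i..x n (i + 1), ψ y) -
      τ * ∑ i ∈ Finset.range N, costRate (ρ n) (x n) ψ i| ≤ τ * costError M W ℓ τ L N := by
  rw [Finset.mul_sum, ← Finset.sum_sub_distrib, ← Finset.sum_sub_distrib]
  refine (Finset.abs_sum_le_sum_abs _ _).trans ((Finset.sum_le_sum fun i hi =>
    h.abs_cost_cell_sub_le n (Finset.mem_range.1 hi) hψ hc hψ0 hL).trans ?_)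
  have h1M : 0 < 1 - M := by linarith [h.bound_lt]
  have hτ := h.step_pos
  have hℓ := h.mass_pos
  have h4 : 1 / (1 - M) ^ 2 * L * τ * (2 * ℓ) * ∑ i ∈ Finset.range N, |ρ n i - ρ n (i + 1)| ≤
      1 / (1 - M) ^ 2 * L * τ * (2 * ℓ) * (2 * W) :=
    mul_le_mul_of_nonneg_left (h.sum_abs_sub_le n) (by positivity)
  simp only [Finset.sum_add_distrib, mul_add, ← Finset.mul_sum, Finset.sum_const,
    Finset.card_range, nsmul_eq_mul, costError] at h4 ⊢
  nlinarith

end FollowLeader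

/-- `u` has total variation at most `V`, witnessed by a monotone function. -/
def HasVariationLE (V : ℝ) (u : ℝ → ℝ) : Prop :=
  ∃ P : ℝ → ℝ, Monotone P ∧ (∀ x, P x ∈ Icc 0 V) ∧ ∀ x y, x ≤ y → |u y - u x| ≤ P y - P x

/-- The step function with value `ρ i` on `[x i, x (i + 1))`, `i < N`. -/
def stepFn (N : ℕ) (x ρ : ℕ → ℝ) (y : ℝ) : ℝ :=
  ∑ i ∈ Finset.range N, (Ico (x i) (x (i + 1))).indicator (fun _ => ρ i) y

section stepFn

variable {N : ℕ} {x : ℕ → ℝ}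

theorem measurable_stepFn (N : ℕ) (x ρ : ℕ → ℝ) : Measurable (stepFn N x ρ) :=
  Finset.measurable_fun_sum _ fun _ _ => measurable_const.indicator measurableSet_Ico

theorem le_of_forall_lt_succ (hx : ∀ i < N, x i < x (i + 1)) {i j : ℕ} (hij : i ≤ j) (hj : j ≤ N) :
    x i ≤ x j := by
  induction j, hij using Nat.le_induction with
  | base => exact le_rfl
  | succ k _ ih => exact (ih (by omega)).trans (hx k (by omega)).le

theorem stepFn_eq (hx : ∀ i < N, x i < x (i + 1)) (ρ : ℕ → ℝ) {i : ℕ} (hi : i < N) {y : ℝ}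
    (hy : y ∈ Ico (x i) (x (i + 1))) : stepFn N x ρ y = ρ i := by
  rw [stepFn, Finset.sum_eq_single_of_mem i (Finset.mem_range.2 hi), indicator_of_mem hy]
  intro j hj hne
  have hj := Finset.mem_range.1 hj
  refine indicator_of_notMem (fun hyj => ?_) _
  rcases lt_or_gt_of_ne hne with h | h
  · have := le_of_forall_lt_succ hx (show j + 1 ≤ i by omega) hi.le
    linarith [hy.1, hyj.2]
  · have := le_of_forall_lt_succ hx (show i + 1 ≤ j by omega) hj.le
    linarith [hy.2, hyj.1]

theorem stepFn_of_forall_notMem (ρ : ℕ → ℝ) {y : ℝ}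
    (hy : ∀ i < N, y ∉ Ico (x i) (x (i + 1))) : stepFn N x ρ y = 0 :=
  Finset.sum_eq_zero fun i hi => indicator_of_notMem (hy i (Finset.mem_range.1 hi)) _

theorem stepFn_of_lt (hx : ∀ i < N, x i < x (i + 1)) (ρ : ℕ → ℝ) {y : ℝ} (hy : y < x 0) :
    stepFn N x ρ y = 0 :=
  stepFn_of_forall_notMem ρ fun i hi h => by
    have := le_of_forall_lt_succ hx (Nat.zero_le i) hi.le
    linarith [h.1]

theorem stepFn_of_le (hx : ∀ i < N, x i < x (i + 1)) (ρ : ℕ → ℝ) {y : ℝ} (hy : x N ≤ y) :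
    stepFn N x ρ y = 0 :=
  stepFn_of_forall_notMem ρ fun i hi h => by
    have := le_of_forall_lt_succ hx (show i + 1 ≤ N by omega) le_rfl
    linarith [h.2]

theorem stepFn_mem (hx : ∀ i < N, x i < x (i + 1)) {ρ : ℕ → ℝ} {s : Set ℝ} (h0 : (0 : ℝ) ∈ s)
    (hs : ∀ i, ρ i ∈ s) (y : ℝ) : stepFn N x ρ y ∈ s := by
  by_cases h : ∃ i < N, y ∈ Ico (x i) (x (i + 1))
  · obtain ⟨i, hi, hy⟩ := h
    rw [stepFn_eq hx ρ hi hy]; exact hs i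
  · push Not at h
    rw [stepFn_of_forall_notMem ρ h]; exact h0

theorem comp_stepFn (hx : ∀ i < N, x i < x (i + 1)) (ρ : ℕ → ℝ) {G : ℝ → ℝ} (hG : G 0 = 0)
    (y : ℝ) : G (stepFn N x ρ y) = stepFn N x (fun i => G (ρ i)) y := by
  by_cases h : ∃ i < N, y ∈ Ico (x i) (x (i + 1))
  · obtain ⟨i, hi, hy⟩ := h
    rw [stepFn_eq hx ρ hi hy, stepFn_eq hx _ hi hy]
  · push Not at h
    rw [stepFn_of_forall_notMem ρ h, stepFn_of_forall_notMem _ h, hG]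

theorem integral_stepFn_mul (hx : ∀ i < N, x i < x (i + 1)) (e : ℕ → ℝ) {φ : ℝ → ℝ}
    (hφ : Continuous φ) :
    ∫ y, stepFn N x e y * φ y = ∑ i ∈ Finset.range N, e i * ∫ y in x i..x (i + 1), φ y := by
  have h1 : ∀ y, stepFn N x e y * φ y =
      ∑ i ∈ Finset.range N, (Ico (x i) (x (i + 1))).indicator (fun y => e i * φ y) y := fun y => by
    rw [stepFn, Finset.sum_mul]
    refine Finset.sum_congr rfl fun i _ => ?_
    rw [indicator_mul_left]
  simp_rw [h1]
  rw [integral_finsetSum]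
  · refine Finset.sum_congr rfl fun i hi => ?_
    rw [integral_indicator measurableSet_Ico, integral_const_mul, integral_Ico_eq_integral_Ioc,
      intervalIntegral.integral_of_le (hx i (Finset.mem_range.1 hi)).le]
  · intro i _
    rw [integrable_indicator_iff measurableSet_Ico]
    exact ((hφ.const_mul (e i)).continuousOn.integrableOn_Icc).mono_set Ico_subset_Icc_self

theorem intervalIntegrable_stepFn (N : ℕ) (x ρ : ℕ → ℝ) (a b : ℝ) :
    IntervalIntegrable (stepFn N x ρ) volume a b := by
  have : stepFn N x ρ = ∑ i ∈ Finset.range N, (Ico (x i) (x (i + 1))).indicator (fun _ => ρ i) := by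
    funext y; simp [stepFn]
  rw [this]
  refine IntervalIntegrable.sum _ fun i _ => Integrable.intervalIntegrable ?_
  rw [integrable_indicator_iff measurableSet_Ico]
  simp

theorem integral_stepFn_cell (hx : ∀ i < N, x i < x (i + 1)) (ρ : ℕ → ℝ) {i : ℕ} (hi : i < N) :
    ∫ y in x i..x (i + 1), stepFn N x ρ y = ρ i * (x (i + 1) - x i) := by
  rw [intervalIntegral.integral_of_le (hx i hi).le, ← integral_Ico_eq_integral_Ioc,
    setIntegral_congr_fun measurableSet_Ico (g := fun _ => ρ i) fun y hy => stepFn_eq hx ρ hi hy]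
  rw [integral_Ico_eq_integral_Ioc, ← intervalIntegral.integral_of_le (hx i hi).le]
  simp [mul_comm]

theorem hasVariationLE_stepFn (hx : ∀ i < N, x i < x (i + 1)) {ρ : ℕ → ℝ} (hρN : ρ N = 0) {V : ℝ}
    (hV : |ρ 0| + ∑ i ∈ Finset.range N, |ρ i - ρ (i + 1)| ≤ V) :
    HasVariationLE V (stepFn N x ρ) := by
  set H : ℕ → ℝ → ℝ := fun i y => if x i ≤ y then 1 else 0
  have hH : ∀ i, Monotone (H i) := fun i y z hyz => by
    simp only [H]
    split_ifs with h1 h2 <;> first | exact le_rfl | exact zero_le_one | (exfalso; linarith)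
  have hH0 : ∀ i y, H i y ∈ Icc (0 : ℝ) 1 := fun i y => by
    simp only [H]; split_ifs <;> simp
  have hu : ∀ y, stepFn N x ρ y =
      ρ 0 * H 0 y - ∑ i ∈ Finset.range N, (ρ i - ρ (i + 1)) * H (i + 1) y := fun y => by
    have h1 : stepFn N x ρ y = ∑ i ∈ Finset.range N, ρ i * (H i y - H (i + 1) y) := by
      refine Finset.sum_congr rfl fun i hi => ?_
      have := hx i (Finset.mem_range.1 hi)
      simp only [H, indicator, mem_Ico]
      split_ifs with h1 h2 h3 <;> grind
    have h2 := Finset.sum_range_sub' (fun i => ρ i * H i y) N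
    rw [hρN, zero_mul, sub_zero] at h2
    rw [h1, ← h2, ← Finset.sum_sub_distrib]
    exact Finset.sum_congr rfl fun i _ => by ring
  refine ⟨fun y => |ρ 0| * H 0 y + ∑ i ∈ Finset.range N, |ρ i - ρ (i + 1)| * H (i + 1) y,
    fun y z hyz => ?_, fun y => ⟨?_, le_trans ?_ hV⟩, fun y z hyz => ?_⟩
  · refine add_le_add (mul_le_mul_of_nonneg_left (hH 0 hyz) (abs_nonneg _))
      (Finset.sum_le_sum fun i _ => mul_le_mul_of_nonneg_left (hH _ hyz) (abs_nonneg _))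
  · exact add_nonneg (mul_nonneg (abs_nonneg _) (hH0 _ _).1)
      (Finset.sum_nonneg fun i _ => mul_nonneg (abs_nonneg _) (hH0 _ _).1)
  · exact add_le_add (mul_le_of_le_one_right (abs_nonneg _) (hH0 _ _).2)
      (Finset.sum_le_sum fun i _ => mul_le_of_le_one_right (abs_nonneg _) (hH0 _ _).2)
  · have e1 : stepFn N x ρ z - stepFn N x ρ y = ρ 0 * (H 0 z - H 0 y) -
        ∑ i ∈ Finset.range N, (ρ i - ρ (i + 1)) * (H (i + 1) z - H (i + 1) y) := by
      rw [hu, hu]; simp only [mul_sub, Finset.sum_sub_distrib]; ring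
    have e2 : (|ρ 0| * H 0 z + ∑ i ∈ Finset.range N, |ρ i - ρ (i + 1)| * H (i + 1) z) -
        (|ρ 0| * H 0 y + ∑ i ∈ Finset.range N, |ρ i - ρ (i + 1)| * H (i + 1) y) =
        |ρ 0| * (H 0 z - H 0 y) +
          ∑ i ∈ Finset.range N, |ρ i - ρ (i + 1)| * (H (i + 1) z - H (i + 1) y) := by
      simp only [mul_sub, Finset.sum_sub_distrib]; ring
    rw [e1, e2]
    refine (abs_sub _ _).trans (add_le_add ?_ ((Finset.abs_sum_le_sum_abs _ _).trans
      (Finset.sum_le_sum fun i _ => ?_)))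
    · rw [abs_mul, abs_of_nonneg (sub_nonneg.2 (hH 0 hyz))]
    · rw [abs_mul, abs_of_nonneg (sub_nonneg.2 (hH (i + 1) hyz))]

end stepFn

/-- Approximate solution, with time step `τ` and precision `ε`, of `∂ₜ u + ∂ₓ (u (1 - u)) = 0`
with initial datum `g` on `[p, 1]`. -/
structure ApproxLWR (M V p K ε τ : ℝ) (g : ℝ → ℝ) (u : ℕ → ℝ → ℝ) : Prop where
  step_pos : 0 < τ
  step_le : τ ≤ ε
  measurable : ∀ j, Measurable (u j)
  range : ∀ j y, u j y ∈ Icc 0 M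
  left : ∀ (j : ℕ) y, y < p + (1 - M) * (j * τ) → u j y = 0
  right : ∀ (j : ℕ) y, 1 + j * τ ≤ y → u j y = 0
  variation : ∀ j, HasVariationLE V (u j)
  flux : ∀ i j : ℕ, i ≤ j → ∀ y,
    |(∫ z in p..y, u j z) - ∫ z in p..y, u i z| ≤ (j * τ - i * τ) + ε
  init : ∀ y, |(∫ z in p..y, u 0 z) - ∫ z in p..y, g z| ≤ ε
  entropy : ∀ j, ∀ k ∈ Icc (0 : ℝ) 1, ∀ (φ φ' : ℝ → ℝ) (L : ℝ), (∀ y, HasDerivAt φ (φ' y) y) →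
    Continuous φ' → (∀ y, |φ' y| ≤ L) → (∀ y, φ y ∈ Icc 0 L) →
    (∫ y, entE k (u (j + 1) y) * φ y) ≤ (∫ y, entE k (u j y) * φ y) +
      τ * (∫ y, entQ k (u j y) * φ' y) + L * τ * ε
  cost_le : ∀ (j : ℕ) (ψ : ℝ → ℝ) (L : ℝ), (∀ y z, |ψ y - ψ z| ≤ L * |y - z|) → Continuous ψ →
    Antitone ψ → (∀ y, ψ y ∈ Icc (0 : ℝ) 1) → 1 ≤ L →
    (∫ y, excessCost (u (j + 1) y) * ψ y) ≤ (∫ y, excessCost (u j y) * ψ y) + L * τ * ε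
  le_cost : ∀ (j : ℕ) (ψ : ℝ → ℝ) (L : ℝ), (∀ y z, |ψ y - ψ z| ≤ L * |y - z|) → Continuous ψ →
    Antitone ψ → (∀ y, ψ y ∈ Icc (0 : ℝ) 1) → 1 ≤ L →
    (∫ y, excessCost (u j y) * ψ y) - K * τ - L * τ * ε ≤ ∫ y, excessCost (u (j + 1) y) * ψ y

namespace FollowLeader

variable {M W ℓ τ : ℝ} {N : ℕ} {ρ x : ℕ → ℕ → ℝ}

/-- The piecewise constant density. -/
def density (N : ℕ) (ρ x : ℕ → ℕ → ℝ) (j : ℕ) : ℝ → ℝ := stepFn N (x j) (ρ j)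

theorem strict (h : FollowLeader M W ℓ τ N ρ x) (j : ℕ) : ∀ i < N, x j i < x j (i + 1) :=
  fun i hi => by linarith [h.gap_pos j hi]

theorem move_mem (h : FollowLeader M W ℓ τ N ρ x) {i j : ℕ} (hij : i ≤ j) (k : ℕ) :
    x j k - x i k ∈ Icc ((1 - M) * (j * τ - i * τ)) (j * τ - i * τ) := by
  induction j, hij using Nat.le_induction with
  | base => simp
  | succ j _ ih =>
    rw [h.move]
    have h0 := h.nonneg j k
    have h1 := h.le_bound j k
    have hτ := h.step_pos
    push_cast
    constructor
    · nlinarith [ih.1]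
    · nlinarith [ih.2]

theorem intervalIntegrable_density (N : ℕ) (ρ x : ℕ → ℕ → ℝ) (j : ℕ) (a b : ℝ) :
    IntervalIntegrable (density N ρ x j) volume a b :=
  intervalIntegrable_stepFn N (x j) (ρ j) a b

theorem integral_density_of_le (h : FollowLeader M W ℓ τ N ρ x) {p : ℝ} (hp : p ≤ x 0 0) (j : ℕ)
    {y : ℝ} (hy : y ≤ x j 0) : ∫ z in p..y, density N ρ x j z = 0 := by
  have hpj : p ≤ x j 0 := by
    have h1 := (h.move_mem (Nat.zero_le j) 0).1
    have h2 := mul_nonneg (sub_nonneg.2 h.bound_lt.le)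
      (show (0 : ℝ) ≤ j * τ - (0 : ℕ) * τ by have := h.step_pos; simp; positivity)
    linarith
  have key : ∀ a ≤ x j 0, ∫ z in a..x j 0, density N ρ x j z = 0 := fun a ha => by
    rw [intervalIntegral.integral_of_le ha, ← integral_Ico_eq_integral_Ioc]
    exact setIntegral_eq_zero_of_forall_eq_zero fun z hz => stepFn_of_lt (h.strict j) _ hz.2
  have := intervalIntegral.integral_add_adjacent_intervals
    (intervalIntegrable_density N ρ x j p y) (intervalIntegrable_density N ρ x j y (x j 0))
  rwa [key y hy, key p hpj, add_zero] at this

theorem integral_density_eq (h : FollowLeader M W ℓ τ N ρ x) {p : ℝ} (hp : p ≤ x 0 0) (j : ℕ)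
    {i : ℕ} (hi : i ≤ N) : ∫ z in p..x j i, density N ρ x j z = i * ℓ := by
  induction i with
  | zero => simpa using h.integral_density_of_le hp j le_rfl
  | succ i ih =>
    rw [← intervalIntegral.integral_add_adjacent_intervals
      (intervalIntegrable_density N ρ x j p (x j i)) (intervalIntegrable_density N ρ x j _ _),
      ih (by omega), density, integral_stepFn_cell (h.strict j) (ρ j) (show i < N by omega),
      h.gap j i (by omega)]
    push_cast; ring

theorem integral_density_of_ge (h : FollowLeader M W ℓ τ N ρ x) {p : ℝ} (hp : p ≤ x 0 0) (j : ℕ)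
    {y : ℝ} (hy : x j N ≤ y) : ∫ z in p..y, density N ρ x j z = N * ℓ := by
  rw [← h.integral_density_eq hp j le_rfl, ← intervalIntegral.integral_add_adjacent_intervals
    (intervalIntegrable_density N ρ x j p (x j N)) (intervalIntegrable_density N ρ x j _ y),
    add_eq_left, intervalIntegral.integral_of_le hy]
  exact setIntegral_eq_zero_of_forall_eq_zero fun z hz => stepFn_of_le (h.strict j) _ hz.1.le

theorem density_mem (h : FollowLeader M W ℓ τ N ρ x) (j : ℕ) (y : ℝ) :
    density N ρ x j y ∈ Icc 0 M :=
  stepFn_mem (h.strict j) (left_mem_Icc.2 h.bound_nonneg)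
    (fun i => ⟨h.nonneg j i, h.le_bound j i⟩) y

theorem integral_density_sub_mem (h : FollowLeader M W ℓ τ N ρ x) (p : ℝ) (j : ℕ) {y z : ℝ}
    (hyz : y ≤ z) : (∫ s in p..z, density N ρ x j s) - ∫ s in p..y, density N ρ x j s ∈
      Icc 0 (z - y) := by
  have hint := fun a b => intervalIntegrable_density N ρ x j a b
  rw [intervalIntegral.integral_interval_sub_left (hint p z) (hint p y)]
  constructor
  · exact intervalIntegral.integral_nonneg hyz fun s _ => (h.density_mem j s).1
  · have := intervalIntegral.integral_mono_on hyz (hint y z)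
      (intervalIntegrable_const (c := (1 : ℝ)))
      fun s _ => ((h.density_mem j s).2.trans h.bound_lt.le)
    simpa using this

theorem exists_cell (N : ℕ) (x : ℕ → ℕ → ℝ) (j : ℕ) (y : ℝ) :
    y < x j 0 ∨ x j N ≤ y ∨ ∃ i < N, y ∈ Ico (x j i) (x j (i + 1)) := by
  by_contra! hc
  obtain ⟨h0, hN, hc⟩ := hc
  have : ∀ i ≤ N, x j i ≤ y := by
    intro i
    induction i with
    | zero => exact fun _ => h0
    | succ i ih =>
      intro hi
      by_contra! hlt
      exact hc i (by omega) ⟨ih (by omega), hlt⟩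
  linarith [this N le_rfl]

theorem abs_flux_le (h : FollowLeader M W ℓ τ N ρ x) {p : ℝ} (hp : p ≤ x 0 0) {i j : ℕ}
    (hij : i ≤ j) (y : ℝ) :
    |(∫ z in p..y, density N ρ x j z) - ∫ z in p..y, density N ρ x i z| ≤
      (j * τ - i * τ) + ℓ := by
  have hmv := fun k => h.move_mem hij k
  have hℓ := h.mass_pos
  have hT : (0 : ℝ) ≤ j * τ - i * τ := by
    have : (i : ℝ) ≤ j := by exact_mod_cast hij
    nlinarith [h.step_pos]
  have hmv0 : ∀ k, x i k ≤ x j k := fun k => by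
    have := (hmv k).1
    nlinarith [h.bound_lt]
  have mono := fun n {a b : ℝ} (hab : a ≤ b) => (h.integral_density_sub_mem p n hab).1
  have lip := fun n {a b : ℝ} (hab : a ≤ b) => (h.integral_density_sub_mem p n hab).2
  have l1 := lip j (show y ≤ y + (j * τ - i * τ) by linarith)
  rcases exists_cell N x i y with hy | hy | ⟨k, hk, hy⟩
  · rw [h.integral_density_of_le hp i hy.le, h.integral_density_of_le hp j (hy.le.trans (hmv0 0))]
    simp; linarith
  · have a1 := h.integral_density_of_ge hp i hy
    have b2 := h.integral_density_of_ge hp j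
      (show x j N ≤ y + (j * τ - i * τ) by linarith [(hmv N).2])
    have c2 : (∫ z in p..y, density N ρ x j z) ≤ N * ℓ := by
      rcases le_total y (x j N) with hle | hle
      · linarith [mono j hle, h.integral_density_eq hp j le_rfl]
      · exact (h.integral_density_of_ge hp j hle).le
    rw [abs_le]; constructor <;> linarith
  · have a1 := h.integral_density_eq hp i hk.le
    have a2 := h.integral_density_eq hp i (show k + 1 ≤ N by omega)
    have a3 := h.integral_density_eq hp j hk.le
    have a4 := h.integral_density_eq hp j (show k + 1 ≤ N by omega)
    have b1 := mono i hy.1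
    have b2 := mono i hy.2.le
    have b3 := mono j (hy.2.le.trans (hmv0 (k + 1)))
    have b4 := mono j (show x j k ≤ y + (j * τ - i * τ) by linarith [(hmv k).2, hy.1])
    push_cast at a2 a4
    rw [abs_le]; constructor <;> linarith

end FollowLeader

theorem entE_zero {k : ℝ} (hk : 0 ≤ k) : entE k 0 = 0 := by
  simp [entE, abs_of_nonneg hk]

theorem entQ_zero {k : ℝ} (hk : 0 ≤ k) : entQ k 0 = 0 := by
  simp [entQ, abs_of_nonneg hk]

theorem excessCost_zero : excessCost 0 = 0 := by simp [excessCost]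

namespace FollowLeader

variable {M W ℓ τ : ℝ} {N : ℕ} {ρ x : ℕ → ℕ → ℝ}

theorem integral_comp_density_mul (h : FollowLeader M W ℓ τ N ρ x) (j : ℕ) {G : ℝ → ℝ}
    (hG : G 0 = 0) {φ : ℝ → ℝ} (hφ : Continuous φ) :
    ∫ y, G (density N ρ x j y) * φ y =
      ∑ i ∈ Finset.range N, G (ρ j i) * ∫ y in x j i..x j (i + 1), φ y := by
  rw [← integral_stepFn_mul (h.strict j) _ hφ]
  exact integral_congr_ae (Eventually.of_forall fun y => by
    simp only [density, comp_stepFn (h.strict j) (ρ j) hG y])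

theorem approxLWR (h : FollowLeader M W ℓ τ N ρ x) (hM : M ≤ 11 / 20) {κ : ℝ} (hκ : 1 ≤ κ)
    (hκM : excessCost M ^ 2 ≤ κ) {p ε : ℝ} {g : ℝ → ℝ} (hp : p ≤ x 0 0) (hN : x 0 N ≤ 1)
    (hτε : τ ≤ ε) (hℓε : ℓ ≤ ε) (hε : N * (2 * τ + 9 * (τ / ℓ)) + 4 * ℓ * W ≤ ε)
    (hε' : 1 / (1 - M) ^ 2 * (N * (2 * τ + 2 * (τ / ℓ)) + 4 * ℓ * W) +
      (1 / (1 - M) ^ 2) ^ 2 * (N * (τ / ℓ)) ≤ ε)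
    (hinit : ∀ y, |(∫ z in p..y, density N ρ x 0 z) - ∫ z in p..y, g z| ≤ ε) :
    ApproxLWR M (2 * W + 1) p (κ * W) ε τ g (density N ρ x) := by
  have hτ := h.step_pos
  have hℓ := h.mass_pos
  have hcost : ∀ L : ℝ, 1 ≤ L → costError M W ℓ τ L N ≤ L * ε := fun L hL => by
    have h1 : 0 ≤ (1 / (1 - M) ^ 2) ^ 2 * (N * (τ / ℓ)) := by positivity
    have := mul_le_mul_of_nonneg_left hε' (zero_le_one.trans hL)
    rw [costError]
    nlinarith
  refine ⟨hτ, hτε, fun j => measurable_stepFn _ _ _, h.density_mem, fun j y hy => ?_,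
    fun j y hy => ?_, fun j => ?_, fun i j hij y => ?_, hinit, ?_, ?_, ?_⟩
  · have := (h.move_mem (Nat.zero_le j) 0).1
    refine stepFn_of_lt (h.strict j) _ ?_
    simp at this
    linarith
  · have := (h.move_mem (Nat.zero_le j) N).2
    refine stepFn_of_le (h.strict j) _ ?_
    simp at this
    linarith
  · refine hasVariationLE_stepFn (h.strict j) (h.vacuum j N le_rfl) ?_
    rw [abs_of_nonneg (h.nonneg j 0)]
    linarith [h.sum_abs_sub_le j, h.le_one j 0]
  · exact (h.abs_flux_le hp hij y).trans (by linarith)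
  · intro j k hk φ φ' L hφ hφ' hL hφL
    have hcont : Continuous φ := continuous_iff_continuousAt.2 fun y => (hφ y).continuousAt
    have hlip : ∀ y z, |φ y - φ z| ≤ L * |y - z| := fun y z => by
      simpa using Convex.norm_image_sub_le_of_norm_hasDerivWithin_le (f := φ) (f' := φ') (s := univ)
        (x := z) (y := y) (C := L) (fun t _ => (hφ t).hasDerivWithinAt) (fun t _ => hL t)
        convex_univ (mem_univ _) (mem_univ _)
    rw [h.integral_comp_density_mul (j + 1) (entE_zero hk.1) hcont,
      h.integral_comp_density_mul j (entE_zero hk.1) hcont,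
      h.integral_comp_density_mul j (entQ_zero hk.1) hφ']
    have hint : ∀ i, ∫ y in x j i..x j (i + 1), φ' y = φ (x j (i + 1)) - φ (x j i) := fun i =>
      intervalIntegral.integral_eq_sub_of_hasDerivAt (fun y _ => hφ y) (hφ'.intervalIntegrable _ _)
    simp only [hint]
    refine (h.entropy_step j hk hlip hcont hφL).trans ?_
    have hL0 : 0 ≤ L := (hφL 0).1.trans (hφL 0).2
    have := mul_le_mul_of_nonneg_left hε (mul_nonneg hL0 hτ.le)
    linarith
  · intro j ψ L hψ hc ha h0 hL
    rw [h.integral_comp_density_mul (j + 1) excessCost_zero hc,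
      h.integral_comp_density_mul j excessCost_zero hc]
    have h1 := (abs_le.1 (h.abs_cost_step_sub_le j hψ hc h0 hL)).2
    have h2 := mul_nonneg hτ.le (neg_nonneg.2 (h.sum_costRate_nonpos hM j ha fun y => (h0 y).1))
    have h3 := mul_le_mul_of_nonneg_left (hcost L hL) hτ.le
    linarith
  · intro j ψ L hψ hc ha h0 hL
    rw [h.integral_comp_density_mul (j + 1) excessCost_zero hc,
      h.integral_comp_density_mul j excessCost_zero hc]
    have h1 := (abs_le.1 (h.abs_cost_step_sub_le j hψ hc h0 hL)).1
    have h2 := mul_le_mul_of_nonneg_left (h.le_sum_costRate j ha h0 hκ hκM) hτ.le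
    have h3 := mul_le_mul_of_nonneg_left (hcost L hL) hτ.le
    linarith

end FollowLeader

theorem approxLWR_zero {M V p K ε : ℝ} {g : ℝ → ℝ} (hM : 0 ≤ M) (hV : 0 ≤ V) (hK : 0 ≤ K)
    (hε : 0 < ε) (hg : ∀ y, ∫ z in p..y, g z = 0) : ApproxLWR M V p K ε ε g fun _ _ => 0 where
  step_pos := hε
  step_le := le_rfl
  measurable _ := measurable_const
  range _ _ := left_mem_Icc.2 hM
  left _ _ _ := rfl
  right _ _ _ := rfl
  variation _ := ⟨fun _ => 0, monotone_const, fun _ => left_mem_Icc.2 hV, by simp⟩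
  flux i j hij y := by
    have : (i : ℝ) ≤ j := by exact_mod_cast hij
    simp
    nlinarith
  init y := by simp [hg y, hε.le]
  entropy _ k hk φ φ' L _ _ _ h := by
    simp only [entE_zero hk.1, entQ_zero hk.1]
    have : 0 ≤ L := (h 0).1.trans (h 0).2
    simp; positivity
  cost_le _ _ L _ _ _ _ hL := by
    simp only [excessCost_zero]
    have : 0 ≤ L := by linarith
    simp; positivity
  le_cost _ _ L _ _ _ _ hL := by
    simp only [excessCost_zero]
    have h0 : 0 ≤ L := by linarith
    have h1 : 0 ≤ L * ε * ε := by positivity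
    have h2 : 0 ≤ K * ε := by positivity
    simp; linarith

/-- Averages over consecutive intervals do not increase the total variation. -/
theorem sum_abs_average_sub_le {g P : ℝ → ℝ} {p q M T : ℝ} (hg : Measurable g)
    (hgM : ∀ y, g y ∈ Icc 0 M) (hP : Monotone P) (hPT : ∀ y, P y ∈ Icc 0 T)
    (hgP : ∀ y z, p < y → y ≤ z → z < q → |g z - g y| ≤ P z - P y) {x : ℕ → ℝ} {n : ℕ}
    (hx : ∀ i < n + 1, x i < x (i + 1)) (hp : p ≤ x 0) (hq : x (n + 1) ≤ q) :
    ∑ i ∈ Finset.range n, |(∫ y in x i..x (i + 1), g y) / (x (i + 1) - x i) -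
      (∫ y in x (i + 1)..x (i + 2), g y) / (x (i + 2) - x (i + 1))| ≤ T := by
  set a : ℕ → ℝ → ℝ := fun i s => (x (i + 1) - x i) * s + x i with ha
  have hmeas : ∀ i, Measurable (a i) := fun i => by fun_prop
  have bdd : ∀ {f : ℝ → ℝ} {C : ℝ}, Measurable f → (∀ y, f y ∈ Icc 0 C) →
      IntervalIntegrable f volume 0 1 := fun {f C} hf hC => by
    rw [intervalIntegrable_iff]
    refine Measure.integrableOn_of_bounded (M := C) (by simp) hf.aestronglyMeasurable
      (Eventually.of_forall fun y => ?_)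
    rw [Real.norm_eq_abs, abs_of_nonneg (hC y).1]; exact (hC y).2
  have hig : ∀ i, IntervalIntegrable (fun s => g (a i s)) volume 0 1 := fun i =>
    bdd (hg.comp (hmeas i)) fun y => hgM _
  have hiP : ∀ i, IntervalIntegrable (fun s => P (a i s)) volume 0 1 := fun i =>
    bdd (hP.measurable.comp (hmeas i)) fun y => hPT _
  have havg : ∀ i < n + 1, (∫ y in x i..x (i + 1), g y) / (x (i + 1) - x i) =
      ∫ s in (0 : ℝ)..1, g (a i s) := fun i hi => by
    have := hx i hi
    simp only [ha]
    rw [intervalIntegral.integral_comp_mul_add _ (by linarith)]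
    simp [div_eq_inv_mul]
  have hle : ∀ i < n, |(∫ s in (0 : ℝ)..1, g (a i s)) - ∫ s in (0 : ℝ)..1, g (a (i + 1) s)| ≤
      (∫ s in (0 : ℝ)..1, P (a (i + 1) s)) - ∫ s in (0 : ℝ)..1, P (a i s) := fun i hi => by
    rw [← intervalIntegral.integral_sub (hig _) (hig _),
      ← intervalIntegral.integral_sub (hiP _) (hiP _), ← Real.norm_eq_abs]
    refine intervalIntegral.norm_integral_le_of_norm_le zero_le_one ?_ ((hiP _).sub (hiP _))
    have hne : ∀ᵐ s : ℝ, s ≠ 1 := by simp [ae_iff]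
    filter_upwards [hne] with s hs1 hs
    have hs2 : s < 1 := lt_of_le_of_ne hs.2 hs1
    have d1 := hx i (by omega)
    have d2 := hx (i + 1) (by omega)
    have l1 := le_of_forall_lt_succ hx (Nat.zero_le i) (by omega)
    have l2 := le_of_forall_lt_succ hx (show i + 2 ≤ n + 1 by omega) le_rfl
    rw [Real.norm_eq_abs, abs_sub_comm]
    simp only [ha]
    refine hgP _ _ ?_ ?_ ?_
    · nlinarith [hs.1]
    · nlinarith [hs.1]
    · nlinarith [hs.1]
  have hsum : ∑ i ∈ Finset.range n, |(∫ y in x i..x (i + 1), g y) / (x (i + 1) - x i) -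
      (∫ y in x (i + 1)..x (i + 2), g y) / (x (i + 2) - x (i + 1))| ≤
      ∑ i ∈ Finset.range n,
        ((∫ s in (0 : ℝ)..1, P (a (i + 1) s)) - ∫ s in (0 : ℝ)..1, P (a i s)) := by
    refine Finset.sum_le_sum fun i hi => ?_
    have hi := Finset.mem_range.1 hi
    rw [havg i (by omega), havg (i + 1) (by omega)]
    exact hle i hi
  refine hsum.trans ?_
  rw [Finset.sum_range_sub (fun i => ∫ s in (0 : ℝ)..1, P (a i s))]
  have h0 : 0 ≤ ∫ s in (0 : ℝ)..1, P (a 0 s) :=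
    intervalIntegral.integral_nonneg zero_le_one fun s _ => (hPT _).1
  have h1 : ∫ s in (0 : ℝ)..1, P (a n s) ≤ ∫ s in (0 : ℝ)..1, T :=
    intervalIntegral.integral_mono_on zero_le_one (hiP n) intervalIntegrable_const
      fun s _ => (hPT _).2
  simp at h1
  linarith

set_option maxHeartbeats 800000 in
theorem exists_approxLWR {M p T κ : ℝ} {g P : ℝ → ℝ} (hM0 : 0 ≤ M) (hM : M ≤ 11 / 20)
    (hκ : 1 ≤ κ) (hκM : excessCost M ^ 2 ≤ κ) (hp : p ∈ Ioo (-1 : ℝ) 1) (hg : Measurable g)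
    (hgM : ∀ y, g y ∈ Icc 0 M) (hg0 : ∀ y, y ∉ Ioo p 1 → g y = 0)
    (hP : Monotone P) (hPT : ∀ y, P y ∈ Icc 0 T)
    (hgP : ∀ y z, p < y → y ≤ z → z < 1 → |g z - g y| ≤ P z - P y) :
    ∃ C > 0, ∀ n : ℕ, ∃ τ u, ApproxLWR M (2 * (M + T / 2) + 1) p (κ * (M + T / 2))
      (C / (n + 1)) τ g u := by
  have hT : 0 ≤ T := (hPT 0).1.trans (hPT 0).2
  have hgi : ∀ a b, IntervalIntegrable g volume a b := fun a b => by
    rw [intervalIntegrable_iff]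
    refine Measure.integrableOn_of_bounded (M := M) (by simp) hg.aestronglyMeasurable
      (Eventually.of_forall fun y => ?_)
    rw [Real.norm_eq_abs, abs_of_nonneg (hgM y).1]; exact (hgM y).2
  set G : ℝ → ℝ := fun y => ∫ z in p..y, g z with hG
  have hGsub : ∀ a b, G b - G a = ∫ z in a..b, g z := fun a b =>
    intervalIntegral.integral_interval_sub_left (hgi _ _) (hgi _ _)
  have hGmono : Monotone G := fun a b hab => by
    rw [← sub_nonneg, hGsub]
    exact intervalIntegral.integral_nonneg hab fun z _ => (hgM z).1
  have hGlip : ∀ a b, a ≤ b → G b - G a ≤ M * (b - a) := fun a b hab => by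
    rw [hGsub]
    have := intervalIntegral.integral_mono_on hab (hgi a b) (intervalIntegrable_const (c := M))
      fun s _ => (hgM s).2
    simpa [mul_comm] using this
  have hGcont : Continuous G := intervalIntegral.continuous_primitive hgi p
  have hGp : G p = 0 := by simp [hG]
  have hGneg : ∀ y ≤ p, G y = 0 := fun y hy => by
    rw [← sub_zero (G y), ← hGp, hGsub, intervalIntegral.integral_symm,
      intervalIntegral.integral_of_le hy, setIntegral_eq_zero_of_forall_eq_zero fun z hz =>
        hg0 z fun h => by linarith [hz.2, h.1], neg_zero, hGp]
  set m := G 1 with hm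
  have hGone : ∀ y, 1 ≤ y → G y = m := fun y hy => by
    rw [hm, ← sub_eq_zero, hGsub, intervalIntegral.integral_of_le hy]
    exact setIntegral_eq_zero_of_forall_eq_zero fun z hz => hg0 z fun h => by linarith [hz.1, h.2]
  have hm0 : 0 ≤ m := by rw [← hGp]; exact hGmono hp.2.le
  have hGm : ∀ y, G y ∈ Icc 0 m := fun y => by
    constructor
    · rcases le_total y p with h | h
      · exact (hGneg y h).ge
      · rw [← hGp]; exact hGmono h
    · rcases le_total y 1 with h | h
      · exact hGmono h
      · exact (hGone y h).le
  have hm2 : m ≤ 2 := by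
    have := hGlip p 1 hp.2.le
    rw [hGp] at this
    nlinarith [hp.1]
  rcases hm0.eq_or_lt with hmz | hmpos
  · refine ⟨1, one_pos, fun n => ⟨1 / (n + 1), fun _ _ => 0, approxLWR_zero hM0 (by positivity)
      (mul_nonneg (by linarith) (by positivity)) (by positivity) fun y => ?_⟩⟩
    have := hGm y
    rw [← hmz] at this
    exact le_antisymm this.2 this.1
  set Λ := 1 / (1 - M) ^ 2 with hΛ
  have hΛ1 : 1 ≤ Λ := by
    rw [hΛ, le_div_iff₀ (by nlinarith)]
    nlinarith
  set W := M + T / 2 with hW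
  have hW0 : 0 ≤ W := by positivity
  refine ⟨(Λ + Λ ^ 2) * (4 + 4 * W) * m, by positivity, fun n => ?_⟩
  set ℓ := m / (n + 1) with hℓ
  have hn : (0 : ℝ) < n + 1 := by positivity
  have hℓ0 : 0 < ℓ := by positivity
  have hNℓ : ((n + 1 : ℕ) : ℝ) * ℓ = m := by rw [hℓ]; push_cast; field_simp
  have hℓ2 : ℓ ≤ 2 := by
    refine le_trans ?_ hm2
    rw [← hNℓ]; push_cast
    nlinarith [Nat.cast_nonneg (α := ℝ) n]
  obtain ⟨x, hx⟩ : ∃ x : ℕ → ℝ, ∀ i, x i ∈ Icc p 1 ∧ G (x i) = min (i * ℓ) m := by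
    have : ∀ i : ℕ, ∃ y ∈ Icc p 1, G y = min (i * ℓ) m := fun i =>
      intermediate_value_Icc hp.2.le hGcont.continuousOn
        ⟨by rw [hGp]; positivity, min_le_right _ _⟩
    choose x h1 h2 using this
    exact ⟨x, fun i => ⟨h1 i, h2 i⟩⟩
  have hGx : ∀ i ≤ n + 1, G (x i) = i * ℓ := fun i hi => by
    rw [(hx i).2, min_eq_left]
    rw [← hNℓ]
    have : (i : ℝ) ≤ (n + 1 : ℕ) := by exact_mod_cast hi
    exact mul_le_mul_of_nonneg_right this hℓ0.le
  have hGcell : ∀ i < n + 1, G (x (i + 1)) - G (x i) = ℓ := fun i hi => by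
    rw [hGx i hi.le, hGx (i + 1) hi]; push_cast; ring
  have hxs : ∀ i < n + 1, x i < x (i + 1) := fun i hi => by
    by_contra! h
    have := hGmono h
    linarith [hGcell i hi]
  set a : ℕ → ℝ := fun i => if i < n + 1 then ℓ / (x (i + 1) - x i) else 0 with ha
  have hai : ∀ i < n + 1, a i = ℓ / (x (i + 1) - x i) := fun i hi => by simp only [ha, if_pos hi]
  have haN : ∀ i, n + 1 ≤ i → a i = 0 := fun i hi => by simp only [ha, if_neg (not_lt.2 hi)]
  have hapos : ∀ i < n + 1, 0 < a i := fun i hi => by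
    rw [hai i hi]; exact div_pos hℓ0 (by linarith [hxs i hi])
  have haM : ∀ i, a i ≤ M := fun i => by
    rcases lt_or_ge i (n + 1) with hi | hi
    · rw [hai i hi, div_le_iff₀ (by linarith [hxs i hi]), ← hGcell i hi]
      exact hGlip _ _ (hxs i hi).le
    · rw [haN i hi]; exact hM0
  have ha0 : ∀ i, 0 ≤ a i := fun i => by
    rcases lt_or_ge i (n + 1) with hi | hi
    · exact (hapos i hi).le
    · exact (haN i hi).ge
  have hvar : ∑ i ∈ Finset.range n, |a i - a (i + 1)| ≤ T := by
    refine le_trans (le_of_eq ?_) (sum_abs_average_sub_le hg hgM hP hPT hgP hxs (hx 0).1.1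
      (hx (n + 1)).1.2)
    refine Finset.sum_congr rfl fun i hi => ?_
    have hi := Finset.mem_range.1 hi
    rw [hai i (by omega), hai (i + 1) (by omega), ← hGsub, ← hGsub, hGcell i (by omega),
      hGcell (i + 1) (by omega)]
  have hdec : ∑ i ∈ Finset.range (n + 1), max (a i - a (i + 1)) 0 ≤ W := by
    have h1 : ∀ i, max (a i - a (i + 1)) 0 = (|a i - a (i + 1)| + (a i - a (i + 1))) / 2 :=
      fun i => by
        rcases le_total 0 (a i - a (i + 1)) with h | h
        · rw [max_eq_left h, abs_of_nonneg h]; ring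
        · rw [max_eq_right h, abs_of_nonpos h]; ring
    simp only [h1, ← Finset.sum_div, Finset.sum_add_distrib]
    rw [Finset.sum_range_sub', Finset.sum_range_succ, haN (n + 1) le_rfl, sub_zero, sub_zero,
      abs_of_nonneg (ha0 n), hW]
    linarith [haM n, haM 0]
  set τ := ℓ ^ 3 / 8 with hτ
  have hℓsq : ℓ ^ 2 ≤ 4 := by nlinarith
  have hτℓ : τ ≤ ℓ / 2 := by rw [hτ]; nlinarith
  obtain ⟨ρ, y, hFL, hρ, hy⟩ := exists_followLeader (M := M) (W := W) (ℓ := ℓ) (τ := τ) (N := n + 1)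
    (u := a) (y := x) hℓ0 (by positivity) hτℓ (by linarith) ha0 haM haN hapos
    (fun i hi => by
      rw [hai i hi]
      have := hxs i hi
      field_simp [show x (i + 1) - x i ≠ 0 by linarith])
    hdec
  have hC : (Λ + Λ ^ 2) * (4 + 4 * W) * m / (n + 1) = (Λ + Λ ^ 2) * (4 + 4 * W) * ℓ := by
    rw [hℓ]; ring
  have hNτ : ((n + 1 : ℕ) : ℝ) * τ ≤ ℓ / 2 := by
    have : ((n + 1 : ℕ) : ℝ) * τ = m * ℓ ^ 2 / 8 := by rw [← hNℓ, hτ]; ring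
    rw [this]; nlinarith
  have hNτℓ : ((n + 1 : ℕ) : ℝ) * (τ / ℓ) ≤ ℓ / 4 := by
    have : ((n + 1 : ℕ) : ℝ) * (τ / ℓ) = m * ℓ / 8 := by
      rw [← hNℓ, hτ]; field_simp
    rw [this]; nlinarith
  have hbase : (4 + 4 * W) * ℓ ≤ (Λ + Λ ^ 2) * (4 + 4 * W) * ℓ := by
    have h1 : 1 ≤ Λ + Λ ^ 2 := by nlinarith
    have h2 : 0 ≤ (4 + 4 * W) * ℓ := by positivity
    nlinarith
  have hWℓ : 0 ≤ W * ℓ := by positivity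
  rw [hC]
  refine ⟨τ, FollowLeader.density (n + 1) ρ y,
    hFL.approxLWR hM hκ hκM ?_ ?_ ?_ ?_ ?_ ?_ fun z => ?_⟩
  · rw [hy]; exact (hx 0).1.1
  · rw [hy]; exact (hx (n + 1)).1.2
  · linarith
  · linarith
  · linarith
  · have h1 : ((n + 1 : ℕ) : ℝ) * (2 * τ + 2 * (τ / ℓ)) + 4 * ℓ * W ≤ (4 + 4 * W) * ℓ := by linarith
    have h2 : ((n + 1 : ℕ) : ℝ) * (τ / ℓ) ≤ (4 + 4 * W) * ℓ := by linarith
    refine (add_le_add (mul_le_mul_of_nonneg_left h1 (zero_le_one.trans hΛ1))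
      (mul_le_mul_of_nonneg_left h2 (sq_nonneg Λ))).trans (le_of_eq ?_)
    ring
  · have hp0 : p ≤ y 0 0 := by rw [hy]; exact (hx 0).1.1
    change |_ - G z| ≤ _
    have hF := fun {a b : ℝ} (hab : a ≤ b) => (hFL.integral_density_sub_mem p 0 hab).1
    rcases FollowLeader.exists_cell (n + 1) y 0 z with h | h | ⟨i, hi, h⟩
    · rw [hFL.integral_density_of_le hp0 0 h.le]
      have h1 : G z ≤ G (x 0) := hGmono (by rw [hy] at h; exact h.le)
      rw [hGx 0 (Nat.zero_le _)] at h1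
      have h2 := (hGm z).1
      simp at h1
      rw [zero_sub, abs_neg, abs_of_nonneg h2]; linarith
    · rw [hFL.integral_density_of_ge hp0 0 h]
      have h1 : G (x (n + 1)) ≤ G z := hGmono (by rw [hy] at h; exact h)
      rw [hGx (n + 1) le_rfl] at h1
      have h2 := (hGm z).2
      rw [hNℓ] at h1 ⊢
      rw [abs_le]; constructor <;> linarith
    · have a1 := hFL.integral_density_eq hp0 0 hi.le
      have a2 := hFL.integral_density_eq hp0 0 (show i + 1 ≤ n + 1 by omega)
      have b1 := hF h.1
      have b2 := hF h.2.le
      rw [hy] at h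
      have c1 := hGmono h.1
      have c2 := hGmono h.2.le
      rw [hGx i hi.le] at c1
      rw [hGx (i + 1) hi] at c2
      push_cast at a2 c2
      rw [abs_le]; constructor <;> linarith

theorem intervalIntegrable_of_mem_Icc {f : ℝ → ℝ} {m M : ℝ} (hf : Measurable f)
    (hM : ∀ y, f y ∈ Icc m M) (a b : ℝ) : IntervalIntegrable f volume a b := by
  rw [intervalIntegrable_iff]
  refine Measure.integrableOn_of_bounded (M := max |m| |M|) (by simp) hf.aestronglyMeasurable
    (Eventually.of_forall fun y => ?_)
  exact abs_le_max_abs_abs (hM y).1 (hM y).2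

theorem abs_primitive_sub_le {f : ℝ → ℝ} {M : ℝ} (hf : Measurable f) (hM : ∀ y, f y ∈ Icc 0 M)
    (p a b : ℝ) : |(∫ z in p..b, f z) - ∫ z in p..a, f z| ≤ M * |b - a| := by
  rw [intervalIntegral.integral_interval_sub_left (intervalIntegrable_of_mem_Icc hf hM _ _)
    (intervalIntegrable_of_mem_Icc hf hM _ _)]
  rw [← Real.norm_eq_abs]
  refine intervalIntegral.norm_integral_le_of_norm_le_const fun z _ => ?_
  rw [Real.norm_eq_abs, abs_of_nonneg (hM z).1]
  exact (hM z).2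

theorem convexOn_primitive {f : ℝ → ℝ} (hf : Monotone f) (p : ℝ) :
    ConvexOn ℝ univ fun x => ∫ z in p..x, f z := by
  have hi : ∀ a b, IntervalIntegrable f volume a b := fun a b => hf.intervalIntegrable
  refine convexOn_of_slope_mono_adjacent convex_univ fun {x y z} _ _ hxy hyz => ?_
  rw [intervalIntegral.integral_interval_sub_left (hi _ _) (hi _ _),
    intervalIntegral.integral_interval_sub_left (hi _ _) (hi _ _)]
  trans f y
  · rw [div_le_iff₀ (by linarith)]
    have := intervalIntegral.integral_mono_on hxy.le (hi x y) (intervalIntegrable_const (c := f y))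
      fun s hs => hf hs.2
    simpa [mul_comm] using this
  · rw [le_div_iff₀ (by linarith)]
    have := intervalIntegral.integral_mono_on hyz.le (intervalIntegrable_const (c := f y)) (hi y z)
      fun s hs => hf hs.1
    simpa [mul_comm] using this

theorem ConvexOn.of_tendsto {f : ℕ → ℝ → ℝ} {F : ℝ → ℝ} (hf : ∀ n, ConvexOn ℝ univ (f n))
    (h : ∀ x, Tendsto (fun n => f n x) atTop (nhds (F x))) : ConvexOn ℝ univ F :=
  ⟨convex_univ, fun x _ y _ a b ha hb hab => le_of_tendsto_of_tendsto' (h _)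
    (((h x).const_smul a).add ((h y).const_smul b)) fun n =>
      (hf n).2 (mem_univ x) (mem_univ y) ha hb hab⟩

theorem exists_subseq_tendsto {ι : Type*} [Countable ι] (f : ℕ → ι → ℝ) (B : ι → ℝ)
    (hB : ∀ n i, |f n i| ≤ B i) :
    ∃ s : ℕ → ℕ, StrictMono s ∧ ∃ F : ι → ℝ,
      ∀ i, Tendsto (fun n => f (s n) i) atTop (nhds (F i)) := by
  have hc : IsCompact (univ.pi fun i => Icc (-B i) (B i)) :=
    isCompact_univ_pi fun i => isCompact_Icc
  obtain ⟨F, _, s, hs, h⟩ := hc.tendsto_subseq (x := f) fun n i _ => abs_le.1 (hB n i)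
  exact ⟨s, hs, F, fun i => (tendsto_pi_nhds.1 h) i⟩

theorem exists_tendsto_of_dense {X : Type*} [PseudoMetricSpace X] {f : ℕ → X → ℝ} {L : ℝ}
    {δ : ℕ → ℝ} (hδ : Tendsto δ atTop (nhds 0)) (hL : 0 ≤ L)
    (hf : ∀ n x y, |f n x - f n y| ≤ L * dist x y + δ n) {D : Set X} (hD : Dense D)
    (h : ∀ x ∈ D, ∃ l, Tendsto (fun n => f n x) atTop (nhds l)) (x : X) :
    ∃ l, Tendsto (fun n => f n x) atTop (nhds l) := by
  refine cauchySeq_tendsto_of_complete (Metric.cauchySeq_iff'.2 fun e he => ?_)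
  obtain ⟨y, hy, hxy⟩ := hD.exists_dist_lt x (show 0 < e / (8 * (L + 1)) by positivity)
  obtain ⟨l, hl⟩ := h y hy
  have hxy' : L * dist x y ≤ e / 8 := by
    rw [lt_div_iff₀ (by positivity)] at hxy
    nlinarith [dist_nonneg (x := x) (y := y)]
  have h1 := (Metric.tendsto_nhds.1 hl) (e / 8) (by positivity)
  have h2 := (Metric.tendsto_nhds.1 hδ) (e / 8) (by positivity)
  obtain ⟨N, hN⟩ := eventually_atTop.1 (h1.and h2)
  refine ⟨N, fun n hn => ?_⟩
  obtain ⟨a1, a2⟩ := hN n hn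
  obtain ⟨b1, b2⟩ := hN N le_rfl
  rw [Real.dist_eq] at *
  rw [sub_zero] at a2 b2
  have c1 := abs_le.1 (hf n x y)
  have c2 := abs_le.1 (hf N x y)
  rw [abs_lt] at *
  constructor <;> linarith

theorem HasVariationLE.exists_rightDeriv {V M p : ℝ} {u : ℕ → ℝ → ℝ} {G : ℝ → ℝ}
    (hu : ∀ n, Measurable (u n)) (huM : ∀ n y, u n y ∈ Icc 0 M)
    (hV : ∀ n, HasVariationLE V (u n))
    (hG : ∀ x, Tendsto (fun n => ∫ z in p..x, u n z) atTop (nhds (G x))) :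
    HasVariationLE V (fun x => derivWithin G (Ioi x) x) ∧
      ∀ x, HasDerivWithinAt G (derivWithin G (Ioi x) x) (Ioi x) x := by
  choose P hP hPV huP using hV
  have hPi := fun n => intervalIntegrable_of_mem_Icc (hP n).measurable (hPV n)
  have hui := fun n => intervalIntegrable_of_mem_Icc (hu n) (huM n)
  have hV0 : 0 ≤ V := (hPV 0 0).1.trans (hPV 0 0).2
  have hlip := fun n => abs_primitive_sub_le (hP n).measurable (hPV n) p
  obtain ⟨s, hs, Q₀, hQ₀⟩ := exists_subseq_tendsto (fun n (q : ℚ) => ∫ z in p..(q : ℝ), P n z)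
    (fun q => V * |(q : ℝ) - p|) fun n q => by simpa using hlip n p q
  have hQ := exists_tendsto_of_dense (f := fun n x => ∫ z in p..x, P (s n) z) (L := V)
    (δ := fun _ => 0) tendsto_const_nhds hV0
    (fun n x y => by simpa [Real.dist_eq] using hlip (s n) y x) Rat.denseRange_cast
    (by rintro _ ⟨q, rfl⟩; exact ⟨_, hQ₀ q⟩)
  choose Q hQ using hQ
  have hGs : ∀ x, Tendsto (fun n => ∫ z in p..x, u (s n) z) atTop (nhds (G x)) := fun x =>
    (hG x).comp hs.tendsto_atTop
  have conv1 : ConvexOn ℝ univ (fun x => Q x + G x) := by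
    refine ConvexOn.of_tendsto (f := fun n x => ∫ z in p..x, (P (s n) z + u (s n) z))
      (fun n => convexOn_primitive (fun a b hab => ?_) p) fun x => ?_
    · have := (abs_le.1 (huP (s n) a b hab)).1
      change P (s n) a + u (s n) a ≤ P (s n) b + u (s n) b
      linarith
    · simp_rw [intervalIntegral.integral_add (hPi _ _ _) (hui _ _ _)]
      exact (hQ x).add (hGs x)
  have conv2 : ConvexOn ℝ univ (fun x => Q x - G x) := by
    refine ConvexOn.of_tendsto (f := fun n x => ∫ z in p..x, (P (s n) z - u (s n) z))
      (fun n => convexOn_primitive (fun a b hab => ?_) p) fun x => ?_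
    · have := (abs_le.1 (huP (s n) a b hab)).2
      change P (s n) a - u (s n) a ≤ P (s n) b - u (s n) b
      linarith
    · simp_rw [intervalIntegral.integral_sub (hPi _ _ _) (hui _ _ _)]
      exact (hQ x).sub (hGs x)
  have d1 := fun x => conv1.hasDerivWithinAt_rightDeriv_of_mem_interior (x := x) (by simp)
  have d2 := fun x => conv2.hasDerivWithinAt_rightDeriv_of_mem_interior (x := x) (by simp)
  have m1 := conv1.monotoneOn_rightDeriv
  have m2 := conv2.monotoneOn_rightDeriv
  rw [interior_univ, monotoneOn_univ] at m1 m2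
  set A := fun x => derivWithin (fun x => Q x + G x) (Ioi x) x with hA
  set B := fun x => derivWithin (fun x => Q x - G x) (Ioi x) x with hB
  have dG : ∀ x, HasDerivWithinAt G ((A x - B x) / 2) (Ioi x) x := fun x => by
    have := ((d1 x).sub (d2 x)).div_const 2
    refine this.congr (fun y _ => ?_) ?_ <;> simp
  have dQ : ∀ x, HasDerivWithinAt Q ((A x + B x) / 2) (Ioi x) x := fun x => by
    have := ((d1 x).add (d2 x)).div_const 2
    refine this.congr (fun y _ => ?_) ?_ <;> simp
  have hGd : ∀ x, derivWithin G (Ioi x) x = (A x - B x) / 2 := fun x =>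
    (dG x).derivWithin (uniqueDiffWithinAt_Ioi x)
  refine ⟨⟨fun x => (A x + B x) / 2, fun x y hxy => ?_, fun x => ?_, fun x y hxy => ?_⟩,
    fun x => ?_⟩
  · have := m1 hxy
    have := m2 hxy
    simp only at *
    linarith
  · have h := (hasDerivWithinAt_iff_tendsto_slope' self_notMem_Ioi).1 (dQ x)
    have hbd : ∀ y ∈ Ioi x, slope Q x y ∈ Icc 0 V := fun y hy => by
      have hy : x < y := hy
      have h1 : Tendsto (fun n => ∫ z in x..y, P (s n) z) atTop (nhds (Q y - Q x)) := by
        simpa only [intervalIntegral.integral_interval_sub_left (hPi _ _ _) (hPi _ _ _)] using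
          (hQ y).sub (hQ x)
      rw [slope_def_field]
      constructor
      · refine div_nonneg (ge_of_tendsto' h1 fun n => ?_) (by linarith)
        exact intervalIntegral.integral_nonneg hy.le fun z _ => (hPV _ z).1
      · rw [div_le_iff₀ (by linarith)]
        refine le_of_tendsto' h1 fun n => ?_
        have := intervalIntegral.integral_mono_on hy.le (hPi (s n) x y)
          (intervalIntegrable_const (c := V)) fun z _ => (hPV _ z).2
        simpa [mul_comm] using this
    exact isClosed_Icc.mem_of_tendsto h (eventually_mem_nhdsWithin.mono hbd)
  · have h1 := m1 hxy
    have h2 := m2 hxy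
    simp only at *
    rw [hGd, hGd, abs_le]
    constructor <;> linarith
  · rw [hGd]; exact dG x

theorem HasVariationLE.integral_abs_sub_average_le {V M h a b : ℝ} {u : ℝ → ℝ}
    (hV : HasVariationLE V u) (hu : Measurable u) (huM : ∀ y, u y ∈ Icc 0 M) (hh : 0 < h)
    (hab : a ≤ b) :
    ∫ x in a..b, |u x - (∫ z in x..x + h, u z) / h| ≤ h * V := by
  obtain ⟨P, hP, hPV, huP⟩ := hV
  have hPi := intervalIntegrable_of_mem_Icc hP.measurable hPV
  have hui := intervalIntegrable_of_mem_Icc hu huM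
  have hcont : Continuous fun x => ∫ z in x..x + h, u z := by
    have h1 := intervalIntegral.continuous_primitive hui 0
    have : (fun x => ∫ z in x..x + h, u z) =
        fun x => (∫ z in (0 : ℝ)..x + h, u z) - ∫ z in (0 : ℝ)..x, u z := by
      funext x
      rw [intervalIntegral.integral_interval_sub_left (hui _ _) (hui _ _)]
    rw [this]
    exact (h1.comp (continuous_add_const h)).sub h1
  have hpt : ∀ x, |u x - (∫ z in x..x + h, u z) / h| ≤ P (x + h) - P x := fun x => by
    have h1 : u x - (∫ z in x..x + h, u z) / h = (∫ z in x..x + h, (u x - u z)) / h := by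
      rw [intervalIntegral.integral_sub intervalIntegrable_const (hui _ _)]
      simp
      field_simp
    rw [h1, abs_div, abs_of_pos hh, div_le_iff₀ hh]
    have := intervalIntegral.norm_integral_le_of_norm_le_const (a := x) (b := x + h)
      (f := fun z => u x - u z) (C := P (x + h) - P x) fun z hz => by
        rw [uIoc_of_le (by linarith)] at hz
        rw [Real.norm_eq_abs, abs_sub_comm]
        exact (huP x z hz.1.le).trans (sub_le_sub_right (hP hz.2) _)
    simpa [abs_of_pos hh] using this
  have hPh : ∀ a b, IntervalIntegrable (fun x => P (x + h)) volume a b := fun a b =>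
    intervalIntegrable_of_mem_Icc (hP.measurable.comp (measurable_add_const h)) (fun _ => hPV _) a b
  have h2 := intervalIntegral.integral_mono_on hab
    ((hui a b).sub ((hcont.intervalIntegrable a b).div_const h)).abs ((hPh a b).sub (hPi a b))
    fun x _ => hpt x
  refine h2.trans ?_
  rw [intervalIntegral.integral_sub (hPh a b) (hPi a b), intervalIntegral.integral_comp_add_right]
  have h3 : (∫ x in a + h..b + h, P x) - ∫ x in a..b, P x =
      (∫ x in b..b + h, P x) - ∫ x in a..a + h, P x := by
    rw [← intervalIntegral.integral_add_adjacent_intervals (hPi (a + h) b) (hPi b (b + h)),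
      ← intervalIntegral.integral_add_adjacent_intervals (hPi a (a + h)) (hPi (a + h) b)]
    ring
  rw [h3]
  have h4 : 0 ≤ ∫ x in a..a + h, P x :=
    intervalIntegral.integral_nonneg (by linarith) fun x _ => (hPV x).1
  have h5 := intervalIntegral.integral_mono_on (show b ≤ b + h by linarith) (hPi b (b + h))
    (intervalIntegrable_const (c := V)) fun x _ => (hPV x).2
  simp at h5
  linarith

theorem tendsto_integral_abs_sub_of_variation {ι : Type*} {l : Filter ι} [l.IsCountablyGenerated]
    {V M p a b : ℝ} {u : ι → ℝ → ℝ} {w : ℝ → ℝ} (hV : ∀ i, HasVariationLE V (u i))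
    (hu : ∀ i, Measurable (u i)) (huM : ∀ i y, u i y ∈ Icc 0 M) (hwV : HasVariationLE V w)
    (hw : Measurable w) (hwM : ∀ y, w y ∈ Icc 0 M) (hab : a ≤ b)
    (h : ∀ x, Tendsto (fun i => ∫ z in p..x, u i z) l (nhds (∫ z in p..x, w z))) :
    Tendsto (fun i => ∫ x in a..b, |u i x - w x|) l (nhds 0) := by
  have hui := fun i => intervalIntegrable_of_mem_Icc (hu i) (huM i)
  have hwi := intervalIntegrable_of_mem_Icc hw hwM
  have hM0 : 0 ≤ M := (hwM 0).1.trans (hwM 0).2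
  have hV0 : 0 ≤ V := by
    obtain ⟨P, _, hP, _⟩ := hwV
    exact (hP 0).1.trans (hP 0).2
  have hcont : ∀ {f : ℝ → ℝ} (s : ℝ), (∀ a b, IntervalIntegrable f volume a b) →
      Continuous fun x => ∫ z in x..x + s, f z := fun {f} s hf => by
    have h1 := intervalIntegral.continuous_primitive hf 0
    have : (fun x => ∫ z in x..x + s, f z) =
        fun x => (∫ z in (0 : ℝ)..x + s, f z) - ∫ z in (0 : ℝ)..x, f z := by
      funext x
      rw [intervalIntegral.integral_interval_sub_left (hf _ _) (hf _ _)]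
    rw [this]
    exact (h1.comp (continuous_add_const s)).sub h1
  rw [Metric.tendsto_nhds]
  intro e he
  set s := e / (4 * (V + 1)) with hs
  have hs0 : 0 < s := by positivity
  have hsV : s * V ≤ e / 4 := by
    rw [hs, div_mul_eq_mul_div, div_le_div_iff₀ (by positivity) (by norm_num)]
    nlinarith
  have hmid : Tendsto (fun i => ∫ x in a..b,
      |(∫ z in x..x + s, u i z) / s - (∫ z in x..x + s, w z) / s|) l (nhds 0) := by
    have := intervalIntegral.tendsto_integral_filter_of_dominated_convergence (a := a) (b := b)
      (μ := volume) (l := l) (F := fun i x =>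
        |(∫ z in x..x + s, u i z) / s - (∫ z in x..x + s, w z) / s|) (f := fun _ => 0)
      (fun _ => 2 * M) ?_ ?_ intervalIntegrable_const ?_
    · simpa using this
    · refine Eventually.of_forall fun i => Continuous.aestronglyMeasurable ?_
      exact (((hcont s (hui i)).div_const s).sub ((hcont s hwi).div_const s)).abs
    · refine Eventually.of_forall fun i => Eventually.of_forall fun x _ => ?_
      have key : ∀ {f : ℝ → ℝ}, (∀ y, f y ∈ Icc 0 M) → |(∫ z in x..x + s, f z) / s| ≤ M :=
        fun {f} hf => by
          rw [abs_div, abs_of_pos hs0, div_le_iff₀ hs0]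
          have := intervalIntegral.norm_integral_le_of_norm_le_const (a := x) (b := x + s)
            (f := f) (C := M) fun z _ => by
              rw [Real.norm_eq_abs, abs_of_nonneg (hf z).1]; exact (hf z).2
          simpa [abs_of_pos hs0] using this
      rw [Real.norm_eq_abs, abs_abs]
      refine (abs_sub _ _).trans ?_
      linarith [key (huM i), key hwM]
    · refine Eventually.of_forall fun x _ => ?_
      have h1 := ((h (x + s)).sub (h x)).div_const s
      simp_rw [intervalIntegral.integral_interval_sub_left (hui _ _ _) (hui _ _ _),
        intervalIntegral.integral_interval_sub_left (hwi _ _) (hwi _ _)] at h1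
      have := (h1.sub_const ((∫ z in x..x + s, w z) / s)).abs
      simpa using this
  filter_upwards [(Metric.tendsto_nhds.1 hmid) (e / 4) (by positivity)] with i hi
  rw [Real.dist_0_eq_abs] at hi ⊢
  have hi := (le_abs_self _).trans_lt hi
  rw [abs_of_nonneg (intervalIntegral.integral_nonneg hab fun _ _ => abs_nonneg _)]
  have iu : IntervalIntegrable (fun x => |u i x - (∫ z in x..x + s, u i z) / s|) volume a b :=
    ((hui i a b).sub (((hcont s (hui i)).intervalIntegrable a b).div_const s)).abs
  have iw : IntervalIntegrable (fun x => |w x - (∫ z in x..x + s, w z) / s|) volume a b :=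
    ((hwi a b).sub (((hcont s hwi).intervalIntegrable a b).div_const s)).abs
  have im : IntervalIntegrable (fun x =>
      |(∫ z in x..x + s, u i z) / s - (∫ z in x..x + s, w z) / s|) volume a b :=
    ((((hcont s (hui i)).div_const s).sub ((hcont s hwi).div_const s)).abs).intervalIntegrable a b
  have h1 := (hV i).integral_abs_sub_average_le (hu i) (huM i) hs0 hab
  have h2 := hwV.integral_abs_sub_average_le hw hwM hs0 hab
  have h3 := intervalIntegral.integral_mono_on hab ((hui i a b).sub (hwi a b)).abs
    ((iu.add im).add iw) fun x _ => by
      have := abs_add_three (u i x - (∫ z in x..x + s, u i z) / s)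
        ((∫ z in x..x + s, u i z) / s - (∫ z in x..x + s, w z) / s)
        (-(w x - (∫ z in x..x + s, w z) / s))
      rw [abs_neg] at this
      refine le_trans (le_of_eq ?_) this
      congr 1; ring
  rw [intervalIntegral.integral_add (iu.add im) iw, intervalIntegral.integral_add iu im] at h3
  linarith

theorem HasDerivWithinAt.mem_of_slope_mem {G : ℝ → ℝ} {d x b : ℝ} {s : Set ℝ} (hs : IsClosed s)
    (hG : HasDerivWithinAt G d (Ioi x) x) (hb : x < b) (h : ∀ y ∈ Ioo x b, slope G x y ∈ s) :
    d ∈ s := by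
  refine hs.mem_of_tendsto ((hasDerivWithinAt_iff_tendsto_slope' self_notMem_Ioi).1 hG) ?_
  filter_upwards [Ioo_mem_nhdsGT hb] with y hy using h y hy

theorem natFloor_mul_le {t τ : ℝ} (ht : 0 ≤ t) (hτ : 0 < τ) : ⌊t / τ⌋₊ * τ ≤ t := by
  rw [← le_div_iff₀ hτ]
  exact Nat.floor_le (by positivity)

theorem lt_natFloor_add_one_mul (t : ℝ) {τ : ℝ} (hτ : 0 < τ) : t < (⌊t / τ⌋₊ + 1) * τ := by
  rw [← div_lt_iff₀ hτ]
  exact Nat.lt_floor_add_one _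

theorem natFloor_mul_sub_le {s t τ : ℝ} (hτ : 0 < τ) (hst : s ≤ t) :
    ⌊t / τ⌋₊ * τ - ⌊s / τ⌋₊ * τ ≤ (t - s) + τ := by
  rcases le_total 0 t with ht | ht
  · have h1 := natFloor_mul_le ht hτ
    have h2 := lt_natFloor_add_one_mul s hτ
    linarith
  · have h1 : ⌊t / τ⌋₊ = 0 := Nat.floor_of_nonpos (div_nonpos_of_nonpos_of_nonneg ht hτ.le)
    have h2 : 0 ≤ (⌊s / τ⌋₊ : ℝ) * τ := by positivity
    rw [h1]
    push_cast
    linarith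

/-- A limit of approximate solutions: the properties that survive in the limit. -/
structure IsLimitLWR (M V p : ℝ) (g : ℝ → ℝ) (r : ℝ → ℝ → ℝ) : Prop where
  measurable : Measurable (Function.uncurry r)
  range : ∀ t x, r t x ∈ Icc 0 M
  variation : ∀ t, HasVariationLE V (r t)
  left : ∀ t x, x < p + (1 - M) * t → r t x = 0
  right : ∀ t x, 0 ≤ t → 1 + t ≤ x → r t x = 0
  flux : ∀ s t x, |(∫ z in p..x, r t z) - ∫ z in p..x, r s z| ≤ |t - s|
  init : ∀ x, ∫ z in p..x, r 0 z = ∫ z in p..x, g z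

theorem ApproxLWR.abs_primitive_sub_le {M V p K ε τ : ℝ} {g : ℝ → ℝ} {u : ℕ → ℝ → ℝ}
    (h : ApproxLWR M V p K ε τ g u) (hM1 : M ≤ 1) (s t x y : ℝ) :
    |(∫ z in p..x, u ⌊t / τ⌋₊ z) - ∫ z in p..y, u ⌊s / τ⌋₊ z| ≤ |t - s| + |x - y| + 2 * ε := by
  wlog hst : s ≤ t generalizing s t x y
  · rw [abs_sub_comm, abs_sub_comm t, abs_sub_comm x]
    exact this t s y x (not_le.1 hst).le
  have h1 := h.flux _ _ (Nat.floor_mono (div_le_div_of_nonneg_right hst h.step_pos.le)) x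
  have h2 := _root_.abs_primitive_sub_le (h.measurable ⌊s / τ⌋₊) (h.range _) p y x
  have h3 := natFloor_mul_sub_le h.step_pos hst
  have h4 := h.step_le
  have h5 : M * |x - y| ≤ |x - y| := mul_le_of_le_one_left (abs_nonneg _) hM1
  rw [abs_of_nonneg (show 0 ≤ t - s by linarith)]
  rw [abs_le] at *
  constructor <;> linarith

theorem exists_isLimitLWR {M V p K : ℝ} {g : ℝ → ℝ} (hM1 : M ≤ 1) (hp : p ≤ 1)
    {ε τ : ℕ → ℝ} {u : ℕ → ℕ → ℝ → ℝ} (hε : Tendsto ε atTop (nhds 0))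
    (hu : ∀ n, ApproxLWR M V p K (ε n) (τ n) g (u n)) :
    ∃ s : ℕ → ℕ, StrictMono s ∧ ∃ r, IsLimitLWR M V p g r ∧ ∀ t, 0 ≤ t →
      Tendsto (fun n => ∫ x, |u (s n) ⌊t / τ (s n)⌋₊ x - r t x|) atTop (nhds 0) := by
  have hF := fun n => (hu n).abs_primitive_sub_le hM1
  have hFb : ∀ n t x, |∫ z in p..x, u n ⌊t / τ n⌋₊ z| ≤ |x - p| := fun n t x => by
    have := _root_.abs_primitive_sub_le ((hu n).measurable ⌊t / τ n⌋₊) ((hu n).range _) p p x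
    simp only [intervalIntegral.integral_same, sub_zero] at this
    exact this.trans (mul_le_of_le_one_left (abs_nonneg _) hM1)
  obtain ⟨s, hs, F₀, hF₀⟩ := exists_subseq_tendsto
    (fun n (q : ℚ × ℚ) => ∫ z in p..(q.2 : ℝ), u n ⌊(q.1 : ℝ) / τ n⌋₊ z) (fun q => |(q.2 : ℝ) - p|)
    fun n q => hFb n q.1 q.2
  have hεs : Tendsto (fun n => ε (s n)) atTop (nhds 0) := hε.comp hs.tendsto_atTop
  have hlim := exists_tendsto_of_dense
    (f := fun n (q : ℝ × ℝ) => ∫ z in p..q.2, u (s n) ⌊q.1 / τ (s n)⌋₊ z) (L := 2)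
    (δ := fun n => 2 * ε (s n)) (by simpa using hεs.const_mul 2) (by norm_num)
    (fun n x y => by
      refine (hF (s n) y.1 x.1 x.2 y.2).trans ?_
      have h1 : |x.1 - y.1| ≤ dist x y := le_max_left _ _
      have h2 : |x.2 - y.2| ≤ dist x y := le_max_right _ _
      linarith)
    (Rat.denseRange_cast.prodMap Rat.denseRange_cast)
    (by rintro _ ⟨q, rfl⟩; exact ⟨_, hF₀ q⟩)
  choose F hF' using hlim
  have hFlim : ∀ t x, Tendsto (fun n => ∫ z in p..x, u (s n) ⌊t / τ (s n)⌋₊ z) atTop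
      (nhds (F (t, x))) := fun t x => hF' (t, x)
  clear hF'
  have hFlip : ∀ s t x y, |F (t, x) - F (s, y)| ≤ |t - s| + |x - y| := fun s' t x y => by
    refine le_of_tendsto_of_tendsto' ((hFlim t x).sub (hFlim s' y)).abs
      (b := atTop) (g := fun n => |t - s'| + |x - y| + 2 * ε (s n)) ?_ fun n => hF _ _ _ _ _
    simpa using (hεs.const_mul 2).const_add (|t - s'| + |x - y|)
  have hFcont : Continuous F := by
    refine (LipschitzWith.of_dist_le_mul (K := 2) fun x y => ?_).continuous
    refine (hFlip y.1 x.1 x.2 y.2).trans ?_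
    have h1 : |x.1 - y.1| ≤ dist x y := le_max_left _ _
    have h2 : |x.2 - y.2| ≤ dist x y := le_max_right _ _
    simp only [NNReal.coe_ofNat]
    linarith
  have hder := fun t => HasVariationLE.exists_rightDeriv (G := fun x => F (t, x))
    (u := fun n => u (s n) ⌊t / τ (s n)⌋₊) (fun n => (hu _).measurable _) (fun n => (hu _).range _)
    (fun n => (hu _).variation _) (hFlim t)
  set r : ℝ → ℝ → ℝ := fun t x => derivWithin (fun x => F (t, x)) (Ioi x) x with hr
  have hui := fun n j => intervalIntegrable_of_mem_Icc ((hu n).measurable j) ((hu n).range j)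
  have hinc : ∀ t x y, Tendsto (fun n => ∫ z in x..y, u (s n) ⌊t / τ (s n)⌋₊ z) atTop
      (nhds (F (t, y) - F (t, x))) := fun t x y => by
    simpa only [intervalIntegral.integral_interval_sub_left (hui _ _ _ _) (hui _ _ _ _)] using
      (hFlim t y).sub (hFlim t x)
  have hrange : ∀ t x, r t x ∈ Icc 0 M := fun t x => by
    refine ((hder t).2 x).mem_of_slope_mem isClosed_Icc (lt_add_one x) fun y hy => ?_
    rw [slope_def_field]
    constructor
    · refine div_nonneg (ge_of_tendsto' (hinc t x y) fun n => ?_) (by linarith [hy.1])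
      exact intervalIntegral.integral_nonneg hy.1.le fun z _ => ((hu _).range _ z).1
    · rw [div_le_iff₀ (by linarith [hy.1])]
      refine le_of_tendsto' (hinc t x y) fun n => ?_
      have := intervalIntegral.integral_mono_on hy.1.le (hui (s n) ⌊t / τ (s n)⌋₊ x y)
        (intervalIntegrable_const (c := M)) fun z _ => ((hu _).range _ z).2
      simpa [mul_comm] using this
  have hmeas : Measurable (Function.uncurry r) := by
    refine measurable_of_tendsto_metrizable (f := fun (n : ℕ) (q : ℝ × ℝ) =>
      (F (q.1, q.2 + 1 / ((n : ℝ) + 1)) - F q) / (1 / ((n : ℝ) + 1))) (fun n => ?_)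
      (tendsto_pi_nhds.2 fun q => ?_)
    · exact ((hFcont.comp (by fun_prop)).sub hFcont).measurable.div_const _
    · have h1 := (hasDerivWithinAt_iff_tendsto_slope' self_notMem_Ioi).1 ((hder q.1).2 q.2)
      have h2 : Tendsto (fun n : ℕ => q.2 + 1 / ((n : ℝ) + 1)) atTop
          (nhdsWithin q.2 (Ioi q.2)) := by
        refine tendsto_nhdsWithin_iff.2 ⟨?_, Eventually.of_forall fun n => ?_⟩
        · simpa using tendsto_one_div_add_atTop_nhds_zero_nat.const_add q.2
        · have : (0 : ℝ) < 1 / ((n : ℝ) + 1) := by positivity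
          simpa using this
      refine (h1.comp h2).congr fun n => ?_
      simp [slope_def_field]
  have hmeas' : ∀ t, Measurable (r t) := fun t => hmeas.of_uncurry_left
  have hint : ∀ t x, ∫ z in p..x, r t z = F (t, x) := fun t x => by
    rw [intervalIntegral.integral_eq_sub_of_hasDeriv_right (f := fun x => F (t, x))
      (hFcont.comp (by fun_prop)).continuousOn (fun x _ => (hder t).2 x)
      (intervalIntegrable_of_mem_Icc (hmeas' t) (hrange t) _ _)]
    have : F (t, p) = 0 := tendsto_nhds_unique (hFlim t p) (by simp)
    simp [this]
  have hleft : ∀ t x, x < p + (1 - M) * t → r t x = 0 := fun t x hx => by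
    rw [← mem_singleton_iff]
    refine ((hder t).2 x).mem_of_slope_mem isClosed_singleton hx fun y hy => ?_
    have h1 : F (t, y) - F (t, x) = 0 := by
      refine tendsto_nhds_unique (hinc t x y) (tendsto_const_nhds.congr' ?_)
      have h2 : Tendsto (fun n => p + (1 - M) * (t - ε (s n))) atTop
          (nhds (p + (1 - M) * t)) := by
        simpa using ((hεs.const_sub t).const_mul (1 - M)).const_add p
      filter_upwards [h2.eventually (lt_mem_nhds hy.2)] with n hn
      symm
      rw [intervalIntegral.integral_of_le hy.1.le]
      refine setIntegral_eq_zero_of_forall_eq_zero fun z hz => (hu _).left _ z ?_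
      have h3 := lt_natFloor_add_one_mul t (hu (s n)).step_pos
      have h4 := (hu (s n)).step_le
      have h5 : (1 - M) * (t - ε (s n)) ≤ (1 - M) * (⌊t / τ (s n)⌋₊ * τ (s n)) :=
        mul_le_mul_of_nonneg_left (by linarith) (by linarith)
      linarith [hz.2]
    rw [mem_singleton_iff, slope_def_field, h1, zero_div]
  have hright : ∀ t x, 0 ≤ t → 1 + t ≤ x → r t x = 0 := fun t x ht hx => by
    rw [← mem_singleton_iff]
    refine ((hder t).2 x).mem_of_slope_mem isClosed_singleton (lt_add_one x) fun y hy => ?_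
    have h1 : F (t, y) - F (t, x) = 0 := by
      refine tendsto_nhds_unique (hinc t x y) (tendsto_const_nhds.congr fun n => ?_)
      symm
      rw [intervalIntegral.integral_of_le hy.1.le]
      refine setIntegral_eq_zero_of_forall_eq_zero fun z hz => (hu _).right _ z ?_
      linarith [natFloor_mul_le ht (hu (s n)).step_pos, hz.1]
    rw [mem_singleton_iff, slope_def_field, h1, zero_div]
  refine ⟨s, hs, r, ⟨hmeas, hrange, fun t => (hder t).1, hleft, hright, fun s' t x => ?_,
    fun x => ?_⟩, fun t ht => ?_⟩
  · rw [hint, hint]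
    simpa using hFlip s' t x x
  · rw [hint]
    refine tendsto_nhds_unique (hFlim 0 x) ?_
    rw [tendsto_iff_dist_tendsto_zero]
    refine squeeze_zero (fun _ => dist_nonneg) (fun n => ?_) hεs
    simpa [Real.dist_eq] using (hu (s n)).init x
  · have h1 := tendsto_integral_abs_sub_of_variation (l := atTop) (p := p) (a := p - 1) (b := 1 + t)
      (u := fun n => u (s n) ⌊t / τ (s n)⌋₊) (w := r t) (fun n => (hu _).variation _)
      (fun n => (hu _).measurable _) (fun n => (hu _).range _) (hder t).1 (hmeas' t) (hrange t)
      (by linarith) fun x => by rw [hint]; exact hFlim t x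
    refine h1.congr fun n => intervalIntegral.integral_eq_integral_of_support_subset fun x hx => ?_
    by_contra hc
    refine hx ?_
    have h3 := natFloor_mul_le ht (hu (s n)).step_pos
    have h4 : 0 ≤ (1 - M) * t := mul_nonneg (by linarith) ht
    have h5 : 0 ≤ (1 - M) * (⌊t / τ (s n)⌋₊ * τ (s n)) :=
      mul_nonneg (by linarith) (mul_nonneg (Nat.cast_nonneg _) (hu (s n)).step_pos.le)
    rw [mem_Ioc, not_and_or, not_lt, not_le] at hc
    rcases hc with hc | hc
    · simp only [(hu (s n)).left _ x (by linarith), hleft t x (by linarith)]; simp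
    · simp only [(hu (s n)).right _ x (by linarith), hright t x ht (by linarith)]; simp

theorem integrable_of_bounded_of_support {f : ℝ → ℝ} {A a b : ℝ} (hf : Measurable f)
    (hA : ∀ y, |f y| ≤ A) (h0 : ∀ y, y ∉ Icc a b → f y = 0) : Integrable f := by
  have : IntegrableOn f (Icc a b) := Measure.integrableOn_of_bounded (M := A) (by simp)
    hf.aestronglyMeasurable (Eventually.of_forall hA)
  rwa [integrableOn_iff_integrable_of_support_subset] at this
  intro y hy
  by_contra h
  exact hy (h0 y h)

theorem abs_integral_le_of_support {f : ℝ → ℝ} {A R : ℝ} (hR : 0 ≤ R) (hA : ∀ y, |f y| ≤ A)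
    (h0 : ∀ y, y ∉ Icc (-R) R → f y = 0) : |∫ y, f y| ≤ 2 * R * A := by
  rw [← setIntegral_eq_integral_of_forall_compl_eq_zero (s := Icc (-R) R) fun y hy => h0 y hy,
    ← Real.norm_eq_abs]
  refine (norm_setIntegral_le_of_norm_le_const (C := A) (by simp) fun y _ => hA y).trans ?_
  rw [Measure.real, Real.volume_Icc, ENNReal.toReal_ofReal (by linarith)]
  linarith

theorem abs_integral_comp_mul_sub_le {E φ u w : ℝ → ℝ} {M Λ B a b : ℝ}
    (hE : ∀ x ∈ Icc 0 M, ∀ y ∈ Icc 0 M, |E x - E y| ≤ Λ * |x - y|) (hEm : Measurable E)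
    (hE0 : E 0 = 0) (hΛ : 0 ≤ Λ) (hu : Measurable u) (hw : Measurable w)
    (huM : ∀ y, u y ∈ Icc 0 M) (hwM : ∀ y, w y ∈ Icc 0 M) (hu0 : ∀ y, y ∉ Icc a b → u y = 0)
    (hw0 : ∀ y, y ∉ Icc a b → w y = 0) (hφ : Measurable φ) (hB : ∀ y, |φ y| ≤ B) :
    |(∫ y, E (u y) * φ y) - ∫ y, E (w y) * φ y| ≤ Λ * B * ∫ y, |u y - w y| := by
  have hM0 : 0 ≤ M := (huM 0).1.trans (huM 0).2
  have key : ∀ {f : ℝ → ℝ}, Measurable f → (∀ y, f y ∈ Icc 0 M) → (∀ y, y ∉ Icc a b → f y = 0) →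
      Integrable fun y => E (f y) * φ y := fun {f} hf hfM hf0 => by
    refine integrable_of_bounded_of_support (A := Λ * M * B) (a := a) (b := b)
      ((hEm.comp hf).mul hφ) (fun y => ?_) fun y hy => by rw [hf0 y hy, hE0, zero_mul]
    rw [abs_mul]
    refine mul_le_mul ?_ (hB y) (abs_nonneg _) (by positivity)
    have := hE (f y) (hfM y) 0 (left_mem_Icc.2 hM0)
    rw [hE0, sub_zero, sub_zero, abs_of_nonneg (hfM y).1] at this
    exact this.trans (mul_le_mul_of_nonneg_left (hfM y).2 hΛ)
  have huw : Integrable fun y => |u y - w y| := by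
    refine integrable_of_bounded_of_support (A := M) (a := a) (b := b) (hu.sub hw).abs (fun y => ?_)
      fun y hy => by rw [hu0 y hy, hw0 y hy]; simp
    have h1 := huM y
    have h2 := hwM y
    rw [abs_abs, abs_le]
    constructor <;> linarith [h1.1, h1.2, h2.1, h2.2]
  rw [← integral_sub (key hu huM hu0) (key hw hwM hw0), ← integral_const_mul, ← Real.norm_eq_abs]
  refine norm_integral_le_of_norm_le (huw.const_mul _) (Eventually.of_forall fun y => ?_)
  rw [← sub_mul, Real.norm_eq_abs, abs_mul]
  have h1 := hE _ (huM y) _ (hwM y)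
  have h2 := mul_le_mul h1 (hB y) (abs_nonneg _) (by positivity)
  linarith

theorem abs_entE_sub_le (k x y : ℝ) : |entE k x - entE k y| ≤ 1 * |x - y| := by
  rw [entE, entE, one_mul]
  have := abs_abs_sub_abs_le_abs_sub (x - k) (y - k)
  simpa using this

theorem abs_entQ_sub_le {k x y : ℝ} (hk : k ∈ Icc (0 : ℝ) 1) (hx : x ∈ Icc (0 : ℝ) 1)
    (hy : y ∈ Icc (0 : ℝ) 1) : |entQ k x - entQ k y| ≤ 2 * |x - y| := by
  have e : entQ k x - entQ k y = (|x - k| - |y - k|) * (1 - x - k) + |y - k| * (y - x) := by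
    rw [entQ, entQ]; ring
  have h1 : |(|x - k| - |y - k|)| ≤ |x - y| := by
    simpa using abs_abs_sub_abs_le_abs_sub (x - k) (y - k)
  have h2 : |1 - x - k| ≤ 1 := by
    rw [abs_le]; constructor <;> linarith [hx.1, hx.2, hk.1, hk.2]
  have h3 : |y - k| ≤ 1 := by
    rw [abs_le]; constructor <;> linarith [hy.1, hy.2, hk.1, hk.2]
  rw [e]
  refine (abs_add_le _ _).trans ?_
  rw [abs_mul, abs_mul, abs_abs, abs_sub_comm y x]
  have h4 := mul_le_mul h1 h2 (abs_nonneg _) (abs_nonneg _)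
  have h5 := mul_le_mul_of_nonneg_right h3 (abs_nonneg (x - y))
  linarith

theorem abs_entE_le {k x : ℝ} (hk : k ∈ Icc (0 : ℝ) 1) (hx : x ∈ Icc (0 : ℝ) 1) :
    |entE k x| ≤ 1 := by
  have := abs_entE_sub_le k x 0
  rw [entE_zero hk.1, sub_zero, sub_zero, abs_of_nonneg hx.1] at this
  linarith [hx.2]

theorem abs_entQ_le {k x : ℝ} (hk : k ∈ Icc (0 : ℝ) 1) (hx : x ∈ Icc (0 : ℝ) 1) :
    |entQ k x| ≤ 2 := by
  have := abs_entQ_sub_le hk hx (left_mem_Icc.2 zero_le_one)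
  rw [entQ_zero hk.1, sub_zero, sub_zero, abs_of_nonneg hx.1] at this
  linarith [hx.2]

theorem measurable_entE (k : ℝ) : Measurable (entE k) := by
  unfold entE; fun_prop

theorem measurable_entQ (k : ℝ) : Measurable (entQ k) := by
  unfold entQ; fun_prop

/-- A nonnegative test function `φ` supported in `[0, T] × [-R, R]`, with its partial derivatives
`φt` and `φx`, all bounded and Lipschitz in time with constant `L`. -/
structure IsTestFn (φ φt φx : ℝ → ℝ → ℝ) (L R T : ℝ) : Prop where
  radius_nonneg : 0 ≤ R
  time_nonneg : 0 ≤ T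
  hasDerivAt_time : ∀ t y, HasDerivAt (fun s => φ s y) (φt t y) t
  hasDerivAt_space : ∀ t y, HasDerivAt (φ t) (φx t y) y
  continuous_time : Continuous (Function.uncurry φt)
  continuous_space : Continuous (Function.uncurry φx)
  mem : ∀ t y, φ t y ∈ Icc 0 L
  abs_time_le : ∀ t y, |φt t y| ≤ L
  abs_space_le : ∀ t y, |φx t y| ≤ L
  lip_time : ∀ s t y, |φt s y - φt t y| ≤ L * |s - t|
  lip_space : ∀ s t y, |φx s y - φx t y| ≤ L * |s - t|
  eq_zero : ∀ t y, y ∉ Icc (-R) R → φ t y = 0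
  time_eq_zero : ∀ t y, y ∉ Icc (-R) R → φt t y = 0
  space_eq_zero : ∀ t y, y ∉ Icc (-R) R → φx t y = 0
  zero : ∀ y, φ 0 y = 0
  late : ∀ t y, T ≤ t → φ t y = 0
  time_late : ∀ t y, T ≤ t → φt t y = 0
  space_late : ∀ t y, T ≤ t → φx t y = 0

/-- The spatial integral in the entropy inequality. -/
def entropyRate (k : ℝ) (w a b : ℝ → ℝ) : ℝ := ∫ y, (entE k (w y) * a y + entQ k (w y) * b y)

namespace IsTestFn

variable {φ φt φx : ℝ → ℝ → ℝ} {L R T k : ℝ} {w : ℝ → ℝ}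

theorem continuous (h : IsTestFn φ φt φx L R T) (t : ℝ) : Continuous (φ t) :=
  continuous_iff_continuousAt.2 fun y => (h.hasDerivAt_space t y).continuousAt

theorem bound_nonneg (h : IsTestFn φ φt φx L R T) : 0 ≤ L := (h.mem 0 0).1.trans (h.mem 0 0).2

theorem integrable_entE_mul (hk : k ∈ Icc (0 : ℝ) 1)
    (hw : Measurable w) (hw1 : ∀ y, w y ∈ Icc (0 : ℝ) 1) {ψ : ℝ → ℝ} {A : ℝ} (hψ : Measurable ψ)
    (hA : ∀ y, |ψ y| ≤ A) (h0 : ∀ y, y ∉ Icc (-R) R → ψ y = 0) :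
    Integrable fun y => entE k (w y) * ψ y := by
  refine integrable_of_bounded_of_support (A := 1 * A) (((measurable_entE k).comp hw).mul hψ)
    (fun y => ?_) fun y hy => by rw [h0 y hy, mul_zero]
  rw [abs_mul]
  exact mul_le_mul (abs_entE_le hk (hw1 y)) (hA y) (abs_nonneg _) zero_le_one

theorem integrable_entQ_mul (hk : k ∈ Icc (0 : ℝ) 1)
    (hw : Measurable w) (hw1 : ∀ y, w y ∈ Icc (0 : ℝ) 1) {ψ : ℝ → ℝ} {A : ℝ} (hψ : Measurable ψ)
    (hA : ∀ y, |ψ y| ≤ A) (h0 : ∀ y, y ∉ Icc (-R) R → ψ y = 0) :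
    Integrable fun y => entQ k (w y) * ψ y := by
  refine integrable_of_bounded_of_support (A := 2 * A) (((measurable_entQ k).comp hw).mul hψ)
    (fun y => ?_) fun y hy => by rw [h0 y hy, mul_zero]
  rw [abs_mul]
  exact mul_le_mul (abs_entQ_le hk (hw1 y)) (hA y) (abs_nonneg _) zero_le_two

theorem measurable_time (h : IsTestFn φ φt φx L R T) (t : ℝ) : Measurable (φt t) :=
  h.continuous_time.measurable.of_uncurry_left

theorem measurable_space (h : IsTestFn φ φt φx L R T) (t : ℝ) : Measurable (φx t) :=
  h.continuous_space.measurable.of_uncurry_left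

theorem entropyRate_eq (h : IsTestFn φ φt φx L R T) (hk : k ∈ Icc (0 : ℝ) 1)
    (hw : Measurable w) (hw1 : ∀ y, w y ∈ Icc (0 : ℝ) 1) (t : ℝ) :
    entropyRate k w (φt t) (φx t) = (∫ y, entE k (w y) * φt t y) + ∫ y, entQ k (w y) * φx t y :=
  integral_add
    (integrable_entE_mul hk hw hw1 (h.measurable_time t) (h.abs_time_le t) (h.time_eq_zero t))
    (integrable_entQ_mul hk hw hw1 (h.measurable_space t) (h.abs_space_le t) (h.space_eq_zero t))

theorem abs_entropyRate_le (h : IsTestFn φ φt φx L R T) (hk : k ∈ Icc (0 : ℝ) 1)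
    (hw1 : ∀ y, w y ∈ Icc (0 : ℝ) 1) (t : ℝ) :
    |entropyRate k w (φt t) (φx t)| ≤ 2 * R * (3 * L) := by
  refine abs_integral_le_of_support h.radius_nonneg (fun y => ?_) fun y hy => by
    rw [h.time_eq_zero t y hy, h.space_eq_zero t y hy]; ring
  refine (abs_add_le _ _).trans ?_
  rw [abs_mul, abs_mul]
  have h1 := mul_le_mul (abs_entE_le hk (hw1 y)) (h.abs_time_le t y) (abs_nonneg _) zero_le_one
  have h2 := mul_le_mul (abs_entQ_le hk (hw1 y)) (h.abs_space_le t y) (abs_nonneg _) zero_le_two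
  linarith

theorem entropyRate_late (h : IsTestFn φ φt φx L R T) {t : ℝ} (ht : T ≤ t) :
    entropyRate k w (φt t) (φx t) = 0 := by
  simp [entropyRate, h.time_late t _ ht, h.space_late t _ ht]

theorem measurable_entropyRate (h : IsTestFn φ φt φx L R T) {v : ℝ → ℝ → ℝ}
    (hv : Measurable (Function.uncurry v)) :
    Measurable fun t => entropyRate k (v t) (φt t) (φx t) := by
  have : Measurable fun q : ℝ × ℝ => entE k (v q.1 q.2) * φt q.1 q.2 +
      entQ k (v q.1 q.2) * φx q.1 q.2 :=
    (((measurable_entE k).comp hv).mul h.continuous_time.measurable).add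
      (((measurable_entQ k).comp hv).mul h.continuous_space.measurable)
  exact this.stronglyMeasurable.integral_prod_right'.measurable

theorem abs_increment_sub_le (h : IsTestFn φ φt φx L R T) {s t τ : ℝ} (hτ : 0 < τ)
    (hs : s ∈ Icc t (t + τ)) (y : ℝ) : |φ (t + τ) y - φ t y - τ * φt s y| ≤ τ * (L * τ) := by
  obtain ⟨c, hc, he⟩ := exists_hasDerivAt_eq_slope (fun s => φ s y) (fun s => φt s y)
    (show t < t + τ by linarith)
    (continuous_iff_continuousAt.2 fun s => (h.hasDerivAt_time s y).continuousAt).continuousOn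
    fun s _ => h.hasDerivAt_time s y
  have he' : φ (t + τ) y - φ t y = τ * φt c y := by
    rw [he, add_sub_cancel_left]; field_simp
  rw [he', ← mul_sub, abs_mul, abs_of_pos hτ]
  refine mul_le_mul_of_nonneg_left ((h.lip_time c s y).trans ?_) hτ.le
  refine mul_le_mul_of_nonneg_left ?_ h.bound_nonneg
  rw [abs_le]; constructor <;> linarith [hc.1, hc.2, hs.1, hs.2]

end IsTestFn

theorem ApproxLWR.entropy_step_le {M V p K ε τ L R T k : ℝ} {g : ℝ → ℝ} {u : ℕ → ℝ → ℝ}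
    {φ φt φx : ℝ → ℝ → ℝ} (h : ApproxLWR M V p K ε τ g u) (hM1 : M ≤ 1)
    (hφ : IsTestFn φ φt φx L R T) (hk : k ∈ Icc (0 : ℝ) 1) (j : ℕ) {s : ℝ}
    (hs : s ∈ Icc (j * τ) ((j + 1) * τ)) :
    (∫ y, entE k (u (j + 1) y) * φ ((j + 1) * τ) y) - (∫ y, entE k (u j y) * φ (j * τ) y) ≤
      τ * (entropyRate k (u j) (φt s) (φx s) + (6 * R + 1) * L * ε) := by
  have hτ := h.step_pos
  have hL := hφ.bound_nonneg
  have hR := hφ.radius_nonneg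
  have hu1 : ∀ y, u j y ∈ Icc (0 : ℝ) 1 := fun y => Icc_subset_Icc_right hM1 (h.range j y)
  have hent := h.entropy j k hk (φ ((j + 1) * τ)) (φx ((j + 1) * τ)) L
    (hφ.hasDerivAt_space _) (hφ.continuous_space.comp (Continuous.prodMk_right _))
    (hφ.abs_space_le _)
    (hφ.mem _)
  have hjτ : ((j : ℝ) + 1) * τ = j * τ + τ := by ring
  rw [hφ.entropyRate_eq hk (h.measurable j) hu1]
  have habs : ∀ t y, |φ t y| ≤ L := fun t y => by
    rw [abs_of_nonneg (hφ.mem t y).1]; exact (hφ.mem t y).2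
  have i1 := fun t => IsTestFn.integrable_entE_mul hk (h.measurable j) hu1
    (hφ.continuous t).measurable
    (habs t) (hφ.eq_zero t)
  have i2 := IsTestFn.integrable_entE_mul hk (h.measurable j) hu1 (hφ.measurable_time s)
    (hφ.abs_time_le s) (hφ.time_eq_zero s)
  have i3 := fun t => IsTestFn.integrable_entQ_mul hk (h.measurable j) hu1 (hφ.measurable_space t)
    (hφ.abs_space_le t) (hφ.space_eq_zero t)
  have e1 : |∫ y, entE k (u j y) * (φ ((j + 1) * τ) y - φ (j * τ) y - τ * φt s y)| ≤
      2 * R * (τ * (L * τ)) := by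
    refine abs_integral_le_of_support hR (fun y => ?_) fun y hy => by
      rw [hφ.eq_zero _ y hy, hφ.eq_zero _ y hy, hφ.time_eq_zero _ y hy]; ring
    rw [abs_mul]
    have a1 := abs_entE_le hk (hu1 y)
    have a2 := hφ.abs_increment_sub_le hτ (s := s) (t := j * τ) (by rwa [← hjτ]) y
    rw [hjτ]
    have := mul_le_mul a1 a2 (abs_nonneg _) zero_le_one
    linarith
  have e2 : |∫ y, entQ k (u j y) * (φx ((j + 1) * τ) y - φx s y)| ≤ 2 * R * (2 * (L * τ)) := by
    refine abs_integral_le_of_support hR (fun y => ?_) fun y hy => by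
      rw [hφ.space_eq_zero _ y hy, hφ.space_eq_zero _ y hy]; ring
    rw [abs_mul]
    refine mul_le_mul (abs_entQ_le hk (hu1 y)) ((hφ.lip_space _ _ y).trans ?_) (abs_nonneg _)
      zero_le_two
    refine mul_le_mul_of_nonneg_left ?_ hL
    rw [hjτ] at hs ⊢
    rw [abs_le]; constructor <;> linarith [hs.1, hs.2]
  simp only [mul_sub] at e1 e2
  have i4 : Integrable fun y => entE k (u j y) * (τ * φt s y) := by
    refine (i2.const_mul τ).congr (Eventually.of_forall fun y => ?_)
    ring
  have e4 : ∫ y, entE k (u j y) * (τ * φt s y) = τ * ∫ y, entE k (u j y) * φt s y := by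
    rw [← integral_const_mul]
    congr 1; funext y; ring
  have i5 := (i1 ((j + 1) * τ)).sub (i1 (j * τ))
  simp only [Pi.sub_def] at i5
  rw [integral_sub i5 i4, integral_sub (i1 _) (i1 _), e4] at e1
  rw [integral_sub (i3 _) (i3 _)] at e2
  have e1 := (abs_le.1 e1).2
  have e2 := mul_le_mul_of_nonneg_left (abs_le.1 e2).2 hτ.le
  have e3 : τ * (6 * R * L * τ) ≤ τ * (6 * R * L * ε) :=
    mul_le_mul_of_nonneg_left (mul_le_mul_of_nonneg_left h.step_le (by positivity)) hτ.le
  nlinarith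

theorem ApproxLWR.measurable_interp {M V p K ε τ : ℝ} {g : ℝ → ℝ} {u : ℕ → ℝ → ℝ}
    (h : ApproxLWR M V p K ε τ g u) : Measurable (Function.uncurry fun t => u ⌊t / τ⌋₊) := by
  have h1 : Measurable (Function.uncurry u) := measurable_from_prod_countable_right h.measurable
  exact h1.comp (((Nat.measurable_floor.comp (measurable_fst.div_const τ))).prodMk measurable_snd)

theorem ApproxLWR.entropy_integral_ge {M V p K ε τ L R T k : ℝ} {g : ℝ → ℝ} {u : ℕ → ℝ → ℝ}
    {φ φt φx : ℝ → ℝ → ℝ} (h : ApproxLWR M V p K ε τ g u) (hM1 : M ≤ 1) (hε : ε ≤ 1)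
    (hφ : IsTestFn φ φt φx L R T) (hk : k ∈ Icc (0 : ℝ) 1) :
    -((T + 1) * ((6 * R + 1) * L * ε)) ≤
      ∫ t in Ioi (0 : ℝ), entropyRate k (u ⌊t / τ⌋₊) (φt t) (φx t) := by
  have hτ := h.step_pos
  have hu1 : ∀ j y, u j y ∈ Icc (0 : ℝ) 1 := fun j y => Icc_subset_Icc_right hM1 (h.range j y)
  set H : ℝ → ℝ := fun t => entropyRate k (u ⌊t / τ⌋₊) (φt t) (φx t) with hH
  set δ := (6 * R + 1) * L * ε with hδ
  have hδ0 : 0 ≤ δ := mul_nonneg (mul_nonneg (by linarith [hφ.radius_nonneg]) hφ.bound_nonneg)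
    (hτ.le.trans h.step_le)
  have hHm : Measurable H := hφ.measurable_entropyRate h.measurable_interp
  have hHi : ∀ a b, IntervalIntegrable H volume a b := fun a b =>
    intervalIntegrable_of_mem_Icc hHm (fun t => abs_le.1 (hφ.abs_entropyRate_le hk (hu1 _) t)) a b
  set S : ℕ → ℝ := fun j => ∫ y, entE k (u j y) * φ (j * τ) y with hS
  have hstep : ∀ j : ℕ, S (j + 1) - S j - τ * δ ≤ ∫ t in (j * τ)..((j + 1 : ℕ) * τ), H t := by
    intro j
    have hle : (j : ℝ) * τ ≤ (j + 1 : ℕ) * τ := by push_cast; nlinarith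
    have h1 := intervalIntegral.integral_mono_on_of_le_Ioo hle
      (intervalIntegrable_const (c := (S (j + 1) - S j) / τ - δ)) (hHi _ _) fun t ht => by
        have hj : ⌊t / τ⌋₊ = j := by
          rw [Nat.floor_eq_iff (div_nonneg (le_trans (by positivity) ht.1.le) hτ.le)]
          rw [le_div_iff₀ hτ, div_lt_iff₀ hτ]
          exact ⟨ht.1.le, by simpa using ht.2⟩
        have h2 := h.entropy_step_le hM1 hφ hk j (s := t) ⟨ht.1.le, by simpa using ht.2.le⟩
        rw [← div_le_iff₀' hτ] at h2
        simp only [hH, hj, hS]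
        push_cast
        linarith
    refine le_trans (le_of_eq ?_) h1
    simp
    field_simp
    ring
  have hsum : ∀ J : ℕ, S J - S 0 - J * τ * δ ≤ ∫ t in (0 : ℝ)..(J * τ), H t := by
    intro J
    induction J with
    | zero => simp
    | succ J ih =>
      rw [← intervalIntegral.integral_add_adjacent_intervals (hHi _ (J * τ)) (hHi _ _)]
      have := hstep J
      push_cast at this ⊢
      linarith
  set J := ⌈T / τ⌉₊ with hJ
  have hJ1 : T ≤ J * τ := by
    rw [← div_le_iff₀ hτ]; exact Nat.le_ceil _
  have hJ2 : J * τ ≤ T + 1 := by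
    have := Nat.ceil_lt_add_one (div_nonneg hφ.time_nonneg hτ.le)
    have := mul_lt_mul_of_pos_right this hτ
    rw [add_mul, div_mul_cancel₀ _ hτ.ne'] at this
    linarith [h.step_le]
  have h3 := hsum J
  have hS0 : S 0 = 0 := by simp [hS, hφ.zero]
  have hSJ : S J = 0 := by simp [hS, hφ.late _ _ hJ1]
  rw [hS0, hSJ, intervalIntegral.integral_of_le (by positivity)] at h3
  have h4 : ∫ t in Ioi (0 : ℝ), H t = ∫ t in Ioc 0 (J * τ), H t := by
    refine setIntegral_eq_of_subset_of_forall_sdiff_eq_zero measurableSet_Ioi Ioc_subset_Ioi_self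
      fun t ht => hφ.entropyRate_late ?_
    by_contra! hc
    exact ht.2 ⟨ht.1, by linarith⟩
  rw [h4]
  have := mul_le_mul_of_nonneg_right hJ2 hδ0
  linarith

section limit

variable {M V p K : ℝ} {g : ℝ → ℝ} {r : ℝ → ℝ → ℝ} {ε τ : ℕ → ℝ} {u : ℕ → ℕ → ℝ → ℝ}

theorem IsLimitLWR.notMem (hr : IsLimitLWR M V p g r) (hM1 : M ≤ 1) {t y : ℝ} (ht : 0 ≤ t)
    (hy : y ∉ Icc p (1 + t)) : r t y = 0 := by
  have h1 : 0 ≤ (1 - M) * t := mul_nonneg (by linarith) ht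
  rw [mem_Icc, not_and_or, not_le, not_le] at hy
  rcases hy with hy | hy
  · exact hr.left t y (by linarith)
  · exact hr.right t y ht hy.le

theorem ApproxLWR.notMem {ε τ : ℝ} {u : ℕ → ℝ → ℝ} (h : ApproxLWR M V p K ε τ g u) (hM1 : M ≤ 1)
    {t y : ℝ} (ht : 0 ≤ t) (hy : y ∉ Icc p (1 + t)) : u ⌊t / τ⌋₊ y = 0 := by
  have h1 : 0 ≤ (1 - M) * (⌊t / τ⌋₊ * τ) :=
    mul_nonneg (by linarith) (mul_nonneg (Nat.cast_nonneg _) h.step_pos.le)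
  have h2 := natFloor_mul_le ht h.step_pos
  rw [mem_Icc, not_and_or, not_le, not_le] at hy
  rcases hy with hy | hy
  · exact h.left _ y (by linarith)
  · exact h.right _ y (by linarith)

theorem IsLimitLWR.tendsto_integral_comp (hr : IsLimitLWR M V p g r) (hM1 : M ≤ 1)
    (hu : ∀ n, ApproxLWR M V p K (ε n) (τ n) g (u n)) {t : ℝ} (ht : 0 ≤ t)
    (hlim : Tendsto (fun n => ∫ x, |u n ⌊t / τ n⌋₊ x - r t x|) atTop (nhds 0)) {E φ : ℝ → ℝ}
    {Λ B : ℝ} (hE : ∀ x ∈ Icc 0 M, ∀ y ∈ Icc 0 M, |E x - E y| ≤ Λ * |x - y|) (hEm : Measurable E)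
    (hE0 : E 0 = 0) (hΛ : 0 ≤ Λ) (hφ : Measurable φ) (hB : ∀ y, |φ y| ≤ B) :
    Tendsto (fun n => ∫ y, E (u n ⌊t / τ n⌋₊ y) * φ y) atTop (nhds (∫ y, E (r t y) * φ y)) := by
  rw [tendsto_iff_dist_tendsto_zero]
  refine squeeze_zero (fun _ => dist_nonneg) (fun n => ?_)
    (g := fun n => Λ * B * ∫ x, |u n ⌊t / τ n⌋₊ x - r t x|) (by simpa using hlim.const_mul (Λ * B))
  exact abs_integral_comp_mul_sub_le hE hEm hE0 hΛ ((hu n).measurable _)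
    hr.measurable.of_uncurry_left ((hu n).range _) (hr.range t) (fun y => (hu n).notMem hM1 ht)
    (fun y => hr.notMem hM1 ht) hφ hB

theorem IsLimitLWR.entropy (hr : IsLimitLWR M V p g r) (hM1 : M ≤ 1)
    (hε : Tendsto ε atTop (nhds 0)) (hu : ∀ n, ApproxLWR M V p K (ε n) (τ n) g (u n))
    (hlim : ∀ t, 0 ≤ t → Tendsto (fun n => ∫ x, |u n ⌊t / τ n⌋₊ x - r t x|) atTop (nhds 0))
    {k : ℝ} (hk : k ∈ Icc (0 : ℝ) 1) {φ φt φx : ℝ → ℝ → ℝ} {L R T : ℝ}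
    (hφ : IsTestFn φ φt φx L R T) :
    0 ≤ ∫ t in Ioi (0 : ℝ), entropyRate k (r t) (φt t) (φx t) := by
  have hu1 : ∀ n j y, u n j y ∈ Icc (0 : ℝ) 1 := fun n j y =>
    Icc_subset_Icc_right hM1 ((hu n).range j y)
  have hr1 : ∀ t y, r t y ∈ Icc (0 : ℝ) 1 := fun t y => Icc_subset_Icc_right hM1 (hr.range t y)
  have key : Tendsto (fun n => ∫ t in Ioi (0 : ℝ), entropyRate k (u n ⌊t / τ n⌋₊) (φt t) (φx t))
      atTop (nhds (∫ t in Ioi (0 : ℝ), entropyRate k (r t) (φt t) (φx t))) := by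
    refine tendsto_integral_of_dominated_convergence
      ((Ioc 0 T).indicator fun _ => 2 * R * (3 * L)) (fun n => ?_) ?_ (fun n => ?_) ?_
    · exact (hφ.measurable_entropyRate (hu n).measurable_interp).aestronglyMeasurable
    · refine Integrable.integrableOn ?_
      rw [integrable_indicator_iff measurableSet_Ioc]
      exact integrableOn_const (by simp)
    · refine (ae_restrict_iff' measurableSet_Ioi).2 (Eventually.of_forall fun t ht => ?_)
      by_cases h : t ∈ Ioc 0 T
      · rw [indicator_of_mem h]
        exact hφ.abs_entropyRate_le hk (hu1 n _) t
      · rw [indicator_of_notMem h, hφ.entropyRate_late, norm_zero]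
        by_contra! hc
        exact h ⟨ht, hc.le⟩
    · refine (ae_restrict_iff' measurableSet_Ioi).2 (Eventually.of_forall fun t ht => ?_)
      have ht : 0 ≤ t := le_of_lt ht
      rw [hφ.entropyRate_eq hk (hr.measurable.of_uncurry_left) (hr1 t)]
      refine Tendsto.congr
        (fun n => (hφ.entropyRate_eq hk ((hu n).measurable _) (hu1 n _) t).symm) ?_
      refine (hr.tendsto_integral_comp hM1 hu ht (hlim t ht) (fun x _ y _ => abs_entE_sub_le k x y)
        (measurable_entE k) (entE_zero hk.1) zero_le_one (hφ.measurable_time t)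
        (hφ.abs_time_le t)).add (hr.tendsto_integral_comp hM1 hu ht (hlim t ht)
        (fun x hx y hy => abs_entQ_sub_le hk ⟨hx.1, hx.2.trans hM1⟩ ⟨hy.1, hy.2.trans hM1⟩)
        (measurable_entQ k) (entQ_zero hk.1) zero_le_two (hφ.measurable_space t)
        (hφ.abs_space_le t))
  have h0 : Tendsto (fun n => -((T + 1) * ((6 * R + 1) * L * ε n))) atTop (nhds 0) := by
    simpa using ((hε.const_mul ((6 * R + 1) * L)).const_mul (T + 1)).neg
  refine le_of_tendsto_of_tendsto h0 key ?_
  filter_upwards [hε.eventually (gt_mem_nhds one_pos)] with n hn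
  exact (hu n).entropy_integral_ge hM1 hn.le hφ hk

theorem ApproxLWR.iterate_cost_mem {ε τ : ℝ} {u : ℕ → ℝ → ℝ} (h : ApproxLWR M V p K ε τ g u)
    {ψ : ℝ → ℝ} {L : ℝ} (hψL : ∀ y z, |ψ y - ψ z| ≤ L * |y - z|) (hψ : Continuous ψ)
    (hψa : Antitone ψ) (hψ1 : ∀ y, ψ y ∈ Icc (0 : ℝ) 1) (hL : 1 ≤ L) {i j : ℕ} (hij : i ≤ j) :
    (∫ y, excessCost (u j y) * ψ y) - (∫ y, excessCost (u i y) * ψ y) ∈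
      Icc (-(K + L * ε) * (j * τ - i * τ)) (L * ε * (j * τ - i * τ)) := by
  induction j, hij using Nat.le_induction with
  | base => simp
  | succ j _ ih =>
    have h1 := h.cost_le j ψ L hψL hψ hψa hψ1 hL
    have h2 := h.le_cost j ψ L hψL hψ hψa hψ1 hL
    push_cast
    constructor
    · linarith [ih.1]
    · linarith [ih.2]

theorem IsLimitLWR.cost_mul_sub_mem (hr : IsLimitLWR M V p g r) (hM1 : M < 1) (hK : 0 ≤ K)
    (hε : Tendsto ε atTop (nhds 0)) (hu : ∀ n, ApproxLWR M V p K (ε n) (τ n) g (u n))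
    (hlim : ∀ t, 0 ≤ t → Tendsto (fun n => ∫ x, |u n ⌊t / τ n⌋₊ x - r t x|) atTop (nhds 0))
    {ψ : ℝ → ℝ} {L : ℝ} (hψL : ∀ y z, |ψ y - ψ z| ≤ L * |y - z|) (hψ : Continuous ψ)
    (hψa : Antitone ψ) (hψ1 : ∀ y, ψ y ∈ Icc (0 : ℝ) 1) (hL : 1 ≤ L) {s t : ℝ} (hs : 0 ≤ s)
    (hst : s ≤ t) :
    (∫ y, excessCost (r t y) * ψ y) - (∫ y, excessCost (r s y) * ψ y) ∈
      Icc (-(K * (t - s))) 0 := by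
  have hEm : Measurable excessCost := by unfold excessCost; fun_prop
  have key := fun {t : ℝ} (ht : 0 ≤ t) => hr.tendsto_integral_comp hM1.le hu ht (hlim t ht)
    (Λ := 1 / (1 - M) ^ 2) (fun x hx y hy => abs_excessCost_sub_le hM1 hy.2 hx.2) hEm
    excessCost_zero (by positivity) hψ.measurable (B := 1) fun y => by
      rw [abs_of_nonneg (hψ1 y).1]; exact (hψ1 y).2
  have hsub := (key (hs.trans hst)).sub (key hs)
  have hmem := fun n => (hu n).iterate_cost_mem hψL hψ hψa hψ1 hL
    (Nat.floor_mono (div_le_div_of_nonneg_right hst (hu n).step_pos.le))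
  have hd := fun n => natFloor_mul_sub_le (hu n).step_pos hst
  have hd0 : ∀ n, 0 ≤ (⌊t / τ n⌋₊ : ℝ) * τ n - ⌊s / τ n⌋₊ * τ n := fun n => by
    rw [← sub_mul]
    refine mul_nonneg (sub_nonneg.2 ?_) (hu n).step_pos.le
    exact_mod_cast Nat.floor_mono (div_le_div_of_nonneg_right hst (hu n).step_pos.le)
  have hε0 := fun n => (hu n).step_pos.le.trans (hu n).step_le
  constructor
  · refine le_of_tendsto_of_tendsto' (f := fun n => -(K + L * ε n) * ((t - s) + ε n))
      (b := atTop) ?_ hsub fun n => ?_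
    · simpa using (((hε.const_mul L).const_add K).neg).mul (hε.const_add (t - s))
    · refine le_trans ?_ (hmem n).1
      rw [neg_mul, neg_mul, neg_le_neg_iff]
      refine mul_le_mul_of_nonneg_left ((hd n).trans ?_) ?_
      · linarith [(hu n).step_le]
      · have := hε0 n
        positivity
  · refine le_of_tendsto_of_tendsto' (g := fun n => L * ε n * ((t - s) + ε n))
      (b := atTop) hsub ?_ fun n => ?_
    · simpa using (hε.const_mul L).mul (hε.const_add (t - s))
    · refine (hmem n).2.trans (mul_le_mul_of_nonneg_left ((hd n).trans ?_) ?_)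
      · linarith [(hu n).step_le]
      · have := hε0 n
        positivity

/-- The excess cost of the part of a density in `(-∞, 1)`. -/
def totalExcess (w : ℝ → ℝ) : ℝ := ∫ y in Iio 1, excessCost (w y)

theorem IsLimitLWR.totalExcess_sub_mem (hr : IsLimitLWR M V p g r) (hM1 : M < 1) (hK : 0 ≤ K)
    (hε : Tendsto ε atTop (nhds 0)) (hu : ∀ n, ApproxLWR M V p K (ε n) (τ n) g (u n))
    (hlim : ∀ t, 0 ≤ t → Tendsto (fun n => ∫ x, |u n ⌊t / τ n⌋₊ x - r t x|) atTop (nhds 0))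
    {s t : ℝ} (hs : 0 ≤ s) (hst : s ≤ t) :
    totalExcess (r t) - totalExcess (r s) ∈ Icc (-(K * (t - s))) 0 := by
  have hEm : Measurable excessCost := by unfold excessCost; fun_prop
  have hM0 : 0 ≤ M := (hr.range 0 0).1.trans (hr.range 0 0).2
  have hcost : ∀ t y, excessCost (r t y) ∈ Icc 0 (1 / (1 - M) ^ 2) := fun t y =>
    ⟨excessCost_nonneg (hr.range t y).1 ((hr.range t y).2.trans_lt hM1),
      excessCost_le hM0 hM1 (hr.range t y).2⟩
  have hrm : ∀ t, Measurable (r t) := fun t => hr.measurable.of_uncurry_left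
  set ψ : ℕ → ℝ → ℝ := fun m y => max 0 (min 1 ((1 - y) * (m + 1))) with hψ
  have hψ1 : ∀ m y, ψ m y ∈ Icc (0 : ℝ) 1 := fun m y =>
    ⟨le_max_left _ _, max_le zero_le_one (min_le_left _ _)⟩
  have hψc : ∀ m, Continuous (ψ m) := fun m => by fun_prop
  have hψlim : ∀ y, Tendsto (fun m => ψ m y) atTop (nhds ((Iio (1 : ℝ)).indicator 1 y)) := by
    intro y
    refine tendsto_const_nhds.congr' ?_
    by_cases hy : y < 1
    · rw [indicator_of_mem (show y ∈ Iio (1 : ℝ) from hy)]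
      obtain ⟨m₀, hm₀⟩ := exists_nat_ge (1 / (1 - y))
      filter_upwards [eventually_ge_atTop m₀] with m hm
      have h1 : 1 ≤ (1 - y) * (m + 1) := by
        rw [div_le_iff₀ (by linarith)] at hm₀
        have : (m₀ : ℝ) ≤ m := by exact_mod_cast hm
        nlinarith
      simp only [hψ, min_eq_left h1, Pi.one_apply]
      norm_num
    · rw [indicator_of_notMem (show y ∉ Iio (1 : ℝ) from hy)]
      refine Eventually.of_forall fun m => ?_
      have h1 : (1 - y) * ((m : ℝ) + 1) ≤ 0 :=
        mul_nonpos_of_nonpos_of_nonneg (by linarith [not_lt.1 hy]) (by positivity)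
      simp only [hψ]
      rw [max_eq_left ((min_le_right _ _).trans h1)]
  have key : ∀ t, 0 ≤ t → Tendsto (fun m => ∫ y, excessCost (r t y) * ψ m y) atTop
      (nhds (totalExcess (r t))) := fun t ht => by
    have e : totalExcess (r t) = ∫ y, excessCost (r t y) * (Iio (1 : ℝ)).indicator 1 y := by
      rw [totalExcess, ← integral_indicator measurableSet_Iio]
      congr 1; funext y
      by_cases hy : y ∈ Iio (1 : ℝ)
      · simp [indicator_of_mem hy]
      · simp [indicator_of_notMem hy]
    rw [e]
    refine tendsto_integral_of_dominated_convergence (fun y => excessCost (r t y)) (fun m => ?_) ?_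
      (fun m => Eventually.of_forall fun y => ?_)
      (Eventually.of_forall fun y => (hψlim y).const_mul _)
    · exact ((hEm.comp (hrm t)).mul (hψc m).measurable).aestronglyMeasurable
    · refine integrable_of_bounded_of_support (A := 1 / (1 - M) ^ 2) (a := p) (b := 1 + t)
        (hEm.comp (hrm t)) (fun y => ?_) fun y hy => by
          rw [hr.notMem hM1.le ht hy, excessCost_zero]
      rw [abs_of_nonneg (hcost t y).1]; exact (hcost t y).2
    · rw [Real.norm_eq_abs, abs_mul, abs_of_nonneg (hcost t y).1, abs_of_nonneg (hψ1 m y).1]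
      exact mul_le_of_le_one_right (hcost t y).1 (hψ1 m y).2
  refine isClosed_Icc.mem_of_tendsto ((key t (hs.trans hst)).sub (key s hs))
    (Eventually.of_forall fun m => ?_)
  refine hr.cost_mul_sub_mem hM1 hK hε hu hlim (L := m + 1) (fun y z => ?_) (hψc m)
    (fun y z hyz => ?_)
    (hψ1 m) (by linarith [Nat.cast_nonneg (α := ℝ) m]) hs hst
  · simp only [hψ]
    have h1 := abs_max_sub_max_le_abs (min 1 ((1 - y) * (m + 1)))
      (min 1 ((1 - z) * ((m : ℝ) + 1))) 0
    have h2 := abs_min_sub_min_le_max 1 ((1 - y) * (m + 1)) 1 ((1 - z) * ((m : ℝ) + 1))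
    rw [sub_self, abs_zero, max_eq_right (abs_nonneg _)] at h2
    rw [max_comm 0, max_comm 0]
    refine h1.trans (h2.trans (le_of_eq ?_))
    rw [← sub_mul, abs_mul, abs_of_nonneg (show (0 : ℝ) ≤ m + 1 by positivity), mul_comm,
      abs_sub_comm y z]
    congr 2; ring
  · refine max_le_max le_rfl (min_le_min le_rfl ?_)
    exact mul_le_mul_of_nonneg_right (by linarith) (by positivity)

end limit

theorem exists_isTestFn {φ : ℝ × ℝ → ℝ} (hφ : ContDiff ℝ (⊤ : ℕ∞) φ) (hc : HasCompactSupport φ)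
    (h0 : ∀ p : ℝ × ℝ, p.1 ≤ 0 → φ p = 0) (hpos : ∀ p, 0 ≤ φ p) :
    ∃ L R T, IsTestFn (fun t x => φ (t, x)) (fun t x => fderiv ℝ φ (t, x) (1, 0))
      (fun t x => fderiv ℝ φ (t, x) (0, 1)) L R T := by
  have hd : ContDiff ℝ 1 (fderiv ℝ φ) := hφ.fderiv_right (m := 1) (by norm_cast)
  have hdiff : Differentiable ℝ φ := hφ.differentiable (by simp)
  obtain ⟨A, hA⟩ := hφ.continuous.bounded_above_of_compact_support hc
  obtain ⟨B, hB⟩ := hd.continuous.bounded_above_of_compact_support (hc.fderiv ℝ)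
  obtain ⟨C, hC⟩ := hd.lipschitzWith_of_hasCompactSupport (hc.fderiv ℝ) one_ne_zero
  obtain ⟨R, hR⟩ := hc.isCompact.isBounded.subset_closedBall 0
  have hφ0 : ∀ t x : ℝ, max |t| |x| > max R 0 → (t, x) ∉ tsupport φ := fun t x h hx => by
    have := mem_closedBall_zero_iff.1 (hR hx)
    rw [Prod.norm_mk, Real.norm_eq_abs, Real.norm_eq_abs] at this
    exact absurd (h.trans_le this) (not_lt.2 (le_max_left _ _))
  have hx : ∀ t x : ℝ, x ∉ Icc (-max R 0) (max R 0) → (t, x) ∉ tsupport φ := fun t x h => by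
    refine hφ0 t x (lt_max_of_lt_right ?_)
    rw [mem_Icc, ← abs_le, not_le] at h
    exact h
  have ht : ∀ t x : ℝ, max R 0 + 1 ≤ t → (t, x) ∉ tsupport φ := fun t x h => by
    refine hφ0 t x (lt_max_of_lt_left ?_)
    linarith [le_abs_self t]
  have hf0 : ∀ z, z ∉ tsupport φ → fderiv ℝ φ z = 0 := fun z hz =>
    image_eq_zero_of_notMem_tsupport fun h => hz (tsupport_fderiv_subset ℝ h)
  have hn1 : ‖((1, 0) : ℝ × ℝ)‖ = 1 := by simp [Prod.norm_mk]
  have hn2 : ‖((0, 1) : ℝ × ℝ)‖ = 1 := by simp [Prod.norm_mk]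
  have hle : ∀ (f : ℝ × ℝ →L[ℝ] ℝ) (e : ℝ × ℝ), ‖e‖ = 1 → |f e| ≤ ‖f‖ := fun f e he => by
    simpa [he] using f.le_opNorm e
  have hlip : ∀ s t y : ℝ, ‖fderiv ℝ φ (s, y) - fderiv ℝ φ (t, y)‖ ≤ C * |s - t| := fun s t y => by
    rw [← dist_eq_norm]
    refine (hC.dist_le_mul _ _).trans (le_of_eq ?_)
    rw [dist_eq_norm, Prod.mk_sub_mk, sub_self, Prod.norm_mk, norm_zero,
      max_eq_left (norm_nonneg _), Real.norm_eq_abs]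
  refine ⟨max A (max B C), max R 0, max R 0 + 1, le_max_right _ _,
    by linarith [le_max_right R 0], fun t y => ?_, fun t y => ?_, ?_, ?_, fun t y => ?_,
    fun t y => ?_, fun t y => ?_, fun s t y => ?_, fun s t y => ?_, fun t y hy => ?_,
    fun t y hy => ?_, fun t y hy => ?_, fun y => h0 _ le_rfl, fun t y h => ?_, fun t y h => ?_,
    fun t y h => ?_⟩
  · exact (hdiff (t, y)).hasFDerivAt.comp_hasDerivAt t
      ((hasDerivAt_id t).prodMk (hasDerivAt_const t y))
  · exact (hdiff (t, y)).hasFDerivAt.comp_hasDerivAt y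
      ((hasDerivAt_const y t).prodMk (hasDerivAt_id y))
  · exact (hd.continuous.clm_apply continuous_const)
  · exact (hd.continuous.clm_apply continuous_const)
  · exact ⟨hpos _, ((le_abs_self _).trans (hA _)).trans (le_max_left _ _)⟩
  · exact (hle _ _ hn1).trans ((hB _).trans ((le_max_left _ _).trans (le_max_right _ _)))
  · exact (hle _ _ hn2).trans ((hB _).trans ((le_max_left _ _).trans (le_max_right _ _)))
  · refine (hle (fderiv ℝ φ (s, y) - fderiv ℝ φ (t, y)) _ hn1).trans ((hlip s t y).trans ?_)
    exact mul_le_mul_of_nonneg_right ((le_max_right _ _).trans (le_max_right _ _)) (abs_nonneg _)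
  · refine (hle (fderiv ℝ φ (s, y) - fderiv ℝ φ (t, y)) _ hn2).trans ((hlip s t y).trans ?_)
    exact mul_le_mul_of_nonneg_right ((le_max_right _ _).trans (le_max_right _ _)) (abs_nonneg _)
  · exact image_eq_zero_of_notMem_tsupport (hx t y hy)
  · rw [hf0 _ (hx t y hy)]; rfl
  · rw [hf0 _ (hx t y hy)]; rfl
  · exact image_eq_zero_of_notMem_tsupport (ht t y h)
  · rw [hf0 _ (ht t y h)]; rfl
  · rw [hf0 _ (ht t y h)]; rfl

theorem IsTestFn.reflect {φ φt φx : ℝ → ℝ → ℝ} {L R T : ℝ} (h : IsTestFn φ φt φx L R T) :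
    IsTestFn (fun t x => φ t (-x)) (fun t x => φt t (-x)) (fun t x => -φx t (-x)) L R T where
  radius_nonneg := h.radius_nonneg
  time_nonneg := h.time_nonneg
  hasDerivAt_time t y := h.hasDerivAt_time t (-y)
  hasDerivAt_space t y := by
    have := (h.hasDerivAt_space t (-y)).comp y (hasDerivAt_neg y)
    rw [mul_neg_one] at this
    exact this
  continuous_time := h.continuous_time.comp (continuous_fst.prodMk continuous_snd.neg)
  continuous_space := (h.continuous_space.comp (continuous_fst.prodMk continuous_snd.neg)).neg
  mem t y := h.mem t (-y)
  abs_time_le t y := h.abs_time_le t (-y)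
  abs_space_le t y := by rw [abs_neg]; exact h.abs_space_le t (-y)
  lip_time s t y := h.lip_time s t (-y)
  lip_space s t y := by
    rw [neg_sub_neg, abs_sub_comm]; exact h.lip_space s t (-y)
  eq_zero t y hy := h.eq_zero t (-y) fun h' => hy ⟨by linarith [h'.2], by linarith [h'.1]⟩
  time_eq_zero t y hy := h.time_eq_zero t (-y) fun h' => hy ⟨by linarith [h'.2], by linarith [h'.1]⟩
  space_eq_zero t y hy := by
    rw [h.space_eq_zero t (-y) fun h' => hy ⟨by linarith [h'.2], by linarith [h'.1]⟩, neg_zero]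
  zero y := h.zero (-y)
  late t y := h.late t (-y)
  time_late t y := h.time_late t (-y)
  space_late t y ht := by rw [h.space_late t (-y) ht, neg_zero]


theorem IsTestFn.integral_space_Ioi {φ φt φx : ℝ → ℝ → ℝ} {L R T : ℝ}
    (h : IsTestFn φ φt φx L R T) (t x : ℝ) : ∫ y in Ioi x, φx t y = -φ t x := by
  have hi : Integrable (φx t) :=
    integrable_of_bounded_of_support (h.measurable_space t) (h.abs_space_le t) (h.space_eq_zero t)
  have h0 : Tendsto (φ t) atTop (nhds 0) := tendsto_const_nhds.congr' <| by
    filter_upwards [eventually_gt_atTop R] with y hy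
    exact (h.eq_zero t y fun h' => absurd h'.2 (not_le.2 hy)).symm
  rw [integral_Ioi_of_hasDerivAt_of_tendsto' (fun y _ => h.hasDerivAt_space t y) hi.integrableOn h0,
    zero_sub]

theorem IsTestFn.integral_space_Iic {φ φt φx : ℝ → ℝ → ℝ} {L R T : ℝ}
    (h : IsTestFn φ φt φx L R T) (t x : ℝ) : ∫ y in Iic x, φx t y = φ t x := by
  have hi : Integrable (φx t) :=
    integrable_of_bounded_of_support (h.measurable_space t) (h.abs_space_le t) (h.space_eq_zero t)
  have h0 : Tendsto (φ t) atBot (nhds 0) := tendsto_const_nhds.congr' <| by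
    filter_upwards [eventually_lt_atBot (-R)] with y hy
    exact (h.eq_zero t y fun h' => absurd h'.1 (not_le.2 hy)).symm
  rw [integral_Iic_of_hasDerivAt_of_tendsto' (fun y _ => h.hasDerivAt_space t y) hi.integrableOn h0,
    sub_zero]

theorem measurable_sign : Measurable Real.sign := by
  unfold Real.sign
  exact Measurable.ite measurableSet_Iio measurable_const
    (Measurable.ite measurableSet_Ioi measurable_const measurable_const)

theorem IsTestFn.integrable_sign_mul_space {φ φt φx : ℝ → ℝ → ℝ} {L R T : ℝ}
    (h : IsTestFn φ φt φx L R T) (t x : ℝ) :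
    Integrable fun y => Real.sign (y - x) * φx t y := by
  refine integrable_of_bounded_of_support (A := L)
    ((measurable_sign.comp (measurable_id.sub_const x)).mul (h.measurable_space t)) (fun y => ?_)
    fun y hy => by rw [h.space_eq_zero t y hy, mul_zero]
  rw [abs_mul]
  refine (mul_le_of_le_one_left (abs_nonneg _) ?_).trans (h.abs_space_le t y)
  rcases Real.sign_apply_eq (y - x) with e | e | e <;> rw [e] <;> norm_num

theorem IsTestFn.integral_sign_mul_space {φ φt φx : ℝ → ℝ → ℝ} {L R T : ℝ}
    (h : IsTestFn φ φt φx L R T) (t x : ℝ) : ∫ y, Real.sign (y - x) * φx t y = -2 * φ t x := by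
  have hi := h.integrable_sign_mul_space t x
  rw [← intervalIntegral.integral_Iic_add_Ioi (b := x) hi.integrableOn hi.integrableOn,
    setIntegral_congr_fun (g := fun y => φx t y) measurableSet_Ioi fun y hy => by
      rw [Real.sign_of_pos (sub_pos.2 hy), one_mul],
    integral_Iic_eq_integral_Iio,
    setIntegral_congr_fun (g := fun y => -φx t y) measurableSet_Iio fun y hy => by
      rw [Real.sign_of_neg (sub_neg.2 hy), neg_one_mul],
    integral_neg, ← integral_Iic_eq_integral_Iio, h.integral_space_Iic, h.integral_space_Ioi]
  ring

theorem IsTestFn.integrable_time_prod {φ φt φx : ℝ → ℝ → ℝ} {L R T : ℝ}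
    (h : IsTestFn φ φt φx L R T) :
    Integrable (Function.uncurry φt) ((volume.restrict (Ioi (0 : ℝ))).prod volume) := by
  have hs : MeasurableSet (Ioc (0 : ℝ) T ×ˢ Icc (-R) R) := measurableSet_Ioc.prod measurableSet_Icc
  refine Integrable.mono' (g := (Ioc (0 : ℝ) T ×ˢ Icc (-R) R).indicator fun _ => L) ?_
    h.continuous_time.measurable.aestronglyMeasurable ?_
  · rw [integrable_indicator_iff hs]
    refine integrableOn_const ?_
    rw [Measure.prod_prod]
    refine ENNReal.mul_ne_top ((Measure.restrict_apply_le _ _).trans_lt ?_).ne ?_ <;> simp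
  · have e : (volume.restrict (Ioi (0 : ℝ))).prod (volume : Measure ℝ) =
        (volume.prod volume).restrict (Ioi 0 ×ˢ univ) := by
      rw [← Measure.prod_restrict, Measure.restrict_univ]
    rw [e]
    refine (ae_restrict_iff' (measurableSet_Ioi.prod MeasurableSet.univ)).2
      (Eventually.of_forall fun q hq => ?_)
    by_cases hq' : q ∈ Ioc (0 : ℝ) T ×ˢ Icc (-R) R
    · rw [indicator_of_mem hq']; exact h.abs_time_le _ _
    · rw [indicator_of_notMem hq']
      refine le_of_eq (norm_eq_zero.2 ?_)
      change φt q.1 q.2 = 0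
      by_cases hy : q.2 ∈ Icc (-R) R
      · refine h.time_late _ _ ?_
        by_contra! hc
        exact hq' ⟨⟨hq.1, hc.le⟩, hy⟩
      · exact h.time_eq_zero _ _ hy

theorem integrableOn_Ioi_of_bounded_of_late {f : ℝ → ℝ} {A T : ℝ} (hf : Measurable f)
    (hA : ∀ t, |f t| ≤ A) (h0 : ∀ t, T ≤ t → f t = 0) : IntegrableOn f (Ioi 0) := by
  refine Integrable.mono' (g := (Ioc (0 : ℝ) T).indicator fun _ => A) ?_ hf.aestronglyMeasurable ?_
  · refine Integrable.integrableOn ?_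
    rw [integrable_indicator_iff measurableSet_Ioc]
    exact integrableOn_const (by simp)
  · refine (ae_restrict_iff' measurableSet_Ioi).2 (Eventually.of_forall fun t ht => ?_)
    by_cases ht' : t ∈ Ioc 0 T
    · rw [indicator_of_mem ht']; exact hA t
    · rw [indicator_of_notMem ht', h0, norm_zero]
      by_contra! hc
      exact ht' ⟨ht, hc.le⟩

theorem IsTestFn.integral_integral_time {φ φt φx : ℝ → ℝ → ℝ} {L R T : ℝ}
    (h : IsTestFn φ φt φx L R T) : ∫ t in Ioi (0 : ℝ), ∫ y, φt t y = 0 := by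
  rw [integral_integral_swap h.integrable_time_prod]
  refine integral_eq_zero_of_ae (Eventually.of_forall fun y => ?_)
  have hm : Measurable fun t => φt t y := h.continuous_time.measurable.of_uncurry_right
  have hi := integrableOn_Ioi_of_bounded_of_late hm (h.abs_time_le · y) (h.time_late · y)
  have h0 : Tendsto (fun t => φ t y) atTop (nhds 0) := tendsto_const_nhds.congr' <| by
    filter_upwards [eventually_ge_atTop T] with t ht
    exact (h.late t y ht).symm
  change (∫ t in Ioi (0 : ℝ), φt t y) = 0
  rw [integral_Ioi_of_hasDerivAt_of_tendsto' (fun t _ => h.hasDerivAt_time t y) hi h0, h.zero,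
    sub_zero]

/-- A density on the half line `(p, ∞)` obtained as a limit of approximate solutions, together
with its entropy inequality and the bounds on the decay of its total excess cost. -/
structure IsHalfLineSol (M V p K : ℝ) (g : ℝ → ℝ) (r : ℝ → ℝ → ℝ) : Prop
    extends IsLimitLWR M V p g r where
  entropy : ∀ k ∈ Icc (0 : ℝ) 1, ∀ (φ φt φx : ℝ → ℝ → ℝ) (L R T : ℝ), IsTestFn φ φt φx L R T →
    0 ≤ ∫ t in Ioi (0 : ℝ), entropyRate k (r t) (φt t) (φx t)
  totalExcess_sub_mem : ∀ s t, 0 ≤ s → s ≤ t →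
    totalExcess (r t) - totalExcess (r s) ∈ Icc (-(K * (t - s))) 0

theorem exists_isHalfLineSol {M p T κ : ℝ} {g P : ℝ → ℝ} (hM0 : 0 ≤ M) (hM : M ≤ 11 / 20)
    (hκ : 1 ≤ κ) (hκM : excessCost M ^ 2 ≤ κ) (hp : p ∈ Ioo (-1 : ℝ) 1) (hg : Measurable g)
    (hgM : ∀ y, g y ∈ Icc 0 M) (hg0 : ∀ y, y ∉ Ioo p 1 → g y = 0)
    (hP : Monotone P) (hPT : ∀ y, P y ∈ Icc 0 T)
    (hgP : ∀ y z, p < y → y ≤ z → z < 1 → |g z - g y| ≤ P z - P y) :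
    ∃ r, IsHalfLineSol M (2 * (M + T / 2) + 1) p (κ * (M + T / 2)) g r := by
  obtain ⟨C, hC, h⟩ := exists_approxLWR hM0 hM hκ hκM hp hg hgM hg0 hP hPT hgP
  choose τ u hu using h
  have hT : 0 ≤ T := (hPT 0).1.trans (hPT 0).2
  have hM1 : M < 1 := by linarith
  have hε : Tendsto (fun n : ℕ => C / ((n : ℝ) + 1)) atTop (nhds 0) := by
    simpa [div_eq_mul_inv] using (tendsto_one_div_add_atTop_nhds_zero_nat (𝕜 := ℝ)).const_mul C
  obtain ⟨s, hs, r, hr, hlim⟩ := exists_isLimitLWR hM1.le hp.2.le hε hu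
  have hε' := hε.comp hs.tendsto_atTop
  exact ⟨r, hr, fun k hk φ φt φx L R T hφ =>
    hr.entropy hM1.le hε' (fun n => hu (s n)) hlim hk hφ, fun a b ha hab =>
    hr.totalExcess_sub_mem hM1 (by positivity) hε' (fun n => hu (s n)) hlim ha hab⟩

namespace IsLimitLWR

variable {M V p : ℝ} {g : ℝ → ℝ} {r : ℝ → ℝ → ℝ}

theorem measurable_slice (hr : IsLimitLWR M V p g r) (t : ℝ) : Measurable (r t) :=
  hr.measurable.of_uncurry_left

theorem integrable (hr : IsLimitLWR M V p g r) (hM1 : M ≤ 1) {t : ℝ} (ht : 0 ≤ t) :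
    Integrable (r t) :=
  integrable_of_bounded_of_support (A := M) (hr.measurable_slice t)
    (fun y => by rw [abs_of_nonneg (hr.range t y).1]; exact (hr.range t y).2)
    fun _ hy => hr.notMem hM1 ht hy

theorem tendsto_integral_abs_sub (hr : IsLimitLWR M V p g r) (hM1 : M ≤ 1) (hp : p ≤ 1) {s : ℝ}
    (hs : 0 ≤ s) :
    Tendsto (fun t => ∫ x, |r t x - r s x|) (nhdsWithin s (Ici 0)) (nhds 0) := by
  have h := tendsto_integral_abs_sub_of_variation (l := nhdsWithin s (Ici 0)) (a := p - 1)
    (b := 2 + s) (p := p) (fun t => hr.variation t) hr.measurable_slice hr.range (hr.variation s)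
    (hr.measurable_slice s) (hr.range s) (by linarith) fun x => by
      rw [tendsto_iff_dist_tendsto_zero]
      refine squeeze_zero (fun _ => dist_nonneg) (fun t => hr.flux s t x) ?_
      have : Tendsto (fun t : ℝ => |t - s|) (nhds s) (nhds |s - s|) :=
        Continuous.tendsto (by fun_prop) s
      rw [sub_self, abs_zero] at this
      exact this.mono_left nhdsWithin_le_nhds
  refine h.congr' ?_
  filter_upwards [self_mem_nhdsWithin,
    nhdsWithin_le_nhds (Iio_mem_nhds (show s < s + 1 by linarith))] with t ht hts
  rw [mem_Ici] at ht
  rw [mem_Iio] at hts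
  rw [intervalIntegral.integral_of_le (by linarith)]
  refine setIntegral_eq_integral_of_forall_compl_eq_zero fun x hx => ?_
  have hx' : ∀ t', 0 ≤ t' → t' < s + 1 → r t' x = 0 := fun t' h0 h1 => by
    refine hr.notMem hM1 h0 fun h => hx ⟨?_, ?_⟩
    · linarith [h.1]
    · linarith [h.2]
  rw [hx' t ht hts, hx' s hs (by linarith), sub_self, abs_zero]

theorem init_ae (hr : IsLimitLWR M V p g r) (hg : Integrable g) (hr0 : Integrable (r 0)) :
    r 0 =ᵐ[volume] g := by
  filter_upwards [LocallyIntegrable.ae_hasDerivAt_integral hg.locallyIntegrable,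
    LocallyIntegrable.ae_hasDerivAt_integral hr0.locallyIntegrable] with x h1 h2
  have e : (fun x => ∫ z in p..x, r 0 z) = fun x => ∫ z in p..x, g z := funext hr.init
  have h2' := h2 p
  rw [e] at h2'
  exact h2'.unique (h1 p)

theorem totalExcess_eq (hr : IsLimitLWR M V p g r) {t ξ : ℝ} (hξ : ξ ≤ p + (1 - M) * t) :
    totalExcess (r t) = ∫ y in Ioo ξ 1, excessCost (r t y) := by
  rw [totalExcess, ← integral_Ico_eq_integral_Ioo]
  refine setIntegral_eq_of_subset_of_forall_sdiff_eq_zero measurableSet_Iio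
    (fun y hy => hy.2) fun y hy => ?_
  have hy1 : y < ξ := by
    by_contra! hc
    exact hy.2 ⟨hc, hy.1⟩
  rw [hr.left t y (by linarith), excessCost_zero]

theorem integral_cost_eq (hr : IsLimitLWR M V p g r) (hM1 : M < 1) {t ξ : ℝ} (hξ1 : ξ ≤ 1)
    (hξ : ξ ≤ p + (1 - M) * t) :
    ∫ y in Ioo ξ 1, 1 / (1 - r t y) = (1 - ξ) + totalExcess (r t) := by
  have hM0 : 0 ≤ M := (hr.range 0 0).1.trans (hr.range 0 0).2
  have hEm : Measurable excessCost := by unfold excessCost; fun_prop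
  have hi : IntegrableOn (fun y => excessCost (r t y)) (Ioo ξ 1) :=
    Measure.integrableOn_of_bounded (M := 1 / (1 - M) ^ 2) (by simp)
      (hEm.comp (hr.measurable_slice t)).aestronglyMeasurable <| Eventually.of_forall fun y => by
        rw [Real.norm_eq_abs,
          abs_of_nonneg (excessCost_nonneg (hr.range t y).1 ((hr.range t y).2.trans_lt hM1))]
        exact excessCost_le hM0 hM1 (hr.range t y).2
  rw [hr.totalExcess_eq hξ, setIntegral_congr_fun (g := fun y => 1 + excessCost (r t y))
    measurableSet_Ioo fun y _ => ?_]
  · have e := integral_add (μ := volume.restrict (Ioo ξ 1)) (f := fun _ => (1 : ℝ))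
      (integrableOn_const (by simp)) hi
    rw [e]
    simp [hξ1]
  · have := (hr.range t y).2
    have : 1 - r t y ≠ 0 := by linarith
    simp only [excessCost]
    field_simp
    ring

theorem totalExcess_eq_zero (hr : IsLimitLWR M V p g r) {t : ℝ} (ht : 1 ≤ p + (1 - M) * t) :
    totalExcess (r t) = 0 := by
  rw [hr.totalExcess_eq ht]; simp

theorem totalExcess_nonneg (hr : IsLimitLWR M V p g r) (hM1 : M < 1) (t : ℝ) :
    0 ≤ totalExcess (r t) :=
  integral_nonneg fun y => excessCost_nonneg (hr.range t y).1 ((hr.range t y).2.trans_lt hM1)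

end IsLimitLWR

/-- The density which agrees with `r` on `[q, ∞)` and with the reflection of `l` on `(-∞, q)`. -/
def gluedDensity (q : ℝ) (r l : ℝ → ℝ → ℝ) (t x : ℝ) : ℝ := if q ≤ x then r t x else l t (-x)

/-- The point which balances the costs of both sides. -/
def turningPoint (r l : ℝ → ℝ → ℝ) (t : ℝ) : ℝ :=
  (totalExcess (r (max t 0)) - totalExcess (l (max t 0))) / 2

theorem measurable_gluedDensity {q : ℝ} {r l : ℝ → ℝ → ℝ} (hr : Measurable (Function.uncurry r))
    (hl : Measurable (Function.uncurry l)) : Measurable (Function.uncurry (gluedDensity q r l)) :=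
  Measurable.ite (measurableSet_le measurable_const measurable_snd) hr
    (hl.comp (measurable_fst.prodMk measurable_snd.neg))

theorem HasVariationLE.glue {V q : ℝ} {u w : ℝ → ℝ} (hu : HasVariationLE V u)
    (hw : HasVariationLE V w) (hu1 : ∀ y, u y ∈ Icc (0 : ℝ) 1) (hw1 : ∀ y, w y ∈ Icc (0 : ℝ) 1) :
    HasVariationLE (2 * V + 1) fun x => if q ≤ x then u x else w (-x) := by
  obtain ⟨P, hP, hPV, huP⟩ := hu
  obtain ⟨Q, hQ, hQV, hwQ⟩ := hw
  refine ⟨fun x => P x + (V - Q (-x)) + if q ≤ x then 1 else 0, fun x y hxy => ?_, fun x => ?_,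
    fun x y hxy => ?_⟩
  · have h1 := hP hxy
    have h2 := hQ (neg_le_neg hxy)
    have h3 : (if q ≤ x then (1 : ℝ) else 0) ≤ if q ≤ y then 1 else 0 := by
      split_ifs <;> linarith
    simp only
    linarith
  · have h1 := hPV x
    have h2 := hQV (-x)
    have h3 : (if q ≤ x then (1 : ℝ) else 0) ∈ Icc (0 : ℝ) 1 := by
      split_ifs <;> norm_num
    constructor <;> linarith [h1.1, h1.2, h2.1, h2.2, h3.1, h3.2]
  · have h1 := hP hxy
    have h2 := hQ (neg_le_neg hxy)
    by_cases hx : q ≤ x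
    · have := huP x y hxy
      simp only [if_pos hx, if_pos (hx.trans hxy)]
      linarith
    · by_cases hy : q ≤ y
      · have h3 := hu1 y
        have h4 := hw1 (-x)
        simp only [if_pos hy, if_neg hx]
        rw [abs_le]
        constructor <;> linarith [h3.1, h3.2, h4.1, h4.2]
      · have := hwQ (-y) (-x) (neg_le_neg hxy)
        rw [abs_sub_comm] at this
        simp only [if_neg hx, if_neg hy]
        linarith

theorem HasVariationLE.eVariationOn_le {V : ℝ} {u : ℝ → ℝ} (hu : HasVariationLE V u) (s : Set ℝ) :
    eVariationOn u s ≤ ENNReal.ofReal V := by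
  obtain ⟨P, hP, hPV, huP⟩ := hu
  refine iSup_le fun ⟨n, v, hv, _⟩ => ?_
  calc ∑ i ∈ Finset.range n, edist (u (v (i + 1))) (u (v i))
      ≤ ∑ i ∈ Finset.range n, ENNReal.ofReal (P (v (i + 1)) - P (v i)) :=
        Finset.sum_le_sum fun i _ => by
          rw [edist_dist, Real.dist_eq]
          exact ENNReal.ofReal_le_ofReal (huP _ _ (hv i.le_succ))
    _ = ENNReal.ofReal (P (v n) - P (v 0)) := by
        rw [← ENNReal.ofReal_sum_of_nonneg fun i _ => sub_nonneg.2 (hP (hv i.le_succ)),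
          Finset.sum_range_sub fun i => P (v i)]
    _ ≤ ENNReal.ofReal V := ENNReal.ofReal_le_ofReal (by linarith [(hPV (v n)).2, (hPV (v 0)).1])

section glue

variable {M V K q : ℝ} {g g' : ℝ → ℝ} {r l : ℝ → ℝ → ℝ}

theorem gluedDensity_mem (hr : IsLimitLWR M V q g r) (hl : IsLimitLWR M V (-q) g' l) (t x : ℝ) :
    gluedDensity q r l t x ∈ Icc 0 M := by
  unfold gluedDensity
  split_ifs
  exacts [hr.range t x, hl.range t (-x)]

theorem gluedDensity_of_lt (hr : IsLimitLWR M V q g r) (hl : IsLimitLWR M V (-q) g' l) {t ξ x : ℝ}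
    (hξ : |ξ - q| ≤ (1 - M) * t) (hx : ξ < x) :
    gluedDensity q r l t x = r t x ∧ l t (-x) = 0 := by
  have h := abs_le.1 hξ
  have h0 : l t (-x) = 0 := hl.left t (-x) (by linarith [h.1])
  refine ⟨?_, h0⟩
  unfold gluedDensity
  split_ifs with hq
  · rfl
  · rw [h0, hr.left t x (by linarith [h.1, h.2])]

theorem gluedDensity_of_gt (hr : IsLimitLWR M V q g r) (hl : IsLimitLWR M V (-q) g' l) {t ξ x : ℝ}
    (hξ : |ξ - q| ≤ (1 - M) * t) (hx : x < ξ) :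
    gluedDensity q r l t x = l t (-x) ∧ r t x = 0 := by
  have h := abs_le.1 hξ
  have h0 : r t x = 0 := hr.left t x (by linarith [h.2])
  refine ⟨?_, h0⟩
  unfold gluedDensity
  split_ifs with hq
  · rw [h0, hl.left t (-x) (by linarith [h.1, h.2])]
  · rfl

theorem abs_turningPoint_sub_le (hr : IsHalfLineSol M V q K g r)
    (hl : IsHalfLineSol M V (-q) K g' l) {s t : ℝ} (hs : 0 ≤ s) (hst : s ≤ t) :
    |turningPoint r l t - turningPoint r l s| ≤ K / 2 * (t - s) := by
  rw [turningPoint, turningPoint, max_eq_left hs, max_eq_left (hs.trans hst)]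
  have h1 := hr.totalExcess_sub_mem s t hs hst
  have h2 := hl.totalExcess_sub_mem s t hs hst
  rw [abs_le]
  constructor <;> linarith [h1.1, h1.2, h2.1, h2.2]

theorem turningPoint_zero (hbal : totalExcess (r 0) - totalExcess (l 0) = 2 * q) :
    turningPoint r l 0 = q := by
  rw [turningPoint, max_self, hbal]; ring

theorem abs_turningPoint_sub_initial_le (hr : IsHalfLineSol M V q K g r)
    (hl : IsHalfLineSol M V (-q) K g' l) (hK : K ≤ 2 - 2 * M)
    (hbal : totalExcess (r 0) - totalExcess (l 0) = 2 * q) {t : ℝ} (ht : 0 ≤ t) :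
    |turningPoint r l t - q| ≤ (1 - M) * t := by
  have h := abs_turningPoint_sub_le hr hl le_rfl ht
  rw [turningPoint_zero hbal] at h
  refine h.trans ?_
  rw [sub_zero]
  exact mul_le_mul_of_nonneg_right (by linarith) ht

theorem turningPoint_mem (hr : IsHalfLineSol M V q K g r)
    (hl : IsHalfLineSol M V (-q) K g' l) (hM1 : M < 1) (hK : K ≤ 2 - 2 * M)
    (hbal : totalExcess (r 0) - totalExcess (l 0) = 2 * q) (t : ℝ) :
    turningPoint r l t ∈ Ioo (-1 : ℝ) 1 := by
  have e : turningPoint r l t = turningPoint r l (max t 0) := by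
    rw [turningPoint, turningPoint, max_eq_left (le_max_right t 0)]
  rw [e]
  generalize hs : max t 0 = s
  have hs0 : 0 ≤ s := hs ▸ le_max_right t 0
  have h := abs_le.1 (abs_turningPoint_sub_initial_le hr hl hK hbal hs0)
  have hA := hl.totalExcess_nonneg hM1 s
  have hB := hr.totalExcess_nonneg hM1 s
  have e' : turningPoint r l s = (totalExcess (r s) - totalExcess (l s)) / 2 := by
    rw [turningPoint, max_eq_left hs0]
  constructor
  · by_cases h1 : 1 ≤ -q + (1 - M) * s
    · rw [e', hl.totalExcess_eq_zero h1]; linarith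
    · linarith [h.1]
  · by_cases h1 : 1 ≤ q + (1 - M) * s
    · rw [e', hr.totalExcess_eq_zero h1]; linarith
    · linarith [h.2]

theorem turningPoint_balance (hr : IsHalfLineSol M V q K g r)
    (hl : IsHalfLineSol M V (-q) K g' l) (hM1 : M < 1) (hK : K ≤ 2 - 2 * M)
    (hbal : totalExcess (r 0) - totalExcess (l 0) = 2 * q) {t : ℝ} (ht : 0 ≤ t) :
    ∫ y in Ioo (-1 : ℝ) (turningPoint r l t), 1 / (1 - gluedDensity q r l t y) =
      ∫ y in Ioo (turningPoint r l t) 1, 1 / (1 - gluedDensity q r l t y) := by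
  have hξ := abs_turningPoint_sub_initial_le hr hl hK hbal ht
  have hmem := turningPoint_mem hr hl hM1 hK hbal t
  have e' : turningPoint r l t = (totalExcess (r t) - totalExcess (l t)) / 2 := by
    rw [turningPoint, max_eq_left ht]
  have h := abs_le.1 hξ
  generalize turningPoint r l t = ξ at hξ hmem e' h
  rw [setIntegral_congr_fun (g := fun y => 1 / (1 - r t y)) (s := Ioo ξ 1) measurableSet_Ioo
      fun y hy => by simp only [(gluedDensity_of_lt hr.1 hl.1 hξ hy.1).1],
    setIntegral_congr_fun (g := fun y => (fun z => 1 / (1 - l t z)) (-y)) measurableSet_Ioo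
      fun y hy => by simp only [(gluedDensity_of_gt hr.1 hl.1 hξ hy.2).1],
    hr.integral_cost_eq hM1 hmem.2.le (by linarith [h.2]), ← integral_Ioc_eq_integral_Ioo,
    ← intervalIntegral.integral_of_le hmem.1.le,
    intervalIntegral.integral_comp_neg fun z => 1 / (1 - l t z), neg_neg,
    intervalIntegral.integral_of_le (by linarith [hmem.1]), integral_Ioc_eq_integral_Ioo,
    hl.integral_cost_eq hM1 (by linarith [hmem.1]) (by linarith [h.1])]
  linarith

theorem continuous_turningPoint (hr : IsHalfLineSol M V q K g r)
    (hl : IsHalfLineSol M V (-q) K g' l) (hK : 0 ≤ K) : Continuous (turningPoint r l) := by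
  have hL : LipschitzWith (K / 2).toNNReal (turningPoint r l) := by
    refine LipschitzWith.of_dist_le_mul fun s t => ?_
    wlog hst : s ≤ t generalizing s t
    · rw [dist_comm, dist_comm s]; exact this t s (not_le.1 hst).le
    rw [Real.coe_toNNReal _ (by positivity), dist_comm, dist_comm s, Real.dist_eq, Real.dist_eq,
      abs_of_nonneg (sub_nonneg.2 hst)]
    have h := abs_turningPoint_sub_le hr hl (le_max_right s 0) (max_le_max_right 0 hst)
    have e : ∀ t, turningPoint r l (max t 0) = turningPoint r l t := fun t => by
      rw [turningPoint, turningPoint, max_eq_left (le_max_right t 0)]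
    rw [e, e] at h
    refine h.trans (mul_le_mul_of_nonneg_left ?_ (by positivity))
    have := abs_max_sub_max_le_abs t s 0
    rw [abs_of_nonneg (sub_nonneg.2 hst)] at this
    exact (le_abs_self _).trans this
  exact hL.continuous

theorem gluedDensity_entropyRate (hr : IsLimitLWR M V q g r) (hl : IsLimitLWR M V (-q) g' l)
    (hM1 : M ≤ 1) {ξ : ℝ → ℝ} {t : ℝ} (hξ : |ξ t - q| ≤ (1 - M) * t) {k : ℝ}
    (hk : k ∈ Icc (0 : ℝ) 1) {φ φt φx : ℝ → ℝ → ℝ} {L R T : ℝ} (hφ : IsTestFn φ φt φx L R T) :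
    ∫ x, (|gluedDensity q r l t x - k| * φt t x +
        hughesKruzhkov (fun r => 1 - r) ξ t x (gluedDensity q r l t x) k * φx t x) =
      entropyRate k (r t) (φt t) (φx t) +
        entropyRate k (l t) (fun x => φt t (-x)) (fun x => -φx t (-x)) +
        (k * ∫ x, φt t x) - 2 * (k * (1 - k)) * φ t (ξ t) := by
  have hr1 : ∀ y, r t y ∈ Icc (0 : ℝ) 1 := fun y => Icc_subset_Icc_right hM1 (hr.range t y)
  have hl1 : ∀ y, l t y ∈ Icc (0 : ℝ) 1 := fun y => Icc_subset_Icc_right hM1 (hl.range t y)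
  have hφ' := hφ.reflect
  have i1 := (IsTestFn.integrable_entE_mul hk (hr.measurable_slice t) hr1 (hφ.measurable_time t)
    (hφ.abs_time_le t) (hφ.time_eq_zero t)).add (IsTestFn.integrable_entQ_mul hk
      (hr.measurable_slice t) hr1 (hφ.measurable_space t) (hφ.abs_space_le t) (hφ.space_eq_zero t))
  have i2 := ((IsTestFn.integrable_entE_mul hk (hl.measurable_slice t) hl1 (hφ'.measurable_time t)
    (hφ'.abs_time_le t) (hφ'.time_eq_zero t)).add (IsTestFn.integrable_entQ_mul hk
      (hl.measurable_slice t) hl1 (hφ'.measurable_space t) (hφ'.abs_space_le t)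
      (hφ'.space_eq_zero t))).comp_neg
  have i3 : Integrable fun x => k * φt t x :=
    (integrable_of_bounded_of_support (hφ.measurable_time t) (hφ.abs_time_le t)
      (hφ.time_eq_zero t)).const_mul k
  have i4 := (hφ.integrable_sign_mul_space t (ξ t)).const_mul (k * (1 - k))
  have e2 : entropyRate k (l t) (fun x => φt t (-x)) (fun x => -φx t (-x)) =
      ∫ x, (entE k (l t (-x)) * φt t x + entQ k (l t (-x)) * -φx t x) := by
    rw [entropyRate, ← integral_neg_eq_self]; simp
  have e4 : -(2 * (k * (1 - k)) * φ t (ξ t)) =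
      ∫ x, k * (1 - k) * (Real.sign (x - ξ t) * φx t x) := by
    rw [integral_const_mul, hφ.integral_sign_mul_space]; ring
  rw [sub_eq_add_neg, e2, e4, ← integral_const_mul, entropyRate]
  simp only [Pi.add_def, neg_neg] at i1 i2
  have i12 := i1.add i2
  simp only [Pi.add_def] at i12
  have i123 := i12.add i3
  simp only [Pi.add_def] at i123
  rw [← integral_add i1 i2, ← integral_add i12 i3, ← integral_add i123 i4]
  refine integral_congr_ae ?_
  have hne : ∀ᵐ x : ℝ, x ≠ ξ t := by simp [ae_iff, measure_singleton]
  filter_upwards [hne] with x hx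
  have hs : ∀ z : ℝ, Real.sign (z - k) * (z - k) = |z - k| := fun z => by
    rcases lt_trichotomy (z - k) 0 with h | h | h
    · rw [Real.sign_of_neg h, abs_of_neg h]; ring
    · rw [h]; simp
    · rw [Real.sign_of_pos h, abs_of_pos h]; ring
  have hH : ∀ z, hughesKruzhkov (fun r => 1 - r) ξ t x z k =
      Real.sign (x - ξ t) * (entQ k z + k * (1 - k)) := fun z => by
    have : hughesKruzhkov (fun r => 1 - r) ξ t x z k =
        Real.sign (x - ξ t) * (Real.sign (z - k) * (z - k) * (1 - z - k)) := by
      simp only [hughesKruzhkov, hughesF, hughesFlux]; ring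
    rw [this, hs, entQ]; ring
  have hE : ∀ z, |z - k| = entE k z + k := fun z => by rw [entE]; ring
  rw [hH, hE]
  rcases lt_or_gt_of_ne hx with h | h
  · obtain ⟨h1, h2⟩ := gluedDensity_of_gt hr hl hξ h
    rw [h1, h2, entE_zero hk.1, entQ_zero hk.1, Real.sign_of_neg (sub_neg.2 h)]
    ring
  · obtain ⟨h1, h2⟩ := gluedDensity_of_lt hr hl hξ h
    rw [h1, h2, entE_zero hk.1, entQ_zero hk.1, Real.sign_of_pos (sub_pos.2 h)]
    ring

theorem IsHalfLineSol.integrableOn_entropyRate (hr : IsHalfLineSol M V q K g r) (hM1 : M ≤ 1)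
    {k : ℝ} (hk : k ∈ Icc (0 : ℝ) 1) {φ φt φx : ℝ → ℝ → ℝ} {L R T : ℝ}
    (hφ : IsTestFn φ φt φx L R T) :
    IntegrableOn (fun t => entropyRate k (r t) (φt t) (φx t)) (Ioi 0) :=
  integrableOn_Ioi_of_bounded_of_late (hφ.measurable_entropyRate hr.measurable)
    (fun t => hφ.abs_entropyRate_le hk
      (fun y => Icc_subset_Icc_right hM1 (hr.range t y)) t) fun _ ht => hφ.entropyRate_late ht

theorem gluedDensity_entropy (hr : IsHalfLineSol M V q K g r) (hl : IsHalfLineSol M V (-q) K g' l)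
    (hM1 : M ≤ 1) {ξ : ℝ → ℝ} (hξc : Continuous ξ) (hξ : ∀ t, 0 ≤ t → |ξ t - q| ≤ (1 - M) * t)
    {k : ℝ} (hk : k ∈ Icc (0 : ℝ) 1) {φ φt φx : ℝ → ℝ → ℝ} {L R T : ℝ}
    (hφ : IsTestFn φ φt φx L R T) (hφc : Continuous (Function.uncurry φ)) :
    0 ≤ (∫ t in Ioi (0 : ℝ), ∫ x, (|gluedDensity q r l t x - k| * φt t x +
        hughesKruzhkov (fun r => 1 - r) ξ t x (gluedDensity q r l t x) k * φx t x)) +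
      2 * ∫ t in Ioi (0 : ℝ), hughesFlux (fun r => 1 - r) k * φ t (ξ t) := by
  have hφ' := hφ.reflect
  have i1 := hr.integrableOn_entropyRate hM1 hk hφ
  have i2 := hl.integrableOn_entropyRate hM1 hk hφ'
  have i3 : IntegrableOn (fun t => k * ∫ x, φt t x) (Ioi 0) :=
    (hφ.integrable_time_prod.integral_prod_left).const_mul k
  have i4 : IntegrableOn (fun t => 2 * (k * (1 - k)) * φ t (ξ t)) (Ioi 0) :=
    (integrableOn_Ioi_of_bounded_of_late (A := L)
      (hφc.comp (continuous_id.prodMk hξc)).measurable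
      (fun t => by rw [abs_of_nonneg]; exacts [(hφ.mem t (ξ t)).2, (hφ.mem t (ξ t)).1])
      fun t ht => hφ.late t (ξ t) ht).const_mul _
  have i12 := i1.add i2
  have i123 := i12.add i3
  simp only [Pi.add_def] at i12 i123
  rw [setIntegral_congr_fun measurableSet_Ioi fun t ht =>
    gluedDensity_entropyRate hr.1 hl.1 hM1 (hξ t (le_of_lt ht)) hk hφ, integral_sub i123 i4,
    integral_add i12 i3, integral_add i1 i2, integral_const_mul, hφ.integral_integral_time]
  have e : (∫ t in Ioi (0 : ℝ), 2 * (k * (1 - k)) * φ t (ξ t)) =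
      2 * ∫ t in Ioi (0 : ℝ), hughesFlux (fun r => 1 - r) k * φ t (ξ t) := by
    simp only [hughesFlux, mul_assoc, integral_const_mul]
  have h1 := hr.entropy k hk _ _ _ L R T hφ
  have h2 := hl.entropy k hk _ _ _ L R T hφ'
  rw [e]
  linarith

theorem isBVEntropySol_gluedDensity (hr : IsHalfLineSol M V q K g r)
    (hl : IsHalfLineSol M V (-q) K g' l) (hM1 : M < 1) (hK0 : 0 ≤ K) (hK : K ≤ 2 - 2 * M)
    (hq : q ∈ Ioo (-1 : ℝ) 1) (hbal : totalExcess (r 0) - totalExcess (l 0) = 2 * q)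
    {ρ₀ : ℝ → ℝ}
    (hinit : ∀ᵐ x, gluedDensity q r l 0 x = if x ∈ Ioo (-1 : ℝ) 1 then ρ₀ x else 0) :
    IsBVEntropySol 1 (fun r => 1 - r) (fun r => 1 / (1 - r)) ρ₀ (gluedDensity q r l)
      (turningPoint r l) := by
  have hm := measurable_gluedDensity (q := q) hr.measurable hl.measurable
  have hsum : ∀ t, 0 ≤ t → ∀ x, x ≠ q → gluedDensity q r l t x = r t x + l t (-x) := by
    intro t ht x hx
    unfold gluedDensity
    have h0 : 0 ≤ (1 - M) * t := mul_nonneg (by linarith) ht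
    split_ifs with h
    · rw [hl.left t (-x) (by linarith [lt_of_le_of_ne h hx.symm]), add_zero]
    · rw [hr.left t x (by linarith [not_le.1 h]), zero_add]
  have hne : ∀ᵐ x : ℝ, x ≠ q := by simp [ae_iff, measure_singleton]
  have hint : ∀ t, 0 ≤ t → Integrable (gluedDensity q r l t) := fun t ht =>
    ((hr.integrable hM1.le ht).add (hl.integrable hM1.le ht).comp_neg).congr <| by
      filter_upwards [hne] with x hx
      exact (hsum t ht x hx).symm
  have hξc := continuous_turningPoint hr hl hK0
  refine ⟨⟨hm, fun t x _ => Icc_subset_Icc_right hM1.le (gluedDensity_mem hr.1 hl.1 t x), hint,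
    fun s hs => ?_, hinit, turningPoint_mem hr hl hM1 hK hbal,
    ⟨(K / 2).toNNReal, LipschitzOnWith.of_dist_le_mul fun s hs t ht => ?_⟩,
    (ae_restrict_iff' measurableSet_Ioi).2 <| Eventually.of_forall fun t ht =>
      turningPoint_balance hr hl hM1 hK hbal (le_of_lt ht),
    fun k hk φ hφ hc h0 hpos => ?_⟩, fun T _ => ⟨ENNReal.ofReal (2 * V + 1), by simp, fun t _ =>
      HasVariationLE.eVariationOn_le ((hr.variation t).glue (hl.variation t)
        (fun y => Icc_subset_Icc_right hM1.le (hr.range t y))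
        fun y => Icc_subset_Icc_right hM1.le (hl.range t y)) _⟩⟩
  · have h1 := hr.tendsto_integral_abs_sub hM1.le hq.2.le hs
    have h2 := hl.tendsto_integral_abs_sub hM1.le (by linarith [hq.1]) hs
    refine squeeze_zero' (Eventually.of_forall fun t => integral_nonneg fun x => abs_nonneg _) ?_
      (by simpa using h1.add h2)
    filter_upwards [self_mem_nhdsWithin] with t ht
    have j1 := ((hr.integrable hM1.le ht).sub (hr.integrable hM1.le hs)).abs
    have j2 := ((hl.integrable hM1.le ht).sub (hl.integrable hM1.le hs)).abs
    rw [← integral_neg_eq_self fun x => |l t x - l s x|]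
    have e := integral_add j1 j2.comp_neg
    simp only [Pi.sub_apply] at e
    rw [← e]
    refine integral_mono_ae ((hint t ht).sub (hint s hs)).abs (j1.add j2.comp_neg) ?_
    filter_upwards [hne] with x hx
    rw [hsum t ht x hx, hsum s hs x hx, add_sub_add_comm]
    exact abs_add_le _ _
  · rw [mem_Ici] at hs ht
    rw [Real.coe_toNNReal _ (by positivity), Real.dist_eq, Real.dist_eq]
    wlog hst : t ≤ s generalizing s t
    · rw [abs_sub_comm, abs_sub_comm s]; exact this t ht s hs (not_le.1 hst).le
    rw [abs_of_nonneg (sub_nonneg.2 hst)]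
    exact abs_turningPoint_sub_le hr hl ht hst
  · obtain ⟨L, R, T, hT⟩ := exists_isTestFn hφ hc h0 hpos
    exact gluedDensity_entropy hr hl hM1.le hξc
      (fun t ht => abs_turningPoint_sub_initial_le hr hl hK hbal ht) hk hT hφ.continuous

end glue

theorem totalExcess_congr {u w : ℝ → ℝ} (h : u =ᵐ[volume] w) : totalExcess u = totalExcess w :=
  integral_congr_ae <| ae_restrict_of_ae <| by
    filter_upwards [h] with x hx
    rw [hx]

theorem totalExcess_indicator_Ioo (g : ℝ → ℝ) (q : ℝ) :
    totalExcess ((Ioo q 1).indicator g) = ∫ y in Ioo q 1, excessCost (g y) := by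
  rw [totalExcess, setIntegral_eq_of_subset_of_forall_sdiff_eq_zero measurableSet_Iio
    (s := Ioo q 1) (fun y hy => hy.2) fun y hy => by
      rw [indicator_of_notMem hy.2, excessCost_zero]]
  exact setIntegral_congr_fun measurableSet_Ioo fun y hy => by simp only [indicator_of_mem hy]

theorem exists_balanced_point {E : ℝ → ℝ} {A : ℝ} (hE : Measurable E)
    (hEA : ∀ y, E y ∈ Icc 0 A) :
    ∃ q ∈ Ioo (-1 : ℝ) 1, (∫ y in Ioo q 1, E y) - (∫ y in Ioo (-q) 1, E (-y)) = 2 * q := by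
  have hi := intervalIntegrable_of_mem_Icc hE hEA
  set F : ℝ → ℝ := fun q => 2 * q - ((∫ y in q..1, E y) - ∫ y in (-1)..q, E y) with hF
  have hc : Continuous F := by
    have h1 : Continuous fun q => ∫ y in (1 : ℝ)..q, E y :=
      intervalIntegral.continuous_primitive hi 1
    have h2 : Continuous fun q => ∫ y in (-1 : ℝ)..q, E y :=
      intervalIntegral.continuous_primitive hi (-1)
    have e : F = fun q => 2 * q - (-(∫ y in (1 : ℝ)..q, E y) - ∫ y in (-1)..q, E y) := by
      funext q
      rw [hF, ← intervalIntegral.integral_symm]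
    rw [e]
    fun_prop
  have hI : 0 ≤ ∫ y in (-1 : ℝ)..1, E y :=
    intervalIntegral.integral_nonneg (by norm_num) fun y _ => (hEA y).1
  have hm : (0 : ℝ) ∈ Ioo (F (-1)) (F 1) := by
    simp only [hF, intervalIntegral.integral_same]
    constructor <;> linarith
  obtain ⟨q, hq, hq0⟩ := intermediate_value_Ioo (by norm_num) hc.continuousOn hm
  refine ⟨q, hq, ?_⟩
  rw [← integral_Ioc_eq_integral_Ioo, ← integral_Ioc_eq_integral_Ioo,
    ← intervalIntegral.integral_of_le hq.2.le,
    ← intervalIntegral.integral_of_le (by linarith [hq.1]),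
    intervalIntegral.integral_comp_neg, neg_neg]
  simp only [hF] at hq0
  linarith

theorem exists_isBVEntropySol_of_variation {M T κ : ℝ} {g P ρ₀ : ℝ → ℝ} (hM0 : 0 ≤ M)
    (hM : M ≤ 11 / 20) (hκ : 1 ≤ κ) (hκM : excessCost M ^ 2 ≤ κ)
    (hsmall : κ * (M + T / 2) ≤ 2 - 2 * M) (hg : Measurable g) (hgM : ∀ y, g y ∈ Icc 0 M)
    (hP : Monotone P) (hPT : ∀ y, P y ∈ Icc 0 T)
    (hgP : ∀ y z, -1 < y → y ≤ z → z < 1 → |g z - g y| ≤ P z - P y)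
    (hρ : ∀ᵐ x, x ∈ Ioo (-1 : ℝ) 1 → g x = ρ₀ x) :
    ∃ ρ ξ, IsBVEntropySol 1 (fun r => 1 - r) (fun r => 1 / (1 - r)) ρ₀ ρ ξ := by
  have hM1 : M < 1 := by linarith
  have hT : 0 ≤ T := (hPT 0).1.trans (hPT 0).2
  have hEm : Measurable excessCost := by unfold excessCost; fun_prop
  obtain ⟨q, hq, hbal⟩ := exists_balanced_point (E := fun y => excessCost (g y))
    (A := 1 / (1 - M) ^ 2) (hEm.comp hg) fun y =>
      ⟨excessCost_nonneg (hgM y).1 ((hgM y).2.trans_lt hM1), excessCost_le hM0 hM1 (hgM y).2⟩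
  have hgM' : ∀ {f : ℝ → ℝ} {p : ℝ}, (∀ y, f y ∈ Icc 0 M) →
      ∀ y, (Ioo p 1).indicator f y ∈ Icc 0 M := fun {f p} hf y => by
    by_cases hy : y ∈ Ioo p 1
    · rw [indicator_of_mem hy]; exact hf y
    · rw [indicator_of_notMem hy]; exact left_mem_Icc.2 hM0
  have hq' : -q ∈ Ioo (-1 : ℝ) 1 := ⟨by linarith [hq.2], by linarith [hq.1]⟩
  have hgm : Measurable fun y => g (-y) := hg.comp measurable_neg
  have hint : ∀ {f : ℝ → ℝ} {p : ℝ}, Measurable f → (∀ y, f y ∈ Icc 0 M) →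
      Integrable ((Ioo p 1).indicator f) := fun {f p} hf hfM =>
    integrable_of_bounded_of_support (A := M) (a := p) (b := 1) (hf.indicator measurableSet_Ioo)
      (fun y => by rw [abs_of_nonneg (hgM' hfM y).1]; exact (hgM' hfM y).2)
      fun y hy => indicator_of_notMem (fun h => hy ⟨h.1.le, h.2.le⟩) _
  obtain ⟨r, hr⟩ := exists_isHalfLineSol (g := (Ioo q 1).indicator g) hM0 hM hκ hκM hq
    (hg.indicator measurableSet_Ioo) (hgM' hgM) (fun y hy => indicator_of_notMem hy _) hP hPT
    fun y z hy hyz hz => by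
      rw [indicator_of_mem (show y ∈ Ioo q 1 from ⟨hy, hyz.trans_lt hz⟩),
        indicator_of_mem (show z ∈ Ioo q 1 from ⟨hy.trans_le hyz, hz⟩)]
      exact hgP y z (hq.1.trans hy) hyz hz
  obtain ⟨l, hl⟩ := exists_isHalfLineSol (g := (Ioo (-q) 1).indicator fun y => g (-y))
    (P := fun y => T - P (-y)) (T := T) hM0 hM hκ hκM hq'
    (hgm.indicator measurableSet_Ioo) (hgM' fun y => hgM (-y))
    (fun y hy => indicator_of_notMem hy _) (fun y z hyz => by
      have := hP (neg_le_neg hyz)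
      simp only
      linarith) (fun y => by
      have := hPT (-y)
      constructor <;> linarith [this.1, this.2]) fun y z hy hyz hz => by
      rw [indicator_of_mem (show y ∈ Ioo (-q) 1 from ⟨hy, hyz.trans_lt hz⟩),
        indicator_of_mem (show z ∈ Ioo (-q) 1 from ⟨hy.trans_le hyz, hz⟩), abs_sub_comm]
      have := hgP (-z) (-y) (by linarith) (by linarith) (by linarith [hq.2])
      linarith
  have hr0 := hr.init_ae (hint hg hgM) (hr.integrable hM1.le le_rfl)
  have hl0 := hl.init_ae (hint hgm fun y => hgM (-y)) (hl.integrable hM1.le le_rfl)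
  refine ⟨gluedDensity q r l, turningPoint r l, isBVEntropySol_gluedDensity hr hl hM1
    (mul_nonneg (by linarith) (by linarith)) hsmall hq ?_ ?_⟩
  · rw [totalExcess_congr hr0, totalExcess_congr hl0, totalExcess_indicator_Ioo,
      totalExcess_indicator_Ioo, hbal]
  · have hl0' : ∀ᵐ x, l 0 (-x) = (Ioo (-q) 1).indicator (fun y => g (-y)) (-x) :=
      (Measure.measurePreserving_neg (volume : Measure ℝ)).quasiMeasurePreserving.ae hl0
    have hne : ∀ᵐ x : ℝ, x ≠ q := by simp [ae_iff, measure_singleton]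
    filter_upwards [hr0, hl0', hne, hρ] with x h1 h2 h3 h4
    rw [gluedDensity, h1, h2]
    by_cases hx : x ∈ Ioo (-1 : ℝ) 1
    · rw [if_pos hx, ← h4 hx]
      split_ifs with hqx
      · exact indicator_of_mem (show x ∈ Ioo q 1 from ⟨lt_of_le_of_ne hqx h3.symm, hx.2⟩) _
      · rw [indicator_of_mem
          (show -x ∈ Ioo (-q) 1 from ⟨by linarith [not_le.1 hqx], by linarith [hx.1]⟩), neg_neg]
    · rw [if_neg hx]
      split_ifs with hqx
      · exact indicator_of_notMem (fun h => hx ⟨hq.1.trans h.1, h.2⟩) _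
      · exact indicator_of_notMem
          (fun h => hx ⟨by linarith [h.2], by linarith [h.1, hq.2]⟩) _

theorem exists_mem_Ioo_of_ae {p : ℝ → Prop} {a b : ℝ} (hab : a < b)
    (h : ∀ᵐ x, x ∈ Ioo a b → p x) : ∃ x ∈ Ioo a b, p x := by
  by_contra! hc
  have : volume (Ioo a b) = 0 :=
    measure_mono_null (fun x hx (hp : x ∈ Ioo a b → p x) => hc x hx (hp hx)) (ae_iff.1 h)
  rw [Real.volume_Ioo, ENNReal.ofReal_eq_zero] at this
  linarith

theorem BoundedVariationOn.exists_monotone {f : ℝ → ℝ} {s : Set ℝ} (h : BoundedVariationOn f s) :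
    ∃ P : ℝ → ℝ, Monotone P ∧ (∀ y, P y ∈ Icc 0 (eVariationOn f s).toReal) ∧
      ∀ y ∈ s, ∀ z ∈ s, y ≤ z → |f z - f y| ≤ P z - P y := by
  have hfin : ∀ y, eVariationOn f (s ∩ Iic y) ≠ ⊤ := fun y =>
    ne_top_of_le_ne_top h (eVariationOn.mono f inter_subset_left)
  refine ⟨fun y => (eVariationOn f (s ∩ Iic y)).toReal, fun y z hyz => ?_, fun y => ?_,
    fun y hy z hz hyz => ?_⟩
  · exact ENNReal.toReal_mono (hfin z)
      (eVariationOn.mono f (inter_subset_inter_right s (Iic_subset_Iic.2 hyz)))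
  · exact ⟨ENNReal.toReal_nonneg, ENNReal.toReal_mono h (eVariationOn.mono f inter_subset_left)⟩
  · have h1 := eVariationOn.add_le_union f (s := s ∩ Iic y) (t := {y, z}) fun a ha b hb => by
      rcases hb with rfl | rfl
      · exact ha.2
      · exact le_trans ha.2 hyz
    have h2 : s ∩ Iic y ∪ {y, z} ⊆ s ∩ Iic z := by
      rintro a (ha | rfl | rfl)
      · exact ⟨ha.1, le_trans ha.2 hyz⟩
      · exact ⟨hy, hyz⟩
      · exact ⟨hz, mem_Iic.2 le_rfl⟩
    have h3 : edist (f z) (f y) ≤ eVariationOn f {y, z} :=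
      eVariationOn.edist_le f (by simp) (by simp)
    have h4 := ((add_le_add_right h3 _).trans h1).trans (eVariationOn.mono f h2)
    have h5 := ENNReal.toReal_mono (hfin z) h4
    rw [ENNReal.toReal_add (hfin y) (edist_ne_top _ _), edist_dist,
      ENNReal.toReal_ofReal dist_nonneg, Real.dist_eq] at h5
    linarith

/-- A function of bounded variation on an interval which is almost everywhere at most `M` exceeds
any larger bound only finitely often. -/
theorem BoundedVariationOn.finite_setOf_lt {f : ℝ → ℝ} {a b M m : ℝ}
    (h : BoundedVariationOn f (Ioo a b)) (hM : ∀ᵐ x, x ∈ Ioo a b → f x ≤ M) (hm : M < m) :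
    {x ∈ Ioo a b | m < f x}.Finite := by
  obtain ⟨P, hP, hPV, hfP⟩ := h.exists_monotone
  set V := (eVariationOn f (Ioo a b)).toReal
  have hδ : 0 < m - M := sub_pos.2 hm
  have hgap : ∀ x ∈ {x ∈ Ioo a b | m < f x}, ∀ y ∈ Ioo a b, x < y → m - M ≤ P y - P x := by
    rintro x ⟨hx, hfx⟩ y hy hxy
    obtain ⟨z, hz, hfz⟩ := exists_mem_Ioo_of_ae (p := fun x => f x ≤ M) hxy <| by
      filter_upwards [hM] with z hz hz'
      exact hz ⟨hx.1.trans hz'.1, hz'.2.trans hy.2⟩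
    have h1 := hfP x hx z ⟨hx.1.trans hz.1, hz.2.trans hy.2⟩ hz.1.le
    have h2 := hP hz.2.le
    have h3 := neg_abs_le (f z - f x)
    linarith
  refine Set.Finite.of_finite_image (f := fun x => ⌊P x / (m - M)⌋) ?_ ?_
  · refine (finite_Icc (0 : ℤ) ⌊V / (m - M)⌋).subset ?_
    rintro _ ⟨x, -, rfl⟩
    exact ⟨Int.floor_nonneg.2 (div_nonneg (hPV x).1 hδ.le),
      Int.floor_mono (div_le_div_of_nonneg_right (hPV x).2 hδ.le)⟩
  · have key : ∀ x ∈ {x ∈ Ioo a b | m < f x}, ∀ y ∈ {x ∈ Ioo a b | m < f x}, x < y →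
        ⌊P x / (m - M)⌋ ≠ ⌊P y / (m - M)⌋ := fun x hx y hy hxy he => by
      have h1 := hgap x hx y hy.1 hxy
      have h2 := Int.abs_sub_lt_one_of_floor_eq_floor he.symm
      rw [← sub_div, abs_lt, div_lt_one hδ] at h2
      linarith [h2.2]
    intro x hx y hy he
    rcases lt_trichotomy x y with h | h | h
    · exact absurd he (key x hx y hy h)
    · exact h
    · exact absurd he.symm (key y hy x hx h)

theorem abs_one_div_one_sub_sub {x y : ℝ} (hx : x < 1) (hy : y < 1) :
    |1 / (1 - x) - 1 / (1 - y)| = |x - y| / ((1 - x) * (1 - y)) := by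
  have h1 : 0 < 1 - x := by linarith
  have h2 : 0 < 1 - y := by linarith
  have e : 1 / (1 - x) - 1 / (1 - y) = (x - y) / ((1 - x) * (1 - y)) := by
    field_simp
    ring
  rw [e, abs_div, abs_of_pos (mul_pos h1 h2)]

theorem BoundedVariationOn.one_div_one_sub {f : ℝ → ℝ} {a b M : ℝ}
    (h : BoundedVariationOn f (Ioo a b)) (hf : ∀ x ∈ Ioo a b, f x ≤ 1)
    (hM : ∀ᵐ x, x ∈ Ioo a b → f x ≤ M) (hM1 : M < 1) :
    BoundedVariationOn (fun x => 1 / (1 - f x)) (Ioo a b) := by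
  obtain ⟨M', hMM', hM'⟩ := exists_between hM1
  have hfin := h.finite_setOf_lt hM hMM'
  have hev : ∀ᶠ m in nhdsWithin (1 : ℝ) (Iio 1), ∀ x ∈ {x ∈ Ioo a b | M' < f x},
      f x < 1 → f x ≤ m := (eventually_all_finite hfin).2 fun x _ => by
    by_cases hx : f x < 1
    · filter_upwards [nhdsWithin_le_nhds (Ioi_mem_nhds hx)] with m hm _ using le_of_lt hm
    · exact Eventually.of_forall fun m h => absurd h hx
  have hev1 : ∀ᶠ m in nhdsWithin (1 : ℝ) (Iio 1), M' < m :=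
    nhdsWithin_le_nhds (Ioi_mem_nhds hM')
  have hev2 : ∀ᶠ m in nhdsWithin (1 : ℝ) (Iio 1), m < 1 := self_mem_nhdsWithin
  obtain ⟨m, hm, hM'm, hm1⟩ := (hev.and (hev1.and hev2)).exists
  have hd : 0 < 1 - m := sub_pos.2 hm1
  have hlip : LipschitzOnWith (1 / (1 - m) ^ 2).toNNReal (fun y : ℝ => 1 / (1 - y))
      (Iic m ∪ {1}) := by
    refine LipschitzOnWith.of_dist_le_mul fun x hx y hy => ?_
    rw [Real.coe_toNNReal _ (by positivity), Real.dist_eq, Real.dist_eq]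
    have h1 : ∀ x ≤ m, |1 / (1 - x) - 1 / (1 - 1)| ≤ 1 / (1 - m) ^ 2 * |x - 1| := fun x hx => by
      have hx' : 1 - m ≤ 1 - x := by linarith
      have hx0 : 0 < 1 - x := by linarith
      rw [sub_self, div_zero, sub_zero, abs_of_pos (by positivity), abs_sub_comm,
        abs_of_pos hx0, one_div_mul_eq_div, div_le_div_iff₀ hx0 (by positivity)]
      nlinarith
    rcases hx with hx | rfl <;> rcases hy with hy | rfl
    · rw [mem_Iic] at hx hy
      rw [abs_one_div_one_sub_sub (by linarith) (by linarith), one_div_mul_eq_div]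
      refine div_le_div_of_nonneg_left (abs_nonneg _) (by positivity) ?_
      nlinarith
    · exact h1 x hx
    · rw [abs_sub_comm, abs_sub_comm 1]; exact h1 y hy
    · simp
  exact hlip.comp_boundedVariationOn (g := f) (fun x hx => by
    rcases (hf x hx).lt_or_eq with h1 | h1
    · left
      by_cases h2 : M' < f x
      · exact hm x ⟨hx, h2⟩ h1
      · exact (not_lt.1 h2).trans hM'm.le
    · exact Or.inr h1) h

theorem abs_min_sub_min_le_abs_sub (x y M : ℝ) : |min x M - min y M| ≤ |x - y| :=
  (abs_min_sub_min_le_max x M y M).trans (by simp)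

theorem abs_min_sub_min_le_abs_cost_sub {x y M : ℝ} (hx : x ∈ Icc (0 : ℝ) 1)
    (hy : y ∈ Icc (0 : ℝ) 1) (hM : M ∈ Icc (0 : ℝ) 1) :
    |min x M - min y M| ≤ |1 / (1 - x) - 1 / (1 - y)| := by
  have key : ∀ z ∈ Icc (0 : ℝ) 1, z < 1 →
      |min 1 M - min z M| ≤ |1 / (1 - 1) - 1 / (1 - z)| := fun z hz hz1 => by
    have h1 : 0 < 1 - z := by linarith
    have h2 : 1 ≤ 1 / (1 - z) := by
      rw [le_div_iff₀ h1]
      linarith [hz.1]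
    rw [sub_self, div_zero, zero_sub, abs_neg, abs_of_pos (a := 1 / (1 - z)) (by linarith),
      min_eq_right hM.2, abs_of_nonneg (sub_nonneg.2 (min_le_right z M))]
    linarith [le_min hz.1 hM.1, hM.2]
  rcases hx.2.lt_or_eq with h1 | rfl <;> rcases hy.2.lt_or_eq with h2 | rfl
  · refine (abs_min_sub_min_le_abs_sub x y M).trans ?_
    have h3 : 0 < 1 - x := by linarith
    have h4 : 0 < 1 - y := by linarith
    rw [abs_one_div_one_sub_sub h1 h2, le_div_iff₀ (by positivity)]
    refine mul_le_of_le_one_right (abs_nonneg _) ?_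
    nlinarith [hx.1, hy.1]
  · rw [abs_sub_comm, abs_sub_comm (1 / (1 - x))]
    exact key x hx h1
  · exact key y hy h2
  · simp

theorem abs_min_sub_min_le_mul_abs_cost_sub {x y M : ℝ} (hx1 : x < 1) (hy1 : y < 1)
    (hx : 1 / 3 ≤ x) (hy : 1 / 3 ≤ y) :
    |min x M - min y M| ≤ 4 / 9 * |1 / (1 - x) - 1 / (1 - y)| := by
  refine (abs_min_sub_min_le_abs_sub x y M).trans ?_
  have h3 : 0 < 1 - x := by linarith
  have h4 : 0 < 1 - y := by linarith
  rw [abs_one_div_one_sub_sub hx1 hy1, ← mul_div_assoc, le_div_iff₀ (by positivity),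
    mul_comm (4 / 9)]
  refine mul_le_mul_of_nonneg_left ?_ (abs_nonneg _)
  nlinarith

theorem one_third_le_of_three_halves_lt_cost {x : ℝ} (h : 3 / 2 < 1 / (1 - x)) :
    1 / 3 ≤ x ∧ x < 1 := by
  have h1 : 0 < 1 - x := by
    by_contra! hc
    have := one_div_nonpos.2 hc
    linarith
  rw [lt_div_iff₀ h1] at h
  constructor <;> linarith

theorem essSup_isBounded {ρ : ℝ → ℝ} (h : ∀ x ∈ Ioo (-1 : ℝ) 1, ρ x ∈ Icc (0 : ℝ) 1) :
    IsBoundedUnder (· ≤ ·) (ae (volume.restrict (Ioo (-1 : ℝ) 1))) ρ ∧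
      IsCoboundedUnder (· ≤ ·) (ae (volume.restrict (Ioo (-1 : ℝ) 1))) ρ := by
  have hne : (ae (volume.restrict (Ioo (-1 : ℝ) 1))).NeBot := by
    rw [ae_neBot, Ne, Measure.restrict_eq_zero, Real.volume_Ioo]
    norm_num
  have hmem : ∀ᵐ x ∂volume.restrict (Ioo (-1 : ℝ) 1), ρ x ∈ Icc (0 : ℝ) 1 :=
    (ae_restrict_mem measurableSet_Ioo).mono h
  refine ⟨⟨1, eventually_map.2 (hmem.mono fun x hx => hx.2)⟩, ?_⟩
  exact IsBoundedUnder.isCoboundedUnder_le ⟨0, eventually_map.2 (hmem.mono fun x hx => hx.1)⟩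

theorem ae_le_essSup_Ioo {ρ : ℝ → ℝ} (h : ∀ x ∈ Ioo (-1 : ℝ) 1, ρ x ∈ Icc (0 : ℝ) 1) :
    ∀ᵐ x, x ∈ Ioo (-1 : ℝ) 1 → ρ x ≤ essSup ρ (volume.restrict (Ioo (-1 : ℝ) 1)) :=
  (ae_restrict_iff' measurableSet_Ioo).1 (ae_le_essSup (hf := (essSup_isBounded h).1))

theorem exists_lt_le_essSup {ρ : ℝ → ℝ} (h : ∀ x ∈ Ioo (-1 : ℝ) 1, ρ x ∈ Icc (0 : ℝ) 1)
    {m : ℝ} (hm : m < essSup ρ (volume.restrict (Ioo (-1 : ℝ) 1))) :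
    ∃ x ∈ Ioo (-1 : ℝ) 1, m < ρ x ∧ ρ x ≤ essSup ρ (volume.restrict (Ioo (-1 : ℝ) 1)) := by
  have hf : ∃ᶠ x in ae (volume.restrict (Ioo (-1 : ℝ) 1)), m < ρ x :=
    frequently_lt_of_lt_limsup (essSup_isBounded h).2 hm
  obtain ⟨x, hx, hx', hxM⟩ := (hf.and_eventually ((ae_restrict_mem measurableSet_Ioo).and
    (ae_le_essSup (hf := (essSup_isBounded h).1)))).exists
  exact ⟨x, hx', hx, hxM⟩

/-- One-sided limits at the endpoints do not exceed an almost everywhere upper bound. -/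
theorem endpoint_limit_le {ρ : ℝ → ℝ} {M a e : ℝ} (he : e = -1 ∨ e = 1)
    (hM : ∀ᵐ x, x ∈ Ioo (-1 : ℝ) 1 → ρ x ≤ M)
    (ha : Tendsto ρ (nhdsWithin e (Ioo (-1 : ℝ) 1)) (nhds a)) : a ≤ M := by
  by_contra! hc
  have hev := ha.eventually (Ioi_mem_nhds hc)
  rw [eventually_nhdsWithin_iff, Metric.eventually_nhds_iff] at hev
  obtain ⟨δ, hδ, hev⟩ := hev
  have hlt : max (-1) (e - δ) < min 1 (e + δ) := by
    rcases he with rfl | rfl <;> simp only [max_lt_iff, lt_min_iff] <;>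
      refine ⟨⟨?_, ?_⟩, ?_, ?_⟩ <;> linarith
  obtain ⟨x, hx, hxM⟩ := exists_mem_Ioo_of_ae (p := fun x => ρ x ≤ M) hlt <| by
    filter_upwards [hM] with x h1 h2
    exact h1 ⟨(le_max_left _ _).trans_lt h2.1, h2.2.trans_le (min_le_left _ _)⟩
  refine (hxM.trans_lt (hev ?_ ⟨(le_max_left _ _).trans_lt hx.1,
    hx.2.trans_le (min_le_left _ _)⟩)).false
  rw [Real.dist_eq, abs_lt]
  have h1 := (le_max_right (-1) (e - δ)).trans_lt hx.1
  have h2 := hx.2.trans_le (min_le_right 1 (e + δ))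
  constructor <;> linarith

/-- The variation of the cost controls the cost at any point relative to both endpoints. -/
theorem two_mul_cost_sub_le {ρ : ℝ → ℝ} {P : ℝ → ℝ} {T a b x : ℝ} (ha1 : a < 1) (hb1 : b < 1)
    (ha : Tendsto ρ (nhdsWithin (-1) (Ioo (-1 : ℝ) 1)) (nhds a))
    (hb : Tendsto ρ (nhdsWithin 1 (Ioo (-1 : ℝ) 1)) (nhds b))
    (hPT : ∀ y, P y ∈ Icc 0 T)
    (hfP : ∀ y ∈ Ioo (-1 : ℝ) 1, ∀ z ∈ Ioo (-1 : ℝ) 1, y ≤ z →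
      |1 / (1 - ρ z) - 1 / (1 - ρ y)| ≤ P z - P y) (hx : x ∈ Ioo (-1 : ℝ) 1) :
    2 * (1 / (1 - ρ x)) - 1 / (1 - a) - 1 / (1 - b) ≤ T := by
  have hlim : ∀ {e c : ℝ}, c < 1 → Tendsto ρ (nhdsWithin e (Ioo (-1 : ℝ) 1)) (nhds c) →
      Tendsto (fun y => 1 / (1 - ρ y)) (nhdsWithin e (Ioo (-1 : ℝ) 1)) (nhds (1 / (1 - c))) :=
    fun hc h => tendsto_const_nhds.div (tendsto_const_nhds.sub h) (by linarith)
  have hleft : 1 / (1 - ρ x) - P x ≤ 1 / (1 - a) := by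
    have : (nhdsWithin (-1 : ℝ) (Ioo (-1 : ℝ) 1)).NeBot := by
      rw [nhdsWithin_Ioo_eq_nhdsGT (by norm_num)]
      infer_instance
    refine ge_of_tendsto (hlim ha1 ha) ?_
    have h1 : ∀ᶠ y in nhdsWithin (-1 : ℝ) (Ioo (-1 : ℝ) 1), y < x :=
      nhdsWithin_le_nhds (Iio_mem_nhds hx.1)
    filter_upwards [h1, self_mem_nhdsWithin] with y hyx hy
    have := hfP y hy x hx hyx.le
    linarith [le_abs_self (1 / (1 - ρ x) - 1 / (1 - ρ y)), (hPT y).1]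
  have hright : 1 / (1 - ρ x) + P x - T ≤ 1 / (1 - b) := by
    have : (nhdsWithin (1 : ℝ) (Ioo (-1 : ℝ) 1)).NeBot := by
      rw [nhdsWithin_Ioo_eq_nhdsLT (by norm_num)]
      infer_instance
    refine ge_of_tendsto (hlim hb1 hb) ?_
    have h1 : ∀ᶠ y in nhdsWithin (1 : ℝ) (Ioo (-1 : ℝ) 1), x < y :=
      nhdsWithin_le_nhds (Ioi_mem_nhds hx.2)
    filter_upwards [h1, self_mem_nhdsWithin] with y hyx hy
    have := hfP x hx y hy hyx.le
    linarith [neg_abs_le (1 / (1 - ρ y) - 1 / (1 - ρ x)), (hPT y).2]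
  linarith

/-- Theorem 3 of Amadori–Goatin–Rosini (wave-front tracking existence):
with `v(ρ) = 1 − ρ`, `c(ρ) = 1/(1 − ρ)`, `ρ_max = 1`, if `ρ₀ ∈ BV((−1,1);[0,1])`,
`‖ρ₀‖_∞ < 1`, with one-sided limits `a = ρ₀(−1⁺)`, `b = ρ₀(1⁻)`, and
`3‖ρ₀‖_∞ + TV(c∘ρ₀) + [c(a) − c(1/2)]₊ + [c(b) − c(1/2)]₊ < 2`
(here `c(1/2) = 2`), then a global-in-time BV-regular entropy solution exists. -/
theorem hughes_WFT_existence
    (ρ₀ : ℝ → ℝ) (hmeas : Measurable ρ₀)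
    (hrange : ∀ x ∈ Ioo (-1 : ℝ) 1, ρ₀ x ∈ Icc (0 : ℝ) 1)
    (hBV : BoundedVariationOn ρ₀ (Ioo (-1 : ℝ) 1))
    (M : ℝ) (hM : M = essSup ρ₀ (volume.restrict (Ioo (-1 : ℝ) 1))) (hM1 : M < 1)
    (a b : ℝ)
    (ha : Tendsto ρ₀ (nhdsWithin (-1) (Ioo (-1 : ℝ) 1)) (nhds a))
    (hb : Tendsto ρ₀ (nhdsWithin 1 (Ioo (-1 : ℝ) 1)) (nhds b))
    (hsmall : 3 * M + (eVariationOn (fun x => 1 / (1 - ρ₀ x)) (Ioo (-1 : ℝ) 1)).toReal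
        + max (1 / (1 - a) - 2) 0 + max (1 / (1 - b) - 2) 0 < 2) :
    ∃ ρ : ℝ → ℝ → ℝ, ∃ ξ : ℝ → ℝ,
      IsBVEntropySol 1 (fun r => 1 - r) (fun r => 1 / (1 - r)) ρ₀ ρ ξ := by
  have hle : ∀ᵐ x, x ∈ Ioo (-1 : ℝ) 1 → ρ₀ x ≤ M := hM ▸ ae_le_essSup_Ioo hrange
  have hM0 : 0 ≤ M := by
    obtain ⟨x, hx, hxM⟩ := exists_mem_Ioo_of_ae (p := fun x => ρ₀ x ≤ M) (by norm_num) hle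
    exact (hrange x hx).1.trans hxM
  obtain ⟨P, hP, hPT, hfP⟩ :=
    (hBV.one_div_one_sub (fun x hx => (hrange x hx).2) hle hM1).exists_monotone
  set T := (eVariationOn (fun x => 1 / (1 - ρ₀ x)) (Ioo (-1 : ℝ) 1)).toReal
  have hmax1 := le_max_right (1 / (1 - a) - 2) 0
  have hmax2 := le_max_right (1 / (1 - b) - 2) 0
  have hT : T < 2 - 3 * M := by linarith
  obtain ⟨g, hg, hgM, hgI, hgρ⟩ : ∃ g : ℝ → ℝ, Measurable g ∧ (∀ y, g y ∈ Icc 0 M) ∧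
      (∀ y ∈ Ioo (-1 : ℝ) 1, g y = min (ρ₀ y) M) ∧ ∀ᵐ x, x ∈ Ioo (-1 : ℝ) 1 → g x = ρ₀ x := by
    refine ⟨(Ioo (-1 : ℝ) 1).indicator fun x => min (ρ₀ x) M,
      (hmeas.min measurable_const).indicator measurableSet_Ioo, fun y => ?_,
      fun y hy => indicator_of_mem hy _, ?_⟩
    · by_cases hy : y ∈ Ioo (-1 : ℝ) 1
      · rw [indicator_of_mem hy]
        exact ⟨le_min (hrange y hy).1 hM0, min_le_right _ _⟩
      · rw [indicator_of_notMem hy]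
        exact ⟨le_rfl, hM0⟩
    · filter_upwards [hle] with x hx hx'
      rw [indicator_of_mem hx', min_eq_left (hx hx')]
  rcases le_or_gt M (1 / 2) with hMh | hMh
  · refine exists_isBVEntropySol_of_variation (M := M) (T := T) (κ := 1) hM0 (by linarith) le_rfl
      ?_ (by linarith) hg hgM hP hPT (fun y z hy hyz hz => ?_) hgρ
    · refine pow_le_one₀ (excessCost_nonneg hM0 hM1) ?_
      rw [excessCost, div_le_one (by linarith)]
      linarith
    · have hy' : y ∈ Ioo (-1 : ℝ) 1 := ⟨hy, hyz.trans_lt hz⟩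
      have hz' : z ∈ Ioo (-1 : ℝ) 1 := ⟨hy.trans_le hyz, hz⟩
      rw [hgI y hy', hgI z hz']
      exact (abs_min_sub_min_le_abs_cost_sub (hrange z hz') (hrange y hy') ⟨hM0, hM1.le⟩).trans
        (hfP y hy' z hz' hyz)
  · have hu : 0 < 1 - M := by linarith
    have hcost : 3 * M + 2 * (1 / (1 - M)) ≤ 6 := by
      by_contra! hc
      have hcont : Tendsto (fun m : ℝ => 3 * M + 2 * (1 / (1 - m))) (nhdsWithin M (Iio M))
          (nhds (3 * M + 2 * (1 / (1 - M)))) := by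
        refine Tendsto.mono_left ?_ nhdsWithin_le_nhds
        exact tendsto_const_nhds.add (tendsto_const_nhds.mul
          (tendsto_const_nhds.div (tendsto_const_nhds.sub tendsto_id) hu.ne'))
      have hM' : ∀ᶠ m in nhdsWithin M (Iio M), m < M := self_mem_nhdsWithin
      obtain ⟨m, hm6, hmM⟩ := ((hcont.eventually (lt_mem_nhds hc)).and hM').exists
      obtain ⟨x, hx, hmx, hxM⟩ := exists_lt_le_essSup hrange (hM ▸ hmM)
      rw [← hM] at hxM
      have h1 := two_mul_cost_sub_le ((endpoint_limit_le (Or.inl rfl) hle ha).trans_lt hM1)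
        ((endpoint_limit_le (Or.inr rfl) hle hb).trans_lt hM1) ha hb hPT hfP hx
      have h2 : 1 / (1 - m) ≤ 1 / (1 - ρ₀ x) :=
        one_div_le_one_div_of_le (by linarith) (by linarith)
      linarith [le_max_left (1 / (1 - a) - 2) 0, le_max_left (1 / (1 - b) - 2) 0]
    have hM545 : M ≤ 109 / 200 := by
      have h1 : 2 * (1 / (1 - M)) = 2 / (1 - M) := by ring
      have h2 : 2 / (1 - M) ≤ 6 - 3 * M := by linarith
      rw [div_le_iff₀ hu] at h2
      nlinarith
    obtain ⟨x, hx, hxh, hxM⟩ := exists_lt_le_essSup hrange (hM ▸ hMh)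
    rw [← hM] at hxM
    have hfx : 2 ≤ 1 / (1 - ρ₀ x) := by
      rw [le_div_iff₀ (by linarith)]
      linarith
    have hthird : ∀ y ∈ Ioo (-1 : ℝ) 1, 1 / 3 ≤ ρ₀ y ∧ ρ₀ y < 1 := fun y hy => by
      refine one_third_le_of_three_halves_lt_cost ?_
      rcases le_total x y with hxy | hxy
      · linarith [hfP x hx y hy hxy, neg_abs_le (1 / (1 - ρ₀ y) - 1 / (1 - ρ₀ x)), (hPT x).1,
          (hPT y).2]
      · linarith [hfP y hy x hx hxy, le_abs_self (1 / (1 - ρ₀ x) - 1 / (1 - ρ₀ y)), (hPT y).1,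
          (hPT x).2]
    refine exists_isBVEntropySol_of_variation (M := M) (T := 4 / 9 * T)
      (P := fun y => 4 / 9 * P y) (κ := excessCost M ^ 2) hM0 (by linarith) ?_ le_rfl ?_ hg hgM
      (hP.const_mul (by norm_num)) (fun y => ⟨?_, ?_⟩) (fun y z hy hyz hz => ?_) hgρ
    · refine one_le_pow₀ ?_
      rw [excessCost, one_le_div hu]
      linarith
    · have h1 : M + 4 / 9 * T / 2 ≤ M / 3 + 4 / 9 := by linarith
      refine (mul_le_mul_of_nonneg_left h1 (sq_nonneg _)).trans ?_
      rw [excessCost, div_pow, div_mul_eq_mul_div, div_le_iff₀ (by positivity)]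
      have h2 : M ^ 2 * (M / 3 + 4 / 9) ≤ (109 / 200) ^ 2 * (109 / 200 / 3 + 4 / 9) := by gcongr
      have h3 : (91 / 200 : ℝ) ^ 3 ≤ (1 - M) ^ 3 := by
        gcongr
        linarith
      linarith
    · linarith [(hPT y).1]
    · linarith [(hPT y).2]
    · have hy' : y ∈ Ioo (-1 : ℝ) 1 := ⟨hy, hyz.trans_lt hz⟩
      have hz' : z ∈ Ioo (-1 : ℝ) 1 := ⟨hy.trans_le hyz, hz⟩
      rw [hgI y hy', hgI z hz']
      refine (abs_min_sub_min_le_mul_abs_cost_sub (hthird z hz').2 (hthird y hy').2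
        (hthird z hz').1 (hthird y hy').1).trans ?_
      linarith [hfP y hy' z hz' hyz]

end
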